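/- arXiv:1809.05446 — 2 statements merged into one kernel-verified Lean document; each statement's English description precedes it below -/
import Mathlib

section
/- Let ζ ∈ B(ω,R) be a zero of f = (f₁,…,f_n) ∈ A²(ω,R)^n with Df(ζ) invertible; write γ = γ(f,ζ), κ = κ_ζ, and for x ∈ B(ω,R) set u = κ‖x − ζ‖. If u < 1 − √(γ/(1 + γ)), then Df(x) is invertible and the Newton iterate satisfies ‖N_f(x) − ζ‖ ≤ γ u² / ( (1 + γ)(1 − u)² − γ ). -/
open MeasureTheory Metric

noncomputable section

/-- `ℂⁿ` with the Euclidean (Hermitian) norm. -/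
abbrev En (n : ℕ) := EuclideanSpace ℂ (Fin n)

instance (n : ℕ) : InnerProductSpace ℝ (En n) := InnerProductSpace.rclikeToReal ℂ _
instance (n : ℕ) : MeasurableSpace (En n) := borel _
instance (n : ℕ) : BorelSpace (En n) := ⟨rfl⟩

/-- The `A²(ω,R)` norm: `‖f‖² = (n!/(πⁿ R^{2n})) ∫_{B(ω,R)} ‖f(z)‖² dz`.  For a system
`f = (f₁,…,f_s) : ℂⁿ → ℂˢ` (with `ℂˢ` carrying the Euclidean norm) this is exactly
`(Σᵢ ‖fᵢ‖²)^{1/2}`. -/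
def A2Norm {𝓕 : Type*} [NormedAddCommGroup 𝓕] {n : ℕ} (ω : En n) (R : ℝ)
    (f : En n → 𝓕) : ℝ :=
  Real.sqrt (((n.factorial : ℝ) / (Real.pi ^ n * R ^ (2 * n))) * ∫ z in ball ω R, ‖f z‖ ^ 2)

/-- Membership in `A²(ω,R)`: analytic on the open ball `B(ω,R)` and square integrable there. -/
def MemA2 {𝓕 : Type*} [NormedAddCommGroup 𝓕] [NormedSpace ℂ 𝓕] {n : ℕ}
    (ω : En n) (R : ℝ) (f : En n → 𝓕) : Prop :=
  AnalyticOnNhd ℂ f (ball ω R) ∧ IntegrableOn (fun z => ‖f z‖ ^ 2) (ball ω R)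

theorem finrank_real_En (n : ℕ) : Module.finrank ℝ (En n) = 2 * n := by
  rw [← Module.finrank_mul_finrank ℝ ℂ (En n), Complex.finrank_real_complex]
  simp

theorem setIntegral_ball_of_homogeneous {n : ℕ} {h : En n → ℝ} {k : ℕ}
    (hh : ∀ (r : ℝ) (z : En n), h (r • z) = r ^ k * h z) {r : ℝ} (hr : 0 < r) :
    ∫ z in ball (0 : En n) r, h z = r ^ (2 * n + k) * ∫ z in ball (0 : En n) 1, h z := by
  have := Measure.setIntegral_comp_smul_of_pos (volume : Measure (En n)) h (ball 0 1) hr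
  rw [smul_unitBall_of_pos hr, finrank_real_En] at this
  simp only [hh, integral_const_mul, smul_eq_mul] at this
  rw [pow_add, mul_assoc, this, ← mul_assoc, mul_inv_cancel₀ (by positivity), one_mul]

theorem lintegral_exp_neg_Ioi (s : ℝ) :
    ∫⁻ t in Set.Ioi s, ENNReal.ofReal (Real.exp (-t)) = ENNReal.ofReal (Real.exp (-s)) := by
  rw [← ofReal_integral_eq_lintegral_ofReal, integral_exp_neg_Ioi]
  · exact integrableOn_exp_neg_Ioi s
  · exact Filter.Eventually.of_forall fun t => (Real.exp_pos _).le

theorem lintegral_exp_neg_mul_pow (m : ℕ) :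
    ∫⁻ t in Set.Ioi (0 : ℝ), ENNReal.ofReal (Real.exp (-t) * t ^ m) =
      ENNReal.ofReal (m.factorial : ℝ) := by
  have hG := Real.Gamma_nat_eq_factorial m
  have hI := Real.GammaIntegral_convergent (s := (m : ℝ) + 1) (by positivity)
  rw [Real.Gamma_eq_integral (by positivity)] at hG
  simp only [add_sub_cancel_right, Real.rpow_natCast] at hG hI
  rw [← ofReal_integral_eq_lintegral_ofReal hI, hG]
  filter_upwards [ae_restrict_mem measurableSet_Ioi] with t ht
  have : (0 : ℝ) < t := ht
  positivity

theorem integral_mul_exp_neg_of_homogeneous {n : ℕ} {h : En n → ℝ} {k : ℕ} (hc : Continuous h)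
    (h0 : ∀ z, 0 ≤ h z) (hh : ∀ (r : ℝ) (z : En n), h (r • z) = r ^ (2 * k) * h z) :
    ∫ z, h z * Real.exp (-‖z‖ ^ 2) =
      ((n + k).factorial : ℝ) * ∫ z in ball (0 : En n) 1, h z := by
  set L := ∫ z in ball (0 : En n) 1, h z
  have hL : 0 ≤ L := integral_nonneg h0
  have hball : ∀ t ∈ Set.Ioi (0 : ℝ), ∫⁻ z in ball (0 : En n) (√t), ENNReal.ofReal (h z) =
      ENNReal.ofReal (t ^ (n + k) * L) := by
    intro t ht
    rw [← ofReal_integral_eq_lintegral_ofReal,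
      setIntegral_ball_of_homogeneous hh (Real.sqrt_pos.2 ht),
      ← mul_add, pow_mul, Real.sq_sqrt (le_of_lt ht)]
    · exact (hc.continuousOn.integrableOn_compact (isCompact_closedBall 0 (√t))).mono_set
        ball_subset_closedBall
    · exact Filter.Eventually.of_forall h0
  have key : ∫⁻ z, ENNReal.ofReal (h z * Real.exp (-‖z‖ ^ 2)) =
      ENNReal.ofReal (((n + k).factorial : ℝ) * L) := by
    calc ∫⁻ z, ENNReal.ofReal (h z * Real.exp (-‖z‖ ^ 2))
        = ∫⁻ z, ∫⁻ t in Set.Ioi (0 : ℝ), (ball (0 : En n) (√t)).indicator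
            (fun z => ENNReal.ofReal (h z) * ENNReal.ofReal (Real.exp (-t))) z := by
          refine lintegral_congr fun z => ?_
          rw [ENNReal.ofReal_mul (h0 z), ← lintegral_exp_neg_Ioi,
            ← lintegral_const_mul _ (by fun_prop),
            ← lintegral_indicator measurableSet_Ioi, ← lintegral_indicator measurableSet_Ioi]
          refine lintegral_congr fun t => ?_
          have : z ∈ ball (0 : En n) (√t) ↔ t ∈ Set.Ioi (‖z‖ ^ 2) := by
            simp [Real.lt_sqrt]
          by_cases ht : t ∈ Set.Ioi (‖z‖ ^ 2)
          · rw [Set.indicator_of_mem ht, Set.indicator_of_mem, Set.indicator_of_mem (this.2 ht)]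
            exact lt_of_le_of_lt (sq_nonneg ‖z‖) (Set.mem_Ioi.1 ht)
          · rw [Set.indicator_of_notMem ht, Set.indicator_apply,
              Set.indicator_of_notMem (mt this.1 ht)]
            simp
      _ = ∫⁻ t in Set.Ioi (0 : ℝ), ∫⁻ z, (ball (0 : En n) (√t)).indicator
            (fun z => ENNReal.ofReal (h z) * ENNReal.ofReal (Real.exp (-t))) z := by
          rw [lintegral_lintegral_swap]
          refine Measurable.aemeasurable ?_
          have hm : MeasurableSet {p : En n × ℝ | ‖p.1‖ < √p.2} :=
            measurableSet_lt (by fun_prop) (by fun_prop)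
          have : (Function.uncurry fun (z : En n) (t : ℝ) => (ball (0 : En n) (√t)).indicator
            (fun z => ENNReal.ofReal (h z) * ENNReal.ofReal (Real.exp (-t))) z) =
            {p : En n × ℝ | ‖p.1‖ < √p.2}.indicator
              (fun p => ENNReal.ofReal (h p.1) * ENNReal.ofReal (Real.exp (-p.2))) := by
            ext ⟨z, t⟩
            by_cases hz : ‖z‖ < √t <;> simp [Function.uncurry, Set.indicator, hz]
          rw [this]
          exact Measurable.indicator (by have := hc.measurable; fun_prop) hm
      _ = ∫⁻ t in Set.Ioi (0 : ℝ),
          ENNReal.ofReal (Real.exp (-t) * t ^ (n + k)) * ENNReal.ofReal L := by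
          refine setLIntegral_congr_fun measurableSet_Ioi fun t ht => ?_
          have ht' : (0 : ℝ) < t := ht
          rw [lintegral_indicator measurableSet_ball,
            lintegral_mul_const _ (by have := hc.measurable; fun_prop), hball t ht, mul_comm,
            ← ENNReal.ofReal_mul (by positivity), ← ENNReal.ofReal_mul (by positivity), mul_assoc]
      _ = _ := by
          rw [lintegral_mul_const _ (by fun_prop), lintegral_exp_neg_mul_pow,
            ENNReal.ofReal_mul (by positivity)]
  rw [integral_eq_lintegral_of_nonneg_ae, key, ENNReal.toReal_ofReal (by positivity)]
  · exact Filter.Eventually.of_forall fun z => mul_nonneg (h0 z) (Real.exp_pos _).le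
  · exact Continuous.aestronglyMeasurable (by fun_prop)

theorem integral_norm_pow_mul_exp (m : ℕ) :
    ∫ z : ℂ, ‖z‖ ^ (2 * m) * Real.exp (-‖z‖ ^ 2) = Real.pi * m.factorial := by
  have := Complex.integral_rpow_mul_exp_neg_rpow (p := 2) (q := ((2 * m : ℕ) : ℝ)) (by norm_num)
    (by have : (0 : ℝ) ≤ ((2 * m : ℕ) : ℝ) := by positivity
        linarith)
  simp only [Real.rpow_natCast, Real.rpow_ofNat] at this
  rw [this, ← Real.Gamma_nat_eq_factorial]
  congr 1
  · ring
  · congr 1; push_cast; ring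

theorem integral_pi_gaussian_moment {n : ℕ} (i₀ : Fin n) (k : ℕ) :
    ∫ x : Fin n → ℂ, ‖x i₀‖ ^ (2 * k) * Real.exp (-∑ i, ‖x i‖ ^ 2) =
      Real.pi ^ n * k.factorial := by
  have := integral_fintype_prod_volume_eq_prod (𝕜 := ℝ)
    (fun (i : Fin n) (z : ℂ) => ‖z‖ ^ (2 * if i = i₀ then k else 0) * Real.exp (-‖z‖ ^ 2))
  simp only [integral_norm_pow_mul_exp] at this
  rw [Finset.prod_mul_distrib] at this
  simp only [Finset.prod_const, Finset.card_univ, Fintype.card_fin, apply_ite Nat.factorial,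
    Nat.factorial_zero, apply_ite (Nat.cast : ℕ → ℝ), Nat.cast_one, Finset.prod_ite_eq',
    Finset.mem_univ, if_true] at this
  rw [← this]
  refine integral_congr_ae (Filter.Eventually.of_forall fun x => ?_)
  simp only [Finset.prod_mul_distrib, ← Real.exp_sum, Finset.sum_neg_distrib]
  congr 1
  rw [Finset.prod_eq_single i₀] <;> simp +contextual

theorem volume_En_eq_smul_map (n : ℕ) : ∃ c : ℝ, ∀ g : En n → ℝ,
    ∫ z, g z = c * ∫ x : Fin n → ℂ, g (WithLp.toLp 2 x) := by
  let e : (Fin n → ℂ) ≃L[ℝ] En n := (PiLp.continuousLinearEquiv 2 ℝ (fun _ : Fin n => ℂ)).symm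
  have : (Measure.map e (volume : Measure (Fin n → ℂ))).IsAddHaarMeasure :=
    e.isAddHaarMeasure_map _
  have h := Measure.isAddLeftInvariant_eq_smul (volume : Measure (En n)) (Measure.map e volume)
  refine ⟨Measure.addHaarScalarFactor (volume : Measure (En n)) (Measure.map e volume),
    fun g => ?_⟩
  conv_lhs => rw [h]
  rw [integral_smul_nnreal_measure,
    (show MeasurableEmbedding e from
      e.toHomeomorph.isClosedEmbedding.measurableEmbedding).integral_map]
  rfl

theorem volume_real_unitBall_En {n : ℕ} (hn : 0 < n) :
    (volume : Measure (En n)).real (ball 0 1) = Real.pi ^ n / n.factorial := by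
  have : Nontrivial (En n) := by
    have : Nonempty (Fin n) := ⟨⟨0, hn⟩⟩
    infer_instance
  rw [Measure.real, InnerProductSpace.volume_ball_of_dim_even (finrank_real_En n)]
  simp [Real.pi_pos.le, div_nonneg]

theorem setIntegral_coord_pow {n : ℕ} (i₀ : Fin n) (k : ℕ) :
    ∫ z in ball (0 : En n) 1, ‖z i₀‖ ^ (2 * k) = Real.pi ^ n * k.factorial / (n + k).factorial := by
  obtain ⟨c, hc⟩ := volume_En_eq_smul_map n
  have key : ∀ k : ℕ, ((n + k).factorial : ℝ) * ∫ z in ball (0 : En n) 1, ‖z i₀‖ ^ (2 * k) =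
      c * (Real.pi ^ n * k.factorial) := by
    intro k
    rw [← integral_mul_exp_neg_of_homogeneous (by fun_prop) (fun z => by positivity)
      (fun r z => by simp [mul_pow, pow_mul]), hc, ← integral_pi_gaussian_moment i₀]
    simp only [EuclideanSpace.norm_sq_eq]
  have h0 := key 0
  have hn : 0 < n := i₀.pos
  have hpi := Real.pi_pos
  simp only [mul_zero, pow_zero, add_zero, Nat.factorial_zero, Nat.cast_one, mul_one,
    setIntegral_const, smul_eq_mul, volume_real_unitBall_En hn] at h0
  have hc1 : c = 1 := by
    field_simp at h0
    linarith
  rw [eq_div_iff (by positivity), mul_comm, key, hc1, one_mul]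

/-- Lebesgue measure on the unit ball of `ℂⁿ`, normalised to total mass one. -/
def ballMeasure (n : ℕ) : Measure (En n) :=
  ENNReal.ofReal ((n.factorial : ℝ) / Real.pi ^ n) • volume.restrict (ball 0 1)

instance (n : ℕ) : IsFiniteMeasure (ballMeasure n) := by
  have : Fact (volume (ball (0 : En n) 1) < ⊤) := ⟨measure_ball_lt_top⟩
  exact Measure.smul_finite _ ENNReal.ofReal_ne_top

theorem integral_ballMeasure {n : ℕ} {F : Type*} [NormedAddCommGroup F] [NormedSpace ℝ F]
    (g : En n → F) :
    ∫ z, g z ∂ballMeasure n = ((n.factorial : ℝ) / Real.pi ^ n) • ∫ z in ball 0 1, g z := by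
  rw [ballMeasure, integral_smul_measure, ENNReal.toReal_ofReal]
  have := Real.pi_pos
  positivity

theorem ae_ballMeasure (n : ℕ) : ∀ᵐ z ∂ballMeasure n, z ∈ ball (0 : En n) 1 :=
  (Measure.ae_smul_measure_le _) (ae_restrict_mem measurableSet_ball)

theorem MeasureTheory.IntegrableOn.integrable_ballMeasure {n : ℕ} {F : Type*} [NormedAddCommGroup F]
    {g : En n → F} (hg : IntegrableOn g (ball 0 1)) : Integrable g (ballMeasure n) :=
  Integrable.smul_measure hg ENNReal.ofReal_ne_top

theorem ContinuousOn.aestronglyMeasurable_ballMeasure {n : ℕ} {F : Type*}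
    [NormedAddCommGroup F] {g : En n → F} (hg : ContinuousOn g (ball 0 1)) :
    AEStronglyMeasurable g (ballMeasure n) :=
  (hg.aestronglyMeasurable measurableSet_ball).smul_measure _

theorem measurePreserving_ballMeasure {n : ℕ} (T : En n →ₗ[ℂ] En n) (hT : ∀ z, ‖T z‖ = ‖z‖) :
    MeasurePreserving T (ballMeasure n) (ballMeasure n) := by
  let L : En n →ₗᵢ[ℝ] En n :=
    { toFun := T
      map_add' := T.map_add
      map_smul' := fun r z => T.map_smul_of_tower r z
      norm_map' := hT }
  have hL : MeasurePreserving T (volume : Measure (En n)) volume :=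
    (L.toLinearIsometryEquiv rfl).measurePreserving
  have := hL.restrict_preimage (measurableSet_ball (x := (0 : En n)) (ε := 1))
  have hpre : T ⁻¹' ball 0 1 = ball 0 1 := by
    ext z
    simp [hT]
  rw [hpre] at this
  exact this.smul_measure _

theorem integral_circleAverage {n : ℕ} {F : Type*} [NormedAddCommGroup F] [NormedSpace ℝ F]
    [CompleteSpace F] {T : ℂ → En n → En n} (hTc : Continuous (Function.uncurry T))
    (hT : ∀ c, ‖c‖ = 1 → MeasurePreserving (T c) (ballMeasure n) (ballMeasure n))
    {h : En n → F} (hh : Integrable h (ballMeasure n)) :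
    Integrable (fun z => Real.circleAverage (fun c => h (T c z)) 0 1) (ballMeasure n) ∧
      ∫ z, Real.circleAverage (fun c => h (T c z)) 0 1 ∂ballMeasure n =
        ∫ z, h z ∂ballMeasure n := by
  set ν : Measure ℝ := volume.restrict (Set.Ioc 0 (2 * Real.pi))
  have hg (θ : ℝ) : MeasurePreserving (T (circleMap 0 1 θ)) (ballMeasure n) (ballMeasure n) :=
    hT _ (by simp)
  have hmp : MeasurePreserving (fun p : ℝ × En n => (p.1, T (circleMap 0 1 p.1) p.2))
      (ν.prod (ballMeasure n)) (ν.prod (ballMeasure n)) := by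
    refine (MeasurePreserving.id ν).skew_product (g := fun θ z => T (circleMap 0 1 θ) z) ?_
      (Filter.Eventually.of_forall fun θ => (hg θ).map_eq)
    have : Continuous (fun p : ℝ × En n => Function.uncurry T (circleMap 0 1 p.1, p.2)) := by
      fun_prop
    exact this.measurable
  have hsnd := hh.comp_snd ν
  have hint : Integrable (fun p : ℝ × En n => h (T (circleMap 0 1 p.1) p.2))
      (ν.prod (ballMeasure n)) :=
    (hmp.integrable_comp hsnd.aestronglyMeasurable).2 hsnd
  have h2pi : (0 : ℝ) ≤ 2 * Real.pi := by positivity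
  simp only [Real.circleAverage_def, intervalIntegral.integral_of_le h2pi]
  refine ⟨hint.integral_prod_right.smul _, ?_⟩
  rw [integral_smul, ← integral_integral_swap hint]
  have heq (θ : ℝ) : ∫ z, h (T (circleMap 0 1 θ) z) ∂ballMeasure n = ∫ z, h z ∂ballMeasure n := by
    have := hh.aestronglyMeasurable
    rw [← (hg θ).map_eq] at this
    rw [← integral_map (hg θ).measurable.aemeasurable this, (hg θ).map_eq]
  simp only [heq, integral_const]
  have h1 : Real.pi⁻¹ * 2⁻¹ * (2 * Real.pi) = 1 := by field_simp
  simp [h2pi, smul_smul, h1]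

theorem hasFPowerSeriesAt_of_hasSum_pow_smul {F : Type*} [NormedAddCommGroup F] [NormedSpace ℂ F]
    {G : ℂ → F} {a : ℕ → F} (ha : ∀ᶠ s in nhds (0 : ℂ), HasSum (fun m => s ^ m • a m) (G s)) :
    ∃ p : FormalMultilinearSeries ℂ ℂ F, HasFPowerSeriesAt G p 0 ∧ ∀ m, p.coeff m = a m := by
  let p : FormalMultilinearSeries ℂ ℂ F :=
    fun m => ContinuousMultilinearMap.mkPiRing ℂ (Fin m) (a m)
  have hp (m : ℕ) : p.coeff m = a m := by
    simp [FormalMultilinearSeries.coeff, p]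
  refine ⟨p, ?_, hp⟩
  rw [hasFPowerSeriesAt_iff]
  simpa [hp]

theorem eq_of_hasSum_pow_smul {F : Type*} [NormedAddCommGroup F] [NormedSpace ℂ F]
    {G : ℂ → F} {a b : ℕ → F}
    (ha : ∀ᶠ s in nhds (0 : ℂ), HasSum (fun m => s ^ m • a m) (G s))
    (hb : ∀ᶠ s in nhds (0 : ℂ), HasSum (fun m => s ^ m • b m) (G s)) : a = b := by
  obtain ⟨p, hp, hpa⟩ := hasFPowerSeriesAt_of_hasSum_pow_smul ha
  obtain ⟨q, hq, hqb⟩ := hasFPowerSeriesAt_of_hasSum_pow_smul hb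
  ext m
  rw [← hpa, ← hqb, hp.eq_formalMultilinearSeries hq]

theorem hasDerivAt_of_hasSum_pow_smul {F : Type*} [NormedAddCommGroup F] [NormedSpace ℂ F]
    {G : ℂ → F} {a : ℕ → F}
    (ha : ∀ᶠ s in nhds (0 : ℂ), HasSum (fun m => s ^ m • a m) (G s)) :
    HasDerivAt G (a 1) 0 := by
  obtain ⟨p, hp, hpa⟩ := hasFPowerSeriesAt_of_hasSum_pow_smul ha
  simpa [← hpa] using hp.hasDerivAt

theorem circleAverage_star_pow_smul {F : Type*} [NormedAddCommGroup F] [NormedSpace ℂ F]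
    [CompleteSpace F] {G : ℂ → F} {a : ℕ → F} (hG : DifferentiableOn ℂ G (closedBall 0 1))
    (ha : ∀ᶠ s in nhds (0 : ℂ), HasSum (fun m => s ^ m • a m) (G s)) (k : ℕ) :
    Real.circleAverage (fun c => (starRingEnd ℂ c) ^ k • G c) 0 1 = a k := by
  have h1 : HasFPowerSeriesAt G (cauchyPowerSeries G 0 1) 0 :=
    (DifferentiableOn.hasFPowerSeriesOnBall (R := 1) hG one_pos).hasFPowerSeriesAt
  rw [hasFPowerSeriesAt_iff] at h1
  simp only [zero_add] at h1
  rw [eq_of_hasSum_pow_smul ha h1, FormalMultilinearSeries.coeff]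
  have := cauchyPowerSeries_apply G 0 1 k 1
  rw [show (1 : Fin k → ℂ) = fun _ => 1 from rfl, this,
    Real.circleAverage_eq_circleIntegral one_ne_zero]
  congr 1
  refine circleIntegral.integral_congr zero_le_one fun c hc => ?_
  have hc1 : ‖c‖ = 1 := by simpa using hc
  simp only [sub_zero]
  rw [smul_smul, smul_smul, one_div, Complex.inv_def, Complex.normSq_eq_norm_sq, hc1]
  simp [mul_comm]

theorem integral_norm_inner_pow {n : ℕ} {q : En n} (hq : ‖q‖ = 1) (k : ℕ) :
    ∫ z, ‖inner ℂ q z‖ ^ (2 * k) ∂ballMeasure n = (((n + k).choose k : ℕ) : ℝ)⁻¹ := by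
  have hn : 0 < n := by
    rcases Nat.eq_zero_or_pos n with rfl | h
    · simp [Subsingleton.elim q 0] at hq
    · exact h
  let i₀ : Fin n := ⟨0, hn⟩
  obtain ⟨b, hb⟩ := Orthonormal.exists_orthonormalBasis_extension_of_card_eq (𝕜 := ℂ) (E := En n)
    (ι := Fin n) (by simp) (v := fun _ => q) (s := {i₀}) (by
      constructor
      · simp [hq]
      · intro i j hij
        exact absurd (Subsingleton.elim i j) hij)
  have hb0 : b i₀ = q := hb i₀ rfl
  have hmp := measurePreserving_ballMeasure (b.repr : En n →ₗ[ℂ] En n) (fun z => b.repr.norm_map z)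
  have hmp' : MeasurePreserving b.repr (ballMeasure n) (ballMeasure n) := hmp
  have h1 := hmp'.integral_comp b.repr.toHomeomorph.isClosedEmbedding.measurableEmbedding
    (fun z : En n => ‖z i₀‖ ^ (2 * k))
  simp only [OrthonormalBasis.repr_apply_apply, hb0] at h1
  rw [h1, integral_ballMeasure, setIntegral_coord_pow, ← Nat.choose_symm_add, Nat.cast_add_choose]
  have := Real.pi_pos
  simp only [smul_eq_mul]
  field_simp

theorem norm_rotate_sq {n : ℕ} {q : En n} (hq : ‖q‖ = 1) (c : ℂ) (z : En n) :
    ‖c • z + ((1 - c) * inner ℂ q z) • q‖ ^ 2 =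
      ‖c‖ ^ 2 * ‖z‖ ^ 2 + (1 - ‖c‖ ^ 2) * ‖inner ℂ q z‖ ^ 2 := by
  have h1 : c • z + ((1 - c) * inner ℂ q z) • q =
      c • (z - inner ℂ q z • q) + inner ℂ q z • q := by module
  have hqq : inner ℂ q q = 1 := by
    rw [inner_self_eq_norm_sq_to_K, hq]; simp
  have h2 : inner ℂ (z - inner ℂ q z • q) q = 0 := by
    rw [inner_sub_left, inner_smul_left, inner_conj_symm, hqq]
    simp
  have h3 (a b : ℂ) : ‖a • (z - inner ℂ q z • q) + b • q‖ ^ 2 =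
      ‖a‖ ^ 2 * ‖z - inner ℂ q z • q‖ ^ 2 + ‖b‖ ^ 2 := by
    have := norm_add_sq_eq_norm_sq_add_norm_sq_of_inner_eq_zero (𝕜 := ℂ)
      (a • (z - inner ℂ q z • q)) (b • q) (by rw [inner_smul_left, inner_smul_right, h2]; simp)
    rw [sq, this, norm_smul, norm_smul, hq]
    ring
  have h4 := h3 1 (inner ℂ q z)
  rw [one_smul, sub_add_cancel, norm_one] at h4
  rw [h1, h3, h4]
  ring

theorem integral_inner_pow_smul {n : ℕ} {F : Type*} [NormedAddCommGroup F] [NormedSpace ℂ F]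
    [CompleteSpace F] {f : En n → F} (hf : DifferentiableOn ℂ f (ball 0 1))
    (hi : Integrable f (ballMeasure n)) {q : En n} (hq : ‖q‖ = 1) {a : ℕ → F}
    (ha : ∀ s : ℂ, ‖s‖ < 1 → HasSum (fun m => s ^ m • a m) (f (s • q))) (k : ℕ) :
    (((n + k).choose k : ℕ) : ℂ) • ∫ z, (inner ℂ z q) ^ k • f z ∂ballMeasure n = a k := by
  have hqq : inner ℂ q q = 1 := by
    rw [inner_self_eq_norm_sq_to_K, hq]; simp
  have hle (z : En n) : ‖inner ℂ q z‖ ≤ ‖z‖ := by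
    simpa [hq] using norm_inner_le_norm (𝕜 := ℂ) q z
  -- averaging over rotations of the orthogonal complement of `q`
  let T (c : ℂ) : En n →ₗ[ℂ] En n :=
    c • LinearMap.id + (1 - c) • (innerₛₗ ℂ q).smulRight q
  have hT (c : ℂ) (z : En n) : T c z = c • z + ((1 - c) * inner ℂ q z) • q := by
    simp [T, mul_smul]
  have hTn (c : ℂ) (hc : ‖c‖ ≤ 1) (z : En n) : ‖T c z‖ ≤ ‖z‖ := by
    refine le_of_sq_le_sq ?_ (norm_nonneg _)
    rw [hT, norm_rotate_sq hq]
    have h1 : ‖inner ℂ q z‖ ^ 2 ≤ ‖z‖ ^ 2 := by gcongr; exact hle z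
    have h2 : ‖c‖ ^ 2 ≤ 1 := by simpa using pow_le_pow_left₀ (norm_nonneg _) hc 2
    nlinarith
  have hi1 : Integrable (fun z => (inner ℂ z q) ^ k • f z) (ballMeasure n) := by
    refine hi.bdd_smul 1 (φ := fun z => (inner ℂ z q) ^ k)
      (Continuous.aestronglyMeasurable (by fun_prop)) ?_
    filter_upwards [ae_ballMeasure n] with z hz
    rw [norm_pow]
    refine pow_le_one₀ (norm_nonneg _) ?_
    rw [norm_inner_symm]
    exact (hle z).trans (mem_ball_zero_iff.1 hz).le
  obtain ⟨hi2, he2⟩ := integral_circleAverage (T := fun c z => T c z)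
    (by simp only [hT]; fun_prop)
    (fun c hc => measurePreserving_ballMeasure (T c) fun z => by
      refine (sq_eq_sq₀ (norm_nonneg _) (norm_nonneg _)).1 ?_
      rw [hT, norm_rotate_sq hq, hc]; ring) hi1
  have hav : ∀ z ∈ ball (0 : En n) 1,
      Real.circleAverage (fun c => (inner ℂ (T c z) q) ^ k • f (T c z)) 0 1 =
        (inner ℂ z q) ^ k • f (inner ℂ q z • q) := by
    intro z hz
    have hin (c : ℂ) : inner ℂ (T c z) q = inner ℂ z q := by
      rw [hT, inner_add_left, inner_smul_left, inner_smul_left, hqq, map_mul, inner_conj_symm,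
        map_sub, map_one]
      ring
    simp only [hin]
    rw [Real.circleAverage_fun_smul, DiffContOnCl.circleAverage]
    · simp [hT]
    · refine DifferentiableOn.diffContOnCl ?_
      refine hf.comp (g := f) (f := fun c => T c z) ?_ ?_
      · simp only [hT]
        fun_prop
      · intro c hc
        rw [abs_one, closure_ball _ one_ne_zero] at hc
        simp only [mem_ball_zero_iff, mem_closedBall_zero_iff] at *
        exact (hTn c hc z).trans_lt hz
  have hav' := (ae_ballMeasure n).mono hav
  rw [integrable_congr hav'] at hi2
  rw [integral_congr_ae hav'] at he2
  rw [← he2]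
  -- averaging over scalar rotations
  obtain ⟨-, he3⟩ := integral_circleAverage (T := fun c z => c • z) (by fun_prop)
    (fun c hc => measurePreserving_ballMeasure (c • LinearMap.id) fun z => by
      simp [norm_smul, hc]) hi2
  have hav3 : ∀ z ∈ ball (0 : En n) 1,
      Real.circleAverage (fun c => (inner ℂ (c • z) q) ^ k • f (inner ℂ q (c • z) • q)) 0 1 =
        ((‖inner ℂ q z‖ ^ (2 * k) : ℝ) : ℂ) • a k := by
    intro z hz
    have hz1 : ‖inner ℂ q z‖ < 1 := (hle z).trans_lt (by simpa using hz)
    have hlt {c : ℂ} (hc : ‖c‖ ≤ 1) : ‖c * inner ℂ q z‖ < 1 := by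
      rw [norm_mul]
      calc ‖c‖ * ‖inner ℂ q z‖ ≤ 1 * ‖inner ℂ q z‖ := by gcongr
        _ < 1 := by simpa using hz1
    have h4 := circleAverage_star_pow_smul (G := fun c => f ((c * inner ℂ q z) • q))
      (a := fun m => (inner ℂ q z) ^ m • a m) (by
        refine hf.comp (f := fun c : ℂ => (c * inner ℂ q z) • q) (by fun_prop) ?_
        intro c hc
        simpa [norm_smul, hq] using hlt (by simpa using hc)) (by
        filter_upwards [closedBall_mem_nhds (0 : ℂ) one_pos] with s hs
        have := ha (s * inner ℂ q z) (hlt (by simpa using hs))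
        simpa [mul_pow, mul_smul] using this) k
    have h5 (c : ℂ) : (inner ℂ (c • z) q) ^ k • f (inner ℂ q (c • z) • q) =
        (inner ℂ z q) ^ k • ((starRingEnd ℂ c) ^ k • f ((c * inner ℂ q z) • q)) := by
      rw [inner_smul_left, inner_smul_right, mul_pow, smul_smul, mul_comm]
    simp only [h5]
    rw [Real.circleAverage_fun_smul, h4, smul_smul, ← mul_pow, ← inner_conj_symm z q,
      Complex.conj_mul', pow_mul]
    push_cast
    rfl
  rw [← he3, integral_congr_ae ((ae_ballMeasure n).mono hav3), integral_smul_const,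
    integral_complex_ofReal, integral_norm_inner_pow hq, smul_smul, Complex.ofReal_inv,
    Complex.ofReal_natCast, mul_inv_cancel₀, one_smul]
  exact_mod_cast (Nat.choose_pos (Nat.le_add_left k n)).ne'

theorem integrable_smul_ballMeasure {n : ℕ} {F : Type*} [NormedAddCommGroup F] [NormedSpace ℂ F]
    {f : En n → F} (hi : Integrable f (ballMeasure n)) {φ : En n → ℂ} {C : ℝ}
    (hc : ContinuousOn φ (ball 0 1)) (hb : ∀ z ∈ ball (0 : En n) 1, ‖φ z‖ ≤ C) :
    Integrable (fun z => φ z • f z) (ballMeasure n) :=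
  hi.bdd_smul C hc.aestronglyMeasurable_ballMeasure ((ae_ballMeasure n).mono hb)

theorem hasSum_integral_smul_ballMeasure {n : ℕ} {F : Type*} [NormedAddCommGroup F]
    [NormedSpace ℂ F] {f : En n → F} (hi : Integrable f (ballMeasure n)) {φ : ℕ → En n → ℂ}
    {Φ : En n → ℂ} {b : ℕ → ℝ} (hc : ∀ k, ContinuousOn (φ k) (ball 0 1))
    (hb : ∀ k, ∀ z ∈ ball (0 : En n) 1, ‖φ k z‖ ≤ b k) (hs : Summable b)
    (hΦ : ∀ z ∈ ball (0 : En n) 1, HasSum (fun k => φ k z) (Φ z)) :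
    HasSum (fun k => ∫ z, φ k z • f z ∂ballMeasure n) (∫ z, Φ z • f z ∂ballMeasure n) := by
  refine hasSum_integral_of_dominated_convergence (fun k z => b k * ‖f z‖)
    (fun k => (integrable_smul_ballMeasure hi (hc k) (hb k)).aestronglyMeasurable)
    (fun k => ?_) (Filter.Eventually.of_forall fun z => hs.mul_right _) ?_ ?_
  · filter_upwards [ae_ballMeasure n] with z hz
    rw [norm_smul]
    gcongr
    exact hb k z hz
  · simp only [tsum_mul_right]
    exact hi.norm.const_mul _
  · filter_upwards [ae_ballMeasure n] with z hz
    exact (hΦ z hz).smul_const _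

theorem hasSum_choose_mul_pow {𝕜 : Type*} [RCLike 𝕜] (n : ℕ) {r : 𝕜} (hr : ‖r‖ < 1) :
    HasSum (fun k => (((n + k).choose k : ℕ) : 𝕜) * r ^ k) ((1 - r) ^ (n + 1))⁻¹ := by
  have := hasSum_choose_mul_geometric_of_norm_lt_one n hr
  rw [one_div] at this
  have h (k : ℕ) : (n + k).choose k = (k + n).choose n := by rw [add_comm, Nat.choose_symm_add]
  simpa only [h] using this

/-- The Bergman reproducing formula on the unit ball. -/
theorem bergman_reproducing {n : ℕ} {F : Type*} [NormedAddCommGroup F] [NormedSpace ℂ F]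
    [CompleteSpace F] {f : En n → F} (hf : DifferentiableOn ℂ f (ball 0 1))
    (hi : Integrable f (ballMeasure n)) (hn : 0 < n) {x : En n} (hx : x ∈ ball 0 1) :
    ∫ z, ((1 - inner ℂ z x) ^ (n + 1))⁻¹ • f z ∂ballMeasure n = f x := by
  obtain ⟨q, hq, r, hxq⟩ : ∃ q : En n, ‖q‖ = 1 ∧ ∃ r : ℂ, x = r • q := by
    by_cases h0 : x = 0
    · refine ⟨EuclideanSpace.single ⟨0, hn⟩ 1, by simp, 0, by simp [h0]⟩
    · refine ⟨(‖x‖⁻¹ : ℂ) • x, ?_, ‖x‖, ?_⟩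
      · simp [norm_smul, h0]
      · rw [smul_smul, mul_inv_cancel₀ (by simpa using h0), one_smul]
  have hxr : ‖x‖ = ‖r‖ := by simp [hxq, norm_smul, hq]
  have hr : ‖r‖ < 1 := by simpa [← hxr] using hx
  have hd : DifferentiableOn ℂ (fun s : ℂ => f (s • q)) (ball 0 1) := by
    refine hf.comp (f := fun s : ℂ => s • q) (by fun_prop) ?_
    intro s hs
    simpa [norm_smul, hq] using hs
  set a : ℕ → F := fun m => ((m.factorial : ℂ))⁻¹ • iteratedDeriv m (fun s : ℂ => f (s • q)) 0
  have ha (s : ℂ) (hs : ‖s‖ < 1) : HasSum (fun m => s ^ m • a m) (f (s • q)) := by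
    have := Complex.hasSum_taylorSeries_on_ball hd (z := s) (by simpa using hs)
    simp only [sub_zero] at this
    convert this using 2 with m
    rw [smul_comm]
  have hin (z : En n) : inner ℂ z x = r * inner ℂ z q := by rw [hxq, inner_smul_right]
  have hle (z : En n) (hz : z ∈ ball (0 : En n) 1) : ‖inner ℂ z x‖ ≤ ‖r‖ := by
    rw [← hxr]
    refine (norm_inner_le_norm z x).trans ?_
    exact mul_le_of_le_one_left (norm_nonneg _) (mem_ball_zero_iff.1 hz).le
  have h1 := hasSum_integral_smul_ballMeasure hi
    (φ := fun k z => (((n + k).choose k : ℕ) : ℂ) * inner ℂ z x ^ k)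
    (Φ := fun z => ((1 - inner ℂ z x) ^ (n + 1))⁻¹)
    (b := fun k => (((n + k).choose k : ℕ) : ℝ) * ‖r‖ ^ k)
    (fun k => by fun_prop) (fun k z hz => by
      rw [norm_mul, norm_pow, Complex.norm_natCast]
      gcongr
      exact hle z hz) (hasSum_choose_mul_pow n (r := ‖r‖) (by simpa using hr)).summable
    (fun z hz => hasSum_choose_mul_pow n ((hle z hz).trans_lt hr))
  refine h1.unique ?_
  convert ha r hr using 1
  · ext k
    rw [← integral_inner_pow_smul hf hi hq ha k]
    simp only [hin, mul_pow, mul_smul]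
    rw [integral_smul, integral_smul, smul_comm]
  · rw [hxq]

theorem norm_inner_le_of_mem_ball {n : ℕ} {z : En n} (hz : z ∈ ball (0 : En n) 1) (v : En n) :
    ‖inner ℂ z v‖ ≤ ‖v‖ :=
  (norm_inner_le_norm z v).trans
    (mul_le_of_le_one_left (norm_nonneg _) (mem_ball_zero_iff.1 hz).le)

theorem one_sub_norm_le_norm_one_sub_inner {n : ℕ} {z : En n} (hz : z ∈ ball (0 : En n) 1)
    (x : En n) : 1 - ‖x‖ ≤ ‖1 - inner ℂ z x‖ := by
  have h1 := norm_sub_norm_le (1 : ℂ) (inner ℂ z x)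
  have h2 := norm_inner_le_of_mem_ball hz x
  rw [norm_one] at h1
  linarith

theorem one_sub_inner_ne_zero {n : ℕ} {z : En n} (hz : z ∈ ball (0 : En n) 1)
    {x : En n} (hx : ‖x‖ < 1) : 1 - inner ℂ z x ≠ 0 := by
  rw [← norm_pos_iff]
  have := one_sub_norm_le_norm_one_sub_inner hz x
  linarith

theorem continuousOn_inv_one_sub_inner_pow {n : ℕ} {x : En n} (hx : ‖x‖ < 1) (m : ℕ) :
    ContinuousOn (fun z : En n => ((1 - inner ℂ z x) ^ m)⁻¹) (ball 0 1) :=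
  ContinuousOn.inv₀ (by fun_prop) fun _ hz => pow_ne_zero _ (one_sub_inner_ne_zero hz hx)

theorem norm_inv_one_sub_inner_pow_le {n : ℕ} {z : En n} (hz : z ∈ ball (0 : En n) 1)
    {x : En n} (hx : ‖x‖ < 1) (m : ℕ) :
    ‖((1 - inner ℂ z x) ^ m)⁻¹‖ ≤ ((1 - ‖x‖) ^ m)⁻¹ := by
  have : 0 < 1 - ‖x‖ := by linarith
  rw [norm_inv, norm_pow]
  gcongr
  exact one_sub_norm_le_norm_one_sub_inner hz x

theorem hasSum_integral_kernel {n : ℕ} {F : Type*} [NormedAddCommGroup F]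
    [NormedSpace ℂ F] {f : En n → F} (hi : Integrable f (ballMeasure n)) (m : ℕ) {ζ v : En n}
    (h : ‖ζ‖ + ‖v‖ < 1) :
    HasSum (fun k => (((m + k).choose k : ℕ) : ℂ) •
        ∫ z, (inner ℂ z v ^ k * ((1 - inner ℂ z ζ) ^ (m + 1 + k))⁻¹) • f z ∂ballMeasure n)
      (∫ z, ((1 - inner ℂ z (ζ + v)) ^ (m + 1))⁻¹ • f z ∂ballMeasure n) := by
  have hζ : ‖ζ‖ < 1 := by linarith [norm_nonneg v]
  have hζ' : 0 < 1 - ‖ζ‖ := by linarith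
  have hθ : ‖v‖ / (1 - ‖ζ‖) < 1 := by rw [div_lt_one hζ']; linarith
  have hle (z : En n) (hz : z ∈ ball (0 : En n) 1) :
      ‖inner ℂ z v / (1 - inner ℂ z ζ)‖ ≤ ‖v‖ / (1 - ‖ζ‖) := by
    rw [norm_div]
    gcongr
    · exact norm_inner_le_of_mem_ball hz v
    · exact one_sub_norm_le_norm_one_sub_inner hz ζ
  have heq (k : ℕ) (z : En n) (hz : z ∈ ball (0 : En n) 1) :
      (((m + k).choose k : ℕ) : ℂ) * (inner ℂ z v ^ k * ((1 - inner ℂ z ζ) ^ (m + 1 + k))⁻¹) =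
      (((m + k).choose k : ℕ) : ℂ) * (inner ℂ z v / (1 - inner ℂ z ζ)) ^ k *
        ((1 - inner ℂ z ζ) ^ (m + 1))⁻¹ := by
    have := one_sub_inner_ne_zero hz hζ
    rw [div_pow, pow_add _ (m + 1) k]
    field_simp
  have := hasSum_integral_smul_ballMeasure hi
    (φ := fun k z => (((m + k).choose k : ℕ) : ℂ) *
      (inner ℂ z v ^ k * ((1 - inner ℂ z ζ) ^ (m + 1 + k))⁻¹))
    (Φ := fun z => ((1 - inner ℂ z (ζ + v)) ^ (m + 1))⁻¹)
    (b := fun k => (((m + k).choose k : ℕ) : ℝ) * (‖v‖ / (1 - ‖ζ‖)) ^ k *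
      ((1 - ‖ζ‖) ^ (m + 1))⁻¹)
    (fun k => continuousOn_const.mul ((by fun_prop : ContinuousOn _ _).mul
      (continuousOn_inv_one_sub_inner_pow hζ _)))
    (fun k z hz => by
      rw [heq k z hz, norm_mul, norm_mul, norm_pow, Complex.norm_natCast]
      gcongr
      · exact hle z hz
      · exact norm_inv_one_sub_inner_pow_le hz hζ _)
    ((hasSum_choose_mul_pow m (r := ‖v‖ / (1 - ‖ζ‖))
      (by rwa [Real.norm_of_nonneg (by positivity)])).summable.mul_right _)
    (fun z hz => by
      have h1 := (hasSum_choose_mul_pow m ((hle z hz).trans_lt hθ)).mul_right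
        (((1 - inner ℂ z ζ) ^ (m + 1))⁻¹)
      simp only [heq _ z hz]
      rw [← mul_inv, ← mul_pow, sub_mul, div_mul_cancel₀ _ (one_sub_inner_ne_zero hz hζ),
        one_mul, sub_sub, ← inner_add_right] at h1
      exact h1)
  simpa only [mul_smul, integral_smul] using this

/-- The coefficients of the expansion at `ζ` of a function on the unit ball, with the last
variable polarised. -/
def taylorCoeff {n : ℕ} {F : Type*} [NormedAddCommGroup F] [NormedSpace ℂ F] (f : En n → F)
    (ζ : En n) (k : ℕ) (v w : En n) : F :=
  (((n + k + 1).choose (k + 1) : ℕ) : ℂ) •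
    ∫ z, (inner ℂ z w * inner ℂ z v ^ k * ((1 - inner ℂ z ζ) ^ (n + k + 2))⁻¹) • f z ∂ballMeasure n

section
variable {n : ℕ} {F : Type*} [NormedAddCommGroup F] [NormedSpace ℂ F] [CompleteSpace F]
  {f : En n → F}

theorem hasSum_integral_kernel_eq (hf : DifferentiableOn ℂ f (ball 0 1))
    (hi : Integrable f (ballMeasure n)) (hn : 0 < n) {ζ v : En n} (h : ‖ζ‖ + ‖v‖ < 1) :
    HasSum (fun k => (((n + k).choose k : ℕ) : ℂ) •
        ∫ z, (inner ℂ z v ^ k * ((1 - inner ℂ z ζ) ^ (n + 1 + k))⁻¹) • f z ∂ballMeasure n)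
      (f (ζ + v)) := by
  have := hasSum_integral_kernel hi n h
  rwa [bergman_reproducing hf hi hn] at this
  simpa using (norm_add_le ζ v).trans_lt h

theorem hasSum_integral_kernel_smul_eq (hf : DifferentiableOn ℂ f (ball 0 1))
    (hi : Integrable f (ballMeasure n)) (hn : 0 < n) {ζ : En n} (hζ : ‖ζ‖ < 1) (v : En n) :
    ∀ᶠ s in nhds (0 : ℂ), HasSum (fun k => s ^ k • (((n + k).choose k : ℕ) : ℂ) •
        ∫ z, (inner ℂ z v ^ k * ((1 - inner ℂ z ζ) ^ (n + 1 + k))⁻¹) • f z ∂ballMeasure n)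
      (f (ζ + s • v)) := by
  have : ∀ᶠ s in nhds (0 : ℂ), ‖ζ‖ + ‖s • v‖ < 1 := by
    have hc : Continuous fun s : ℂ => ‖ζ‖ + ‖s • v‖ := by fun_prop
    exact hc.continuousAt.eventually_lt continuousAt_const (by simpa using hζ)
  filter_upwards [this] with s hs
  convert hasSum_integral_kernel_eq hf hi hn hs using 2 with k
  simp only [inner_smul_right, mul_pow, mul_assoc, mul_smul (s ^ k), integral_smul]
  rw [smul_comm]

theorem hasSum_taylorCoeff (hf : DifferentiableOn ℂ f (ball 0 1))
    (hi : Integrable f (ballMeasure n)) (hn : 0 < n) {ζ v : En n} (h : ‖ζ‖ + ‖v‖ < 1) :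
    HasSum (fun k => taylorCoeff f ζ k v v) (f (ζ + v) - f ζ) := by
  have h1 := hasSum_integral_kernel_eq hf hi hn h
  have h2 := (hasSum_nat_add_iff' 1).2 h1
  convert h2 using 2
  · simp only [taylorCoeff, ← pow_succ', add_assoc]
    simp only [add_left_comm, one_add_one_eq_two]
  · have := bergman_reproducing hf hi hn (x := ζ) (by simp; linarith [norm_nonneg v])
    simpa using this.symm

theorem fderiv_apply_eq_integral (hf : DifferentiableOn ℂ f (ball 0 1))
    (hi : Integrable f (ballMeasure n)) (hn : 0 < n) {x : En n} (hx : ‖x‖ < 1) (w : En n) :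
    fderiv ℂ f x w = ((n + 1 : ℕ) : ℂ) •
      ∫ z, (inner ℂ z w * ((1 - inner ℂ z x) ^ (n + 2))⁻¹) • f z ∂ballMeasure n := by
  have h2 := hasDerivAt_of_hasSum_pow_smul (hasSum_integral_kernel_smul_eq hf hi hn hx w)
  have h3 : HasDerivAt (fun s : ℂ => f (x + s • w)) (fderiv ℂ f x w) 0 := by
    have hd : DifferentiableAt ℂ f x :=
      hf.differentiableAt (isOpen_ball.mem_nhds (by simpa using hx))
    exact hd.hasFDerivAt.hasLineDerivAt w
  rw [h3.unique h2]
  simp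

theorem hasSum_fderiv_apply (hf : DifferentiableOn ℂ f (ball 0 1))
    (hi : Integrable f (ballMeasure n)) (hn : 0 < n) {ζ v : En n} (h : ‖ζ‖ + ‖v‖ < 1)
    (w : En n) :
    HasSum (fun k : ℕ => ((k + 1 : ℕ) : ℂ) • taylorCoeff f ζ k v w) (fderiv ℂ f (ζ + v) w) := by
  have hi' : Integrable (fun z => inner ℂ z w • f z) (ballMeasure n) :=
    integrable_smul_ballMeasure hi (by fun_prop) fun z hz => norm_inner_le_of_mem_ball hz w
  have h1 := (hasSum_integral_kernel hi' (n + 1) h).const_smul ((n + 1 : ℕ) : ℂ)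
  convert h1 using 1
  · ext k
    have h2 : (k + 1) * (n + k + 1).choose (k + 1) = (n + 1) * (n + 1 + k).choose k := by
      have := Nat.add_one_mul_choose_eq (n + k) k
      have h3 := Nat.choose_mul_succ_eq (n + k) k
      have h4 : n + k + 1 - k = n + 1 := by omega
      rw [h4] at h3
      rw [show n + 1 + k = n + k + 1 by ring]
      linarith
    rw [taylorCoeff, smul_smul, smul_smul, ← Nat.cast_mul, ← Nat.cast_mul, h2]
    congr 2
    ext z
    rw [smul_smul]
    congr 1
    rw [show n + k + 2 = n + 1 + 1 + k by ring]
    ring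
  · rw [fderiv_apply_eq_integral hf hi hn ((norm_add_le ζ v).trans_lt h)]
    congr 2
    ext z
    rw [smul_smul, mul_comm]

theorem fderiv_apply_eq_taylorCoeff (hf : DifferentiableOn ℂ f (ball 0 1))
    (hi : Integrable f (ballMeasure n)) (hn : 0 < n) {ζ : En n} (hζ : ‖ζ‖ < 1) (v w : En n) :
    fderiv ℂ f ζ w = taylorCoeff f ζ 0 v w := by
  rw [fderiv_apply_eq_integral hf hi hn hζ]
  simp [taylorCoeff]

end

open Finset.HasAntidiagonal (antidiagonal)

theorem hasSum_choose_mul_pow_mul_pow {b s : ℂ} (j : ℕ) :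
    HasSum (fun i => s ^ i * ((j.choose i : ℂ) * b ^ (j - i))) ((b + s) ^ j) := by
  rw [add_comm, add_pow]
  have := hasSum_sum_of_ne_finset_zero (L := .unconditional ℕ)
    (f := fun i => s ^ i * ((j.choose i : ℂ) * b ^ (j - i)))
    (s := Finset.range (j + 1)) (fun i hi => by
      rw [Nat.choose_eq_zero_of_lt (by simpa using hi)]
      simp)
  convert this using 2
  ring

theorem hasSum_inv_sub_pow {a c s : ℂ} (ha : a ≠ 0) (hs : ‖s * c / a‖ < 1) (N : ℕ) :
    HasSum (fun i => s ^ i * (((N + i).choose i : ℂ) * c ^ i / a ^ (N + 1 + i)))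
      (((a - s * c) ^ (N + 1))⁻¹) := by
  have := (hasSum_choose_mul_pow N hs).mul_right ((a ^ (N + 1))⁻¹)
  rw [← mul_inv, ← mul_pow, sub_mul, div_mul_cancel₀ _ ha, one_mul] at this
  refine this.congr_fun ?_
  intro i
  rw [pow_add a, div_pow, mul_pow]
  field_simp

/-- The holomorphic test functions whose expansions give the kernel moments. -/
theorem hasSum_testFunction {b c a s : ℂ} (ha : a ≠ 0) (hs : ‖s * c / a‖ < 1) (j N : ℕ) :
    HasSum (fun k => s ^ k * ∑ p ∈ antidiagonal k, (j.choose p.1 : ℂ) * b ^ (j - p.1) *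
        (((N + p.2).choose p.2 : ℂ) * c ^ p.2 / a ^ (N + 1 + p.2)))
      ((b + s) ^ j * ((a - s * c) ^ (N + 1))⁻¹) := by
  have h1 := hasSum_choose_mul_pow_mul_pow (b := b) (s := s) j
  have h2 := hasSum_inv_sub_pow ha hs N
  have h3 := summable_norm_sum_mul_antidiagonal_of_summable_norm h1.summable.norm h2.summable.norm
  have h4 := tsum_mul_tsum_eq_tsum_sum_antidiagonal_of_summable_norm
    h1.summable.norm h2.summable.norm
  rw [h1.tsum_eq, h2.tsum_eq] at h4
  rw [h4]
  refine h3.of_norm.hasSum.congr_fun fun k => ?_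
  rw [Finset.mul_sum]
  refine Finset.sum_congr rfl fun p hp => ?_
  rw [← Finset.HasAntidiagonal.mem_antidiagonal.1 hp, pow_add]
  ring

theorem integral_kernel_mul_testFunction {n : ℕ} (hn : 0 < n) {ζ v : En n} (hζ : ‖ζ‖ < 1)
    (hv : ‖v‖ = 1) (j N k : ℕ) :
    ((n + k).choose k : ℂ) * ∫ z, (inner ℂ z v ^ k * ((1 - inner ℂ z ζ) ^ (n + 1 + k))⁻¹) *
        (inner ℂ v z ^ j * ((1 - inner ℂ ζ z) ^ (N + 1))⁻¹) ∂ballMeasure n =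
      ∑ p ∈ antidiagonal k, (j.choose p.1 : ℂ) * inner ℂ v ζ ^ (j - p.1) *
        (((N + p.2).choose p.2 : ℂ) * inner ℂ ζ v ^ p.2 /
          ((1 - ‖ζ‖ ^ 2 : ℝ) : ℂ) ^ (N + 1 + p.2)) := by
  set e : En n → ℂ := fun z => inner ℂ v z ^ j * ((1 - inner ℂ ζ z) ^ (N + 1))⁻¹ with he
  have hne : ∀ z ∈ ball (0 : En n) 1, 1 - inner ℂ ζ z ≠ 0 := by
    intro z hz h
    apply one_sub_inner_ne_zero hz hζ
    rw [← inner_conj_symm, ← map_one (starRingEnd ℂ), ← map_sub, h, map_zero]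
  have hlin (x : En n) : Differentiable ℂ fun z : En n => inner ℂ x z :=
    (innerSL ℂ x).differentiable
  have hf : DifferentiableOn ℂ e (ball 0 1) :=
    ((hlin v).differentiableOn.pow j).mul
      (DifferentiableOn.inv (((differentiableOn_const _).sub (hlin ζ).differentiableOn).pow _)
        fun z hz => pow_ne_zero _ (hne z hz))
  have hi : Integrable e (ballMeasure n) := by
    have h1 : Integrable (fun _ : En n => (1 : ℂ)) (ballMeasure n) := integrable_const _
    have := integrable_smul_ballMeasure h1 (φ := e) (C := ((1 - ‖ζ‖) ^ (N + 1))⁻¹)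
      hf.continuousOn fun z hz => by
        have h2 := norm_inv_one_sub_inner_pow_le hz hζ (N + 1)
        have h3 : ‖inner ℂ v z ^ j‖ ≤ 1 := by
          rw [norm_pow, norm_inner_symm]
          exact pow_le_one₀ (norm_nonneg _) (hv ▸ norm_inner_le_of_mem_ball hz v)
        have h4 : ‖((1 - inner ℂ ζ z) ^ (N + 1))⁻¹‖ = ‖((1 - inner ℂ z ζ) ^ (N + 1))⁻¹‖ := by
          rw [← RCLike.norm_conj]
          simp
        rw [he, norm_mul, h4]
        exact (mul_le_of_le_one_left (norm_nonneg _) h3).trans h2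
    simpa using this
  have ha : ((1 - ‖ζ‖ ^ 2 : ℝ) : ℂ) ≠ 0 := by
    have : 0 < 1 - ‖ζ‖ ^ 2 := by nlinarith [norm_nonneg ζ]
    exact_mod_cast this.ne'
  have h1 := hasSum_integral_kernel_smul_eq hf hi hn hζ v
  have hvv : inner ℂ v v = 1 := by rw [inner_self_eq_norm_sq_to_K, hv]; simp
  have hev (s : ℂ) : e (ζ + s • v) = (inner ℂ v ζ + s) ^ j *
      ((((1 - ‖ζ‖ ^ 2 : ℝ) : ℂ) - s * inner ℂ ζ v) ^ (N + 1))⁻¹ := by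
    simp only [he, inner_add_right, inner_smul_right, hvv, inner_self_eq_norm_sq_to_K, mul_one,
      sub_add_eq_sub_sub]
    simp
  have h2 : ∀ᶠ s in nhds (0 : ℂ), HasSum (fun k => s ^ k • ∑ p ∈ antidiagonal k,
      (j.choose p.1 : ℂ) * inner ℂ v ζ ^ (j - p.1) *
        (((N + p.2).choose p.2 : ℂ) * inner ℂ ζ v ^ p.2 /
          ((1 - ‖ζ‖ ^ 2 : ℝ) : ℂ) ^ (N + 1 + p.2))) (e (ζ + s • v)) := by
    have : ∀ᶠ s in nhds (0 : ℂ), ‖s * inner ℂ ζ v / ((1 - ‖ζ‖ ^ 2 : ℝ) : ℂ)‖ < 1 := by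
      have hc : Continuous fun s : ℂ => ‖s * inner ℂ ζ v / ((1 - ‖ζ‖ ^ 2 : ℝ) : ℂ)‖ := by fun_prop
      exact hc.continuousAt.eventually_lt continuousAt_const (by simp)
    filter_upwards [this] with s hs
    rw [hev]
    exact hasSum_testFunction ha hs j N
  exact congrFun (eq_of_hasSum_pow_smul h1 h2) k

theorem choose_mul_integral_norm_kernel_sq {n : ℕ} (hn : 0 < n) {ζ v : En n} (hζ : ‖ζ‖ < 1)
    (hv : ‖v‖ = 1) (k : ℕ) :
    ((n + k).choose k : ℝ) * ∫ z, ‖inner ℂ z v ^ k * ((1 - inner ℂ z ζ) ^ (n + 1 + k))⁻¹‖ ^ 2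
        ∂ballMeasure n =
      ∑ p ∈ antidiagonal k, (k.choose p.1 : ℝ) * ((n + k + p.2).choose p.2 : ℝ) *
        (‖inner ℂ v ζ‖ ^ 2) ^ p.2 / (1 - ‖ζ‖ ^ 2) ^ (n + k + 1 + p.2) := by
  have h := integral_kernel_mul_testFunction hn hζ hv k (n + k) k
  have h1 (z : En n) : (inner ℂ z v ^ k * ((1 - inner ℂ z ζ) ^ (n + 1 + k))⁻¹) *
        (inner ℂ v z ^ k * ((1 - inner ℂ ζ z) ^ (n + k + 1))⁻¹) =
      ((‖inner ℂ z v ^ k * ((1 - inner ℂ z ζ) ^ (n + 1 + k))⁻¹‖ ^ 2 : ℝ) : ℂ) := by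
    rw [Complex.ofReal_pow, ← Complex.mul_conj', map_mul, map_pow, map_inv₀, map_pow, map_sub,
      map_one, inner_conj_symm, inner_conj_symm, add_right_comm n k 1]
  simp only [h1] at h
  rw [integral_complex_ofReal] at h
  have h2 : ∀ p ∈ antidiagonal k, (k.choose p.1 : ℂ) * inner ℂ v ζ ^ (k - p.1) *
        (((n + k + p.2).choose p.2 : ℂ) * inner ℂ ζ v ^ p.2 /
          ((1 - ‖ζ‖ ^ 2 : ℝ) : ℂ) ^ (n + k + 1 + p.2)) =
      (((k.choose p.1 : ℝ) * ((n + k + p.2).choose p.2 : ℝ) *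
        (‖inner ℂ v ζ‖ ^ 2) ^ p.2 / (1 - ‖ζ‖ ^ 2) ^ (n + k + 1 + p.2) : ℝ) : ℂ) := by
    intro p hp
    have h3 : k - p.1 = p.2 := by
      have := Finset.HasAntidiagonal.mem_antidiagonal.1 hp
      omega
    have h4 : (((‖inner ℂ v ζ‖ ^ 2 : ℝ)) : ℂ) = inner ℂ v ζ * inner ℂ ζ v := by
      rw [Complex.ofReal_pow, ← Complex.mul_conj', inner_conj_symm]
    rw [h3, Complex.ofReal_div, Complex.ofReal_mul, Complex.ofReal_pow _ p.2, h4]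
    push_cast
    ring
  rw [Finset.sum_congr rfl h2] at h
  exact_mod_cast h

theorem one_sub_norm_sq_add_norm_inner_sq_le {n : ℕ} {ζ v : En n} (hv : ‖v‖ = 1) :
    1 - ‖ζ‖ ^ 2 + ‖inner ℂ v ζ‖ ^ 2 ≤ 1 := by
  have : ‖inner ℂ v ζ‖ ≤ ‖ζ‖ := by simpa [hv] using norm_inner_le_norm (𝕜 := ℂ) v ζ
  have := pow_le_pow_left₀ (norm_nonneg _) this 2
  linarith

theorem choose_mul_integral_norm_kernel_sq_le {n : ℕ} (hn : 0 < n) {ζ v : En n} (hζ : ‖ζ‖ < 1)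
    (hv : ‖v‖ = 1) (k : ℕ) :
    ((n + k).choose k : ℝ) * ∫ z, ‖inner ℂ z v ^ k * ((1 - inner ℂ z ζ) ^ (n + 1 + k))⁻¹‖ ^ 2
        ∂ballMeasure n ≤ ((n + 2 * k).choose k : ℝ) / (1 - ‖ζ‖ ^ 2) ^ (n + 1 + 2 * k) := by
  have ha : 0 < 1 - ‖ζ‖ ^ 2 := by nlinarith [norm_nonneg ζ]
  set a := 1 - ‖ζ‖ ^ 2
  set t := ‖inner ℂ v ζ‖ ^ 2
  have ht : 0 ≤ t := by positivity
  have hat : a + t ≤ 1 := one_sub_norm_sq_add_norm_inner_sq_le hv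
  rw [choose_mul_integral_norm_kernel_sq hn hζ hv]
  calc ∑ p ∈ antidiagonal k, (k.choose p.1 : ℝ) * ((n + k + p.2).choose p.2 : ℝ) *
        t ^ p.2 / a ^ (n + k + 1 + p.2)
      ≤ ∑ p ∈ antidiagonal k, ((n + 2 * k).choose k : ℝ) / a ^ (n + 1 + 2 * k) *
        (k.choose p.1 • (a ^ p.1 * t ^ p.2)) := by
        refine Finset.sum_le_sum fun p hp => ?_
        have hp := Finset.HasAntidiagonal.mem_antidiagonal.1 hp
        have h1 : (n + k + p.2).choose p.2 ≤ (n + 2 * k).choose k := by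
          rw [← Nat.choose_symm_add, show n + 2 * k = n + k + k by ring, ← Nat.choose_symm_add]
          exact Nat.choose_le_choose _ (by omega)
        have h2 : a ^ (n + 1 + 2 * k) = a ^ (n + k + 1 + p.2) * a ^ p.1 := by
          rw [← pow_add]
          congr 1
          omega
        rw [h2]
        have h3 : ((n + 2 * k).choose k : ℝ) / (a ^ (n + k + 1 + p.2) * a ^ p.1) *
            (k.choose p.1 • (a ^ p.1 * t ^ p.2)) =
            (k.choose p.1 : ℝ) * ((n + 2 * k).choose k : ℝ) * t ^ p.2 / a ^ (n + k + 1 + p.2) := by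
          rw [nsmul_eq_mul]
          field_simp
        rw [h3]
        gcongr
    _ = ((n + 2 * k).choose k : ℝ) / a ^ (n + 1 + 2 * k) * (a + t) ^ k := by
        rw [← Finset.mul_sum, (Commute.all a t).add_pow']
    _ ≤ _ := mul_le_of_le_one_right (by positivity) (pow_le_one₀ (by positivity) hat)

theorem MeasureTheory.MemLp.integrable_smul_of_two {α F : Type*} [MeasurableSpace α]
    {μ : Measure α} [NormedAddCommGroup F] [NormedSpace ℂ F] {φ : α → ℂ} {f : α → F}
    (hφ : MemLp φ 2 μ) (hf : MemLp f 2 μ) : Integrable (fun z => φ z • f z) μ :=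
  memLp_one_iff_integrable.1 (hf.smul hφ)

theorem norm_integral_smul_le_sqrt_mul_sqrt {α F : Type*} [MeasurableSpace α] {μ : Measure α}
    [NormedAddCommGroup F] [NormedSpace ℂ F] {φ : α → ℂ} {f : α → F}
    (hφ : MemLp φ 2 μ) (hf : MemLp f 2 μ) :
    ‖∫ z, φ z • f z ∂μ‖ ≤ √(∫ z, ‖φ z‖ ^ 2 ∂μ) * √(∫ z, ‖f z‖ ^ 2 ∂μ) := by
  have h := integral_mul_le_Lp_mul_Lq_of_nonneg (μ := μ) Real.HolderConjugate.two_two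
    (f := fun z => ‖φ z‖) (g := fun z => ‖f z‖) (Filter.Eventually.of_forall fun _ => norm_nonneg _)
    (Filter.Eventually.of_forall fun _ => norm_nonneg _)
    (by simpa using hφ.norm) (by simpa using hf.norm)
  simp only [Real.rpow_two, ← Real.sqrt_eq_rpow] at h
  refine (norm_integral_le_integral_norm _).trans ?_
  simpa only [norm_smul] using h

theorem pow_mul_le_of_nonneg {x y : ℝ} (hx : 0 ≤ x) (hy : 0 ≤ y) (k : ℕ) :
    (k + 1) * (y * x ^ k) ≤ k * x ^ (k + 1) + y ^ (k + 1) := by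
  induction k with
  | zero => simp
  | succ k ih =>
    have h1 := mul_le_mul_of_nonneg_left ih hx
    have h2 : 0 ≤ (x ^ (k + 1) - y ^ (k + 1)) * (x - y) := by
      rcases le_total x y with h | h
      · exact mul_nonneg_of_nonpos_of_nonpos
          (sub_nonpos.2 (pow_le_pow_left₀ hx h _)) (sub_nonpos.2 h)
      · exact mul_nonneg (sub_nonneg.2 (pow_le_pow_left₀ hy h _)) (sub_nonneg.2 h)
    push_cast
    ring_nf at h1 h2 ⊢
    linarith

theorem add_one_sq_mul_choose_mul_choose (n k : ℕ) :
    (k + 1) ^ 2 * ((n + (k + 1)).choose (k + 1) * (n + 2 * (k + 1)).choose (k + 1)) =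
      (n + 2 * k + 2) * (n + 2 * k + 1) * ((n + k).choose k * (n + 2 * k).choose k) := by
  have h (j : ℕ) : (n + j).choose j * (n + 2 * j).choose j * (n.factorial * j.factorial ^ 2) =
      (n + 2 * j).factorial := by
    have h1 := Nat.add_choose_mul_factorial_mul_factorial n j
    have h2 := Nat.add_choose_mul_factorial_mul_factorial (n + j) j
    rw [show n + 2 * j = n + j + j by ring, ← h2, ← h1]
    ring
  have h0 : 0 < n.factorial * k.factorial ^ 2 := by positivity
  refine Nat.eq_of_mul_eq_mul_right h0 ?_
  have h1 := h (k + 1)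
  have h2 := h k
  rw [Nat.factorial_succ k, show n + 2 * (k + 1) = n + 2 * k + 1 + 1 by ring,
    Nat.factorial_succ, Nat.factorial_succ, ← h2] at h1
  rw [show n + 2 * (k + 1) = n + 2 * k + 1 + 1 by ring]
  linarith

theorem choose_mul_choose_le {n k : ℕ} (hn : 2 ≤ n) (hk : 3 ≤ k) :
    (n + k).choose k * (n + 2 * k).choose k ≤ (n + 1) ^ (2 * k) := by
  induction k, hk using Nat.le_induction with
  | base =>
    have h0 := add_one_sq_mul_choose_mul_choose n 0
    have h1 := add_one_sq_mul_choose_mul_choose n 1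
    have h2 := add_one_sq_mul_choose_mul_choose n 2
    obtain ⟨m, rfl⟩ := Nat.exists_eq_add_of_le hn
    simp only [Nat.choose_zero_right, zero_add, mul_zero, mul_one, one_add_one_eq_two,
      Nat.reduceAdd, Nat.reduceMul, add_zero, one_pow, one_mul] at h0 h1 h2 ⊢
    rw [h0] at h1
    have h3 : 36 * ((2 + m + 3).choose 3 * (2 + m + 6).choose 3) =
      (2 + m + 6) * (2 + m + 5) * ((2 + m + 4) * (2 + m + 3) * ((2 + m + 2) * (2 + m + 1))) := by
      rw [← h1]
      linarith
    have h4 : (2 + m + 6) * (2 + m + 5) * ((2 + m + 4) * (2 + m + 3) * ((2 + m + 2) * (2 + m + 1)))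
        ≤ 36 * (2 + m + 1) ^ 6 := by
      ring_nf
      nlinarith [Nat.zero_le (m ^ 2), Nat.zero_le (m ^ 3)]
    omega
  | succ k hk ih =>
    have h1 := add_one_sq_mul_choose_mul_choose n k
    have h2 : n + 2 * k + 2 ≤ (n + 1) * (k + 1) := by nlinarith
    have h3 : (n + 2 * k + 2) * (n + 2 * k + 1) ≤ ((n + 1) * (k + 1)) * ((n + 1) * (k + 1)) :=
      Nat.mul_le_mul h2 (by omega)
    have h4 := Nat.mul_le_mul h3 ih
    rw [← h1] at h4
    refine le_of_mul_le_mul_left ?_ (by positivity : 0 < (k + 1) ^ 2)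
    calc _ ≤ _ := h4
      _ = _ := by ring

section
variable {n : ℕ} {ζ : En n}

theorem memLp_kernel (hζ : ‖ζ‖ < 1) (v w : En n) (k m : ℕ) :
    MemLp (fun z => inner ℂ z w * inner ℂ z v ^ k * ((1 - inner ℂ z ζ) ^ m)⁻¹) 2
      (ballMeasure n) := by
  have hc : ContinuousOn (fun z : En n =>
      inner ℂ z w * inner ℂ z v ^ k * ((1 - inner ℂ z ζ) ^ m)⁻¹) (ball 0 1) :=
    (by fun_prop : ContinuousOn _ _).mul (continuousOn_inv_one_sub_inner_pow hζ _)
  refine MemLp.of_bound hc.aestronglyMeasurable_ballMeasure (‖w‖ * ‖v‖ ^ k * ((1 - ‖ζ‖) ^ m)⁻¹) ?_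
  filter_upwards [ae_ballMeasure n] with z hz
  rw [norm_mul, norm_mul, norm_pow]
  gcongr
  · exact norm_inner_le_of_mem_ball hz w
  · exact norm_inner_le_of_mem_ball hz v
  · exact norm_inv_one_sub_inner_pow_le hz hζ m

theorem memLp_kernel_pow (hζ : ‖ζ‖ < 1) (v : En n) (k m : ℕ) :
    MemLp (fun z => inner ℂ z v ^ k * ((1 - inner ℂ z ζ) ^ m)⁻¹) 2 (ballMeasure n) := by
  have hc : ContinuousOn (fun z : En n =>
      inner ℂ z v ^ k * ((1 - inner ℂ z ζ) ^ m)⁻¹) (ball 0 1) :=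
    (by fun_prop : ContinuousOn _ _).mul (continuousOn_inv_one_sub_inner_pow hζ _)
  refine MemLp.of_bound hc.aestronglyMeasurable_ballMeasure (‖v‖ ^ k * ((1 - ‖ζ‖) ^ m)⁻¹) ?_
  filter_upwards [ae_ballMeasure n] with z hz
  rw [norm_mul, norm_pow]
  gcongr
  · exact norm_inner_le_of_mem_ball hz v
  · exact norm_inv_one_sub_inner_pow_le hz hζ m

variable {F : Type*} [NormedAddCommGroup F] [NormedSpace ℂ F] {f : En n → F}

theorem taylorCoeff_smul (c d : ℂ) (v w : En n) (k : ℕ) :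
    taylorCoeff f ζ k (c • v) (d • w) = (c ^ k * d) • taylorCoeff f ζ k v w := by
  have (z : En n) : (inner ℂ z (d • w) * inner ℂ z (c • v) ^ k *
      ((1 - inner ℂ z ζ) ^ (n + k + 2))⁻¹) • f z = (c ^ k * d) • (inner ℂ z w * inner ℂ z v ^ k *
      ((1 - inner ℂ z ζ) ^ (n + k + 2))⁻¹) • f z := by
    rw [smul_smul, inner_smul_right, inner_smul_right]
    congr 1
    ring
  simp only [taylorCoeff, this, integral_smul]
  rw [smul_comm]

theorem norm_taylorCoeff_le_of_unit {k : ℕ} {C : ℝ} (hk : k ≠ 0)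
    (h : ∀ v w, ‖v‖ = 1 → ‖w‖ = 1 → ‖taylorCoeff f ζ k v w‖ ≤ C) (v w : En n) :
    ‖taylorCoeff f ζ k v w‖ ≤ C * ‖v‖ ^ k * ‖w‖ := by
  rcases eq_or_ne v 0 with rfl | hv
  · have := taylorCoeff_smul (f := f) (ζ := ζ) 0 1 0 w k
    rw [zero_smul, one_smul, zero_pow hk, zero_mul, zero_smul] at this
    simp [this, hk]
  rcases eq_or_ne w 0 with rfl | hw
  · have := taylorCoeff_smul (f := f) (ζ := ζ) 1 0 v 0 k
    rw [zero_smul, one_smul, mul_zero, zero_smul] at this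
    simp [this]
  have h1 (x : En n) (hx : x ≠ 0) : ‖((‖x‖ : ℂ)⁻¹) • x‖ = 1 := by simp [norm_smul, hx]
  have h2 (x : En n) (hx : x ≠ 0) : x = (‖x‖ : ℂ) • ((‖x‖ : ℂ)⁻¹) • x := by
    rw [smul_smul, mul_inv_cancel₀ (by simpa using hx), one_smul]
  have h3 := h _ _ (h1 v hv) (h1 w hw)
  conv_lhs => rw [h2 v hv, h2 w hw, taylorCoeff_smul, norm_smul]
  calc _ ≤ ‖(‖v‖ : ℂ) ^ k * (‖w‖ : ℂ)‖ * C := by gcongr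
    _ = _ := by simp; ring

theorem norm_taylorCoeff_le_of_two_le (hn : 2 ≤ n) (hζ : ‖ζ‖ < 1)
    (hf : MemLp f 2 (ballMeasure n)) {k : ℕ} (hk : 2 ≤ k) {v w : En n} (hv : ‖v‖ = 1)
    (hw : ‖w‖ = 1) :
    ‖taylorCoeff f ζ k v w‖ ≤ √(∫ z, ‖f z‖ ^ 2 ∂ballMeasure n) / √((1 - ‖ζ‖ ^ 2) ^ (n + 1)) *
      ((n + 1) / (1 - ‖ζ‖ ^ 2)) ^ (k + 1) := by
  have ha : 0 < 1 - ‖ζ‖ ^ 2 := by nlinarith [norm_nonneg ζ]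
  set a := 1 - ‖ζ‖ ^ 2
  set C : ℝ := ((n + (k + 1)).choose (k + 1) : ℝ)
  set D : En n → ℝ := fun v => ∫ z, ‖inner ℂ z v ^ (k + 1) *
    ((1 - inner ℂ z ζ) ^ (n + 1 + (k + 1)))⁻¹‖ ^ 2 ∂ballMeasure n with hD
  have hDle (x : En n) (hx : ‖x‖ = 1) : C * D x ≤
      ((n + 2 * (k + 1)).choose (k + 1) : ℝ) / a ^ (n + 1 + 2 * (k + 1)) :=
    choose_mul_integral_norm_kernel_sq_le (by omega) hζ hx (k + 1)
  set J := ∫ z, ‖inner ℂ z w * inner ℂ z v ^ k * ((1 - inner ℂ z ζ) ^ (n + k + 2))⁻¹‖ ^ 2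
    ∂ballMeasure n with hJ
  have hint (x : En n) := (memLp_kernel_pow hζ x (k + 1) (n + 1 + (k + 1))).integrable_norm_pow
    two_ne_zero
  have hJD : (k + 1) * J ≤ k * D v + D w := by
    simp only [hJ, hD]
    rw [← integral_const_mul, ← integral_const_mul, ← integral_add ((hint v).const_mul _) (hint w)]
    refine integral_mono
      (((memLp_kernel hζ v w k (n + k + 2)).integrable_norm_pow two_ne_zero).const_mul _)
      (((hint v).const_mul _).add (hint w)) fun z => ?_
    have h1 := pow_mul_le_of_nonneg (sq_nonneg ‖inner ℂ z v‖) (sq_nonneg ‖inner ℂ z w‖) k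
    have h2 := mul_le_mul_of_nonneg_right h1
      (sq_nonneg ‖((1 - inner ℂ z ζ) ^ (n + k + 2))⁻¹‖)
    simp only [norm_mul, norm_pow, mul_pow, ← pow_mul, mul_comm _ 2] at h2 ⊢
    rw [show n + 1 + (k + 1) = n + k + 2 by ring]
    linarith
  have hCJ : C ^ 2 * J ≤ (n + 1) ^ (2 * (k + 1)) / a ^ (n + 1 + 2 * (k + 1)) := by
    have h1 : C * J ≤ ((n + 2 * (k + 1)).choose (k + 1) : ℝ) / a ^ (n + 1 + 2 * (k + 1)) := by
      have hC : 0 ≤ C := by positivity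
      have h2 := mul_le_mul_of_nonneg_left hJD hC
      have h3 := mul_le_mul_of_nonneg_left (hDle v hv) (Nat.cast_nonneg (α := ℝ) k)
      have h4 := hDle w hw
      have h5 : (0 : ℝ) < k + 1 := by positivity
      refine le_of_mul_le_mul_left ?_ h5
      linarith
    have h2 : C * ((n + 2 * (k + 1)).choose (k + 1) : ℝ) ≤ (n + 1) ^ (2 * (k + 1)) := by
      simp only [C]
      exact_mod_cast choose_mul_choose_le hn (by omega : 3 ≤ k + 1)
    calc C ^ 2 * J = C * (C * J) := by ring
      _ ≤ C * (((n + 2 * (k + 1)).choose (k + 1) : ℝ) / a ^ (n + 1 + 2 * (k + 1))) := by gcongr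
      _ = C * ((n + 2 * (k + 1)).choose (k + 1) : ℝ) / a ^ (n + 1 + 2 * (k + 1)) := by ring
      _ ≤ _ := by gcongr
  have hCS := norm_integral_smul_le_sqrt_mul_sqrt (memLp_kernel hζ v w k (n + k + 2)) hf
  have hsq : C * √J ≤ ((n + 1) / a) ^ (k + 1) / √(a ^ (n + 1)) := by
    refine le_of_sq_le_sq ?_ (by positivity)
    rw [mul_pow, Real.sq_sqrt (integral_nonneg fun _ => by positivity), div_pow,
      Real.sq_sqrt (by positivity)]
    refine hCJ.trans_eq ?_
    rw [pow_add a, div_pow _ a (k + 1), div_pow, ← pow_mul, ← pow_mul, mul_comm (k + 1) 2]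
    field_simp
  rw [taylorCoeff, norm_smul, Complex.norm_natCast]
  calc _ ≤ C * (√J * √(∫ z, ‖f z‖ ^ 2 ∂ballMeasure n)) := by
        rw [show n + k + 1 = n + (k + 1) by ring]
        gcongr
    _ = C * √J * √(∫ z, ‖f z‖ ^ 2 ∂ballMeasure n) := by ring
    _ ≤ ((n + 1) / a) ^ (k + 1) / √(a ^ (n + 1)) * √(∫ z, ‖f z‖ ^ 2 ∂ballMeasure n) := by
        gcongr
    _ = _ := by ring

theorem integral_norm_sub_smul_sq {α : Type*} [MeasurableSpace α] {μ : Measure α} {φ ψ : α → ℂ}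
    (hφ : MemLp φ 2 μ) (hψ : MemLp ψ 2 μ) (β : ℂ) :
    ∫ z, ‖φ z - β * ψ z‖ ^ 2 ∂μ = ∫ z, ‖φ z‖ ^ 2 ∂μ -
      2 * (starRingEnd ℂ β * ∫ z, φ z * starRingEnd ℂ (ψ z) ∂μ).re +
        ‖β‖ ^ 2 * ∫ z, ‖ψ z‖ ^ 2 ∂μ := by
  have h1 : Integrable (fun z => φ z * starRingEnd ℂ (ψ z)) μ := hφ.integrable_mul hψ.star
  have h2 := hφ.integrable_norm_pow two_ne_zero
  have h3 := hψ.integrable_norm_pow two_ne_zero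
  have h4 (z : α) : ‖φ z - β * ψ z‖ ^ 2 = ‖φ z‖ ^ 2 -
      2 * (starRingEnd ℂ β * (φ z * starRingEnd ℂ (ψ z))).re + ‖β‖ ^ 2 * ‖ψ z‖ ^ 2 := by
    simp only [← Complex.normSq_eq_norm_sq]
    rw [Complex.normSq_sub, Complex.normSq_mul, map_mul]
    ring_nf
  simp only [h4]
  have h5 : Integrable (fun z => (starRingEnd ℂ β * (φ z * starRingEnd ℂ (ψ z))).re) μ :=
    (h1.const_mul (starRingEnd ℂ β)).re
  have h6 : Integrable (fun z => ‖φ z‖ ^ 2 -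
      2 * (starRingEnd ℂ β * (φ z * starRingEnd ℂ (ψ z))).re) μ := h2.sub (h5.const_mul 2)
  rw [integral_add h6 (h3.const_mul _), integral_sub h2 (h5.const_mul 2),
    integral_const_mul, integral_const_mul, ← integral_const_mul (starRingEnd ℂ β)]
  congr 3
  exact integral_re (h1.const_mul (starRingEnd ℂ β))

theorem norm_taylorCoeff_one_self_le [CompleteSpace F] (hn : 2 ≤ n) (hζ : ‖ζ‖ < 1)
    (hd : DifferentiableOn ℂ f (ball 0 1)) (hf : MemLp f 2 (ballMeasure n)) (hfζ : f ζ = 0)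
    {v : En n} (hv : ‖v‖ = 1) :
    ‖taylorCoeff f ζ 1 v v‖ ≤ √(∫ z, ‖f z‖ ^ 2 ∂ballMeasure n) / √((1 - ‖ζ‖ ^ 2) ^ (n + 1)) *
      ((n + 1) / (1 - ‖ζ‖ ^ 2)) ^ 2 := by
  have ha : 0 < 1 - ‖ζ‖ ^ 2 := by nlinarith [norm_nonneg ζ]
  have hat := one_sub_norm_sq_add_norm_inner_sq_le (ζ := ζ) hv
  have hi : Integrable f (ballMeasure n) := hf.integrable one_le_two
  have hrep := bergman_reproducing hd hi (by omega) (x := ζ) (by simpa using hζ)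
  set ψ : En n → ℂ := fun z => inner ℂ z v ^ 2 * ((1 - inner ℂ z ζ) ^ (n + 3))⁻¹ with hψ
  set K : En n → ℂ := fun z => ((1 - inner ℂ z ζ) ^ (n + 1))⁻¹ with hK
  have hψL : MemLp ψ 2 (ballMeasure n) := memLp_kernel_pow hζ v 2 (n + 3)
  have hKL : MemLp K 2 (ballMeasure n) := by simpa using memLp_kernel_pow hζ v 0 (n + 1)
  set a := 1 - ‖ζ‖ ^ 2 with ha'
  set t := ‖inner ℂ v ζ‖ ^ 2 with ht'
  have ht : 0 ≤ t := by positivity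
  set C : ℝ := ((n + 2).choose 2 : ℝ) with hC
  have hC' : C = (n + 2) * (n + 1) / 2 := by
    rw [hC, Nat.cast_choose_two]
    push_cast
    ring
  have hC0 : C ≠ 0 := by rw [hC']; positivity
  have hψ2 : C * ∫ z, ‖ψ z‖ ^ 2 ∂ballMeasure n =
      ((n + 4) * (n + 3) / 2 * t ^ 2 + 2 * (n + 3) * t * a + a ^ 2) / a ^ (n + 5) := by
    refine (choose_mul_integral_norm_kernel_sq (by omega : 0 < n) hζ hv 2).trans ?_
    simp only [Finset.Nat.antidiagonal_succ, Finset.Nat.antidiagonal_zero]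
    simp [← ha', ← ht', Nat.cast_choose_two]
    rw [pow_add a n 5, pow_add _ _ 2, pow_add _ _ 1, pow_add _ _ 1, pow_add _ _ 2]
    field_simp
    ring
  have hK2 : ∫ z, ‖K z‖ ^ 2 ∂ballMeasure n = (a ^ (n + 1))⁻¹ := by
    simpa [K] using choose_mul_integral_norm_kernel_sq (by omega : 0 < n) hζ hv 0
  have hψK : ∫ z, ψ z * starRingEnd ℂ (K z) ∂ballMeasure n =
      inner ℂ ζ v ^ 2 / (a : ℂ) ^ (n + 3) := by
    have hC1 : ((n + 2).choose 2 : ℂ) ≠ 0 := 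
      Nat.cast_ne_zero.2 (Nat.choose_pos (by omega)).ne'
    have h1 := integral_kernel_mul_testFunction (by omega : 0 < n) hζ hv 0 n 2
    refine mul_left_cancel₀ hC1 (Eq.trans ?_ (h1.trans ?_))
    · simp [ψ, K, add_assoc]
    · simp [Finset.Nat.antidiagonal_succ, ← ha', add_assoc]
      ring
  set β : ℂ := inner ℂ ζ v ^ 2 / (a : ℂ) ^ 2 with hβ
  have hct : ‖inner ℂ ζ v‖ ^ 2 = t := by rw [ht', norm_inner_symm]
  clear_value t
  have hβn : ‖β‖ ^ 2 = t ^ 2 / a ^ 4 := by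
    rw [hβ, norm_div, norm_pow, norm_pow, hct, Complex.norm_real, Real.norm_of_nonneg ha.le,
      div_pow, ← pow_mul a]
  have hβI : (starRingEnd ℂ β * ∫ z, ψ z * starRingEnd ℂ (K z) ∂ballMeasure n).re =
      t ^ 2 / a ^ (n + 5) := by
    have h1 : starRingEnd ℂ β * (inner ℂ ζ v ^ 2 / (a : ℂ) ^ (n + 3)) =
        ((t ^ 2 / a ^ (n + 5) : ℝ) : ℂ) := by
      have h2 : (t : ℂ) = starRingEnd ℂ (inner ℂ ζ v) * inner ℂ ζ v := by
        rw [← hct, Complex.conj_mul']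
        push_cast
        rfl
      rw [hβ, map_div₀, map_pow, map_pow, Complex.conj_ofReal, Complex.ofReal_div,
        Complex.ofReal_pow, Complex.ofReal_pow, h2, show n + 5 = 2 + (n + 3) by ring, pow_add _ 2]
      ring
    rw [hψK, h1, Complex.ofReal_re]
  set J := ∫ z, ‖ψ z - β * K z‖ ^ 2 ∂ballMeasure n with hJ
  have hCJ : C * J ≤ (2 * n + 5) / a ^ (n + 5) := by
    rw [hJ, integral_norm_sub_smul_sq hψL hKL, hβI, hβn, hK2]
    have h1 : C * (∫ z, ‖ψ z‖ ^ 2 ∂ballMeasure n - 2 * (t ^ 2 / a ^ (n + 5)) +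
        t ^ 2 / a ^ 4 * (a ^ (n + 1))⁻¹) =
        (a ^ 2 + 2 * (n + 3) * t * a + (2 * n + 5) * t ^ 2) / a ^ (n + 5) := by
      rw [mul_add, mul_sub, hψ2, hC', show n + 5 = 4 + (n + 1) by ring, pow_add _ 4]
      field_simp
      ring
    rw [h1]
    refine div_le_div_of_nonneg_right ?_ (by positivity)
    have h2 : (a + t) ^ 2 ≤ 1 := pow_le_one₀ (by positivity) hat
    have h3 : (0 : ℝ) ≤ n := Nat.cast_nonneg n
    have h4 : 0 ≤ t * a := by positivity
    nlinarith [mul_le_mul_of_nonneg_left h2 (by positivity : 0 ≤ 2 * (n : ℝ) + 5), sq_nonneg a,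
      mul_nonneg h3 h4, mul_nonneg h3 (sq_nonneg a)]
  have hCJ2 : C * √J ≤ ((n + 1) / a) ^ 2 / √(a ^ (n + 1)) := by
    refine le_of_sq_le_sq ?_ (by positivity)
    rw [mul_pow, Real.sq_sqrt (integral_nonneg fun _ => by positivity), div_pow,
      Real.sq_sqrt (by positivity)]
    have h1 : C * (2 * n + 5) ≤ (n + 1) ^ 4 := by
      rw [hC']
      have h2 : (2 : ℝ) ≤ n := by exact_mod_cast hn
      have h3 : ((n : ℝ) + 2) * (2 * n + 5) ≤ 2 * (n + 1) ^ 3 := by nlinarith [sq_nonneg (n : ℝ)]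
      nlinarith
    calc C ^ 2 * J = C * (C * J) := by ring
      _ ≤ C * ((2 * n + 5) / a ^ (n + 5)) := by gcongr
      _ = C * (2 * n + 5) / a ^ (n + 5) := by ring
      _ ≤ (n + 1) ^ 4 / a ^ (n + 5) := by gcongr
      _ = _ := by
        rw [show n + 5 = 4 + (n + 1) by ring, pow_add _ 4, div_pow]
        field_simp
  have hCS := norm_integral_smul_le_sqrt_mul_sqrt (hψL.sub (hKL.const_mul β)) hf
  have hsub : ∫ z, (ψ - fun z => β * K z) z • f z ∂ballMeasure n =
      ∫ z, ψ z • f z ∂ballMeasure n := by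
    have h1 : Integrable (fun z => ψ z • f z) (ballMeasure n) := hψL.integrable_smul_of_two hf
    have h2 : Integrable (fun z => β • K z • f z) (ballMeasure n) :=
      (hKL.integrable_smul_of_two hf).smul β
    simp only [Pi.sub_apply, sub_smul, mul_smul]
    rw [integral_sub h1 h2, integral_smul, hrep, hfζ, smul_zero, sub_zero]
  rw [hsub] at hCS
  have hT : taylorCoeff f ζ 1 v v = ((n + 2).choose 2 : ℂ) • ∫ z, ψ z • f z ∂ballMeasure n := by
    simp [taylorCoeff, ψ, sq]
  rw [hT, norm_smul, Complex.norm_natCast]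
  calc _ ≤ C * (√J * √(∫ z, ‖f z‖ ^ 2 ∂ballMeasure n)) := by
        gcongr
        exact hCS
    _ = C * √J * √(∫ z, ‖f z‖ ^ 2 ∂ballMeasure n) := by ring
    _ ≤ ((n + 1) / a) ^ 2 / √(a ^ (n + 1)) * √(∫ z, ‖f z‖ ^ 2 ∂ballMeasure n) := by
        gcongr
    _ = _ := by ring

theorem taylorCoeff_polarization (hζ : ‖ζ‖ < 1) (hf : MemLp f 2 (ballMeasure n)) (v w : En n) :
    (4 : ℂ) • taylorCoeff f ζ 1 v w =
      taylorCoeff f ζ 1 (v + w) (v + w) - taylorCoeff f ζ 1 (v - w) (v - w) := by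
  have h (x : En n) := (memLp_kernel hζ x x 1 (n + 1 + 2)).integrable_smul_of_two hf
  simp only [taylorCoeff]
  rw [← smul_sub, ← integral_sub (h _) (h _), smul_comm, ← integral_smul]
  congr 2
  ext z
  rw [← sub_smul, smul_smul]
  congr 1
  simp only [inner_add_right, inner_sub_right]
  ring

theorem norm_taylorCoeff_le [CompleteSpace F] (hn : 2 ≤ n) (hζ : ‖ζ‖ < 1)
    (hd : DifferentiableOn ℂ f (ball 0 1)) (hf : MemLp f 2 (ballMeasure n)) (hfζ : f ζ = 0)
    {k : ℕ} (hk : k ≠ 0) (v w : En n) :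
    ‖taylorCoeff f ζ k v w‖ ≤ √(∫ z, ‖f z‖ ^ 2 ∂ballMeasure n) / √((1 - ‖ζ‖ ^ 2) ^ (n + 1)) *
      ((n + 1) / (1 - ‖ζ‖ ^ 2)) ^ (k + 1) * ‖v‖ ^ k * ‖w‖ := by
  refine norm_taylorCoeff_le_of_unit hk (fun v w hv hw => ?_) v w
  rcases (by omega : k = 1 ∨ 2 ≤ k) with rfl | hk2
  · set M := √(∫ z, ‖f z‖ ^ 2 ∂ballMeasure n) / √((1 - ‖ζ‖ ^ 2) ^ (n + 1)) *
      ((n + 1) / (1 - ‖ζ‖ ^ 2)) ^ (1 + 1)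
    have hdiag (x : En n) : ‖taylorCoeff f ζ 1 x x‖ ≤ M * ‖x‖ ^ 2 := by
      rcases eq_or_ne x 0 with rfl | hx
      · have := taylorCoeff_smul (f := f) (ζ := ζ) 0 0 0 0 1
        simp only [zero_smul, mul_zero] at this
        simp [this]
      have h1 : ‖((‖x‖ : ℂ)⁻¹) • x‖ = 1 := by simp [norm_smul, hx]
      have h2 := norm_taylorCoeff_one_self_le hn hζ hd hf hfζ h1
      have h3 : ((‖x‖ : ℂ)⁻¹) ^ 1 * (‖x‖ : ℂ)⁻¹ = ((‖x‖ : ℂ) ^ 2)⁻¹ := by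
        rw [← pow_succ, inv_pow]
      rw [taylorCoeff_smul, h3, norm_smul, norm_inv, norm_pow, Complex.norm_real, norm_norm,
        inv_mul_le_iff₀ (by positivity), mul_comm] at h2
      exact h2
    have h1 := congrArg norm (taylorCoeff_polarization (f := f) hζ hf v w)
    have h2 := parallelogram_law_with_norm ℂ v w
    have h3 := norm_sub_le (taylorCoeff f ζ 1 (v + w) (v + w)) (taylorCoeff f ζ 1 (v - w) (v - w))
    have h4 := hdiag (v + w)
    have h5 := hdiag (v - w)
    have h6 : M * (‖v + w‖ ^ 2 + ‖v - w‖ ^ 2) = M * 4 := by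
      rw [h2, hv, hw]
      norm_num
    rw [norm_smul, Complex.norm_ofNat] at h1
    linarith
  · exact norm_taylorCoeff_le_of_two_le hn hζ hf hk2 hv hw

end

section

variable {n : ℕ} {ζ : En n}
variable {F : Type*} [NormedAddCommGroup F] [NormedSpace ℂ F] [CompleteSpace F] {f : En n → F}

theorem norm_add_norm_lt_one {v : En n} (hn : 0 < n) (hζ : ‖ζ‖ < 1)
    (hv : (n + 1) / (1 - ‖ζ‖ ^ 2) * ‖v‖ < 1) : ‖ζ‖ + ‖v‖ < 1 := by
  have ha : 0 < 1 - ‖ζ‖ ^ 2 := by nlinarith [norm_nonneg ζ]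
  have hn' : (1 : ℝ) ≤ n := by exact_mod_cast hn
  rw [div_mul_eq_mul_div, div_lt_one ha] at hv
  nlinarith [norm_nonneg ζ, norm_nonneg v, mul_le_mul_of_nonneg_right hn' (norm_nonneg v)]

theorem norm_fderiv_sub_fderiv_le (hn : 2 ≤ n) (hζ : ‖ζ‖ < 1)
    (hd : DifferentiableOn ℂ f (ball 0 1)) (hf : MemLp f 2 (ballMeasure n)) (hfζ : f ζ = 0)
    {v : En n} (hv : (n + 1) / (1 - ‖ζ‖ ^ 2) * ‖v‖ < 1) :
    ‖fderiv ℂ f (ζ + v) - fderiv ℂ f ζ‖ ≤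
      √(∫ z, ‖f z‖ ^ 2 ∂ballMeasure n) / √((1 - ‖ζ‖ ^ 2) ^ (n + 1)) *
        ((n + 1) / (1 - ‖ζ‖ ^ 2)) * (1 / (1 - (n + 1) / (1 - ‖ζ‖ ^ 2) * ‖v‖) ^ 2 - 1) := by
  have ha : 0 < 1 - ‖ζ‖ ^ 2 := by nlinarith [norm_nonneg ζ]
  have hζv := norm_add_norm_lt_one (by omega) hζ hv
  have hi : Integrable f (ballMeasure n) := hf.integrable one_le_two
  have hb {k : ℕ} (hk : k ≠ 0) (w : En n) := norm_taylorCoeff_le hn hζ hd hf hfζ hk v w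
  set l := √(∫ z, ‖f z‖ ^ 2 ∂ballMeasure n) / √((1 - ‖ζ‖ ^ 2) ^ (n + 1))
  set c := (n + 1) / (1 - ‖ζ‖ ^ 2)
  have hl : 0 ≤ l := by positivity
  have hc : 0 ≤ c := by positivity
  set u := c * ‖v‖ with hu
  have hu0 : 0 ≤ u := by positivity
  have hu1 : ‖u‖ < 1 := by rwa [Real.norm_of_nonneg hu0]
  have hgeom : HasSum (fun k : ℕ => ((k + 1 : ℕ) + 1 : ℝ) * u ^ (k + 1)) (1 / (1 - u) ^ 2 - 1) := by
    have h := (hasSum_coe_mul_geometric_of_norm_lt_one hu1).add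
      (hasSum_geometric_of_norm_lt_one hu1)
    rw [← hasSum_nat_add_iff' 1] at h
    have h1 : 1 - u ≠ 0 := by linarith
    have h2 : u / (1 - u) ^ 2 + (1 - u)⁻¹ - ∑ i ∈ Finset.range 1, ((i : ℝ) * u ^ i + u ^ i) =
        1 / (1 - u) ^ 2 - 1 := by
      simp
      field_simp
      ring
    rw [h2] at h
    refine h.congr_fun fun k => ?_
    push_cast
    ring
  have hu2 : 0 ≤ 1 / (1 - u) ^ 2 - 1 := hgeom.nonneg fun k => by positivity
  refine ContinuousLinearMap.opNorm_le_bound _ (by positivity) fun w => ?_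
  have h1 := hasSum_fderiv_apply hd hi (by omega) hζv w
  rw [← hasSum_nat_add_iff' 1] at h1
  have h2 := h1.norm_le_of_bounded (hgeom.mul_left (l * c * ‖w‖)) fun k => ?_
  · simp only [Finset.range_one, Finset.sum_singleton, zero_add, Nat.cast_one, one_smul,
      ← fderiv_apply_eq_taylorCoeff hd hi (by omega : 0 < n) hζ] at h2
    rw [sub_apply]
    linarith
  · rw [norm_smul, Complex.norm_natCast]
    refine (mul_le_mul_of_nonneg_left (hb (Nat.add_one_ne_zero k) w) (by positivity)).trans_eq ?_
    rw [hu]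
    push_cast
    ring_nf

theorem norm_fderiv_apply_sub_le (hn : 2 ≤ n) (hζ : ‖ζ‖ < 1)
    (hd : DifferentiableOn ℂ f (ball 0 1)) (hf : MemLp f 2 (ballMeasure n)) (hfζ : f ζ = 0)
    {v : En n} (hv : (n + 1) / (1 - ‖ζ‖ ^ 2) * ‖v‖ < 1) :
    ‖fderiv ℂ f (ζ + v) v - f (ζ + v)‖ ≤
      √(∫ z, ‖f z‖ ^ 2 ∂ballMeasure n) / √((1 - ‖ζ‖ ^ 2) ^ (n + 1)) *
        (((n + 1) / (1 - ‖ζ‖ ^ 2) * ‖v‖) ^ 2 /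
          (1 - (n + 1) / (1 - ‖ζ‖ ^ 2) * ‖v‖) ^ 2) := by
  have ha : 0 < 1 - ‖ζ‖ ^ 2 := by nlinarith [norm_nonneg ζ]
  have hζv := norm_add_norm_lt_one (by omega) hζ hv
  have hi : Integrable f (ballMeasure n) := hf.integrable one_le_two
  have hb {k : ℕ} (hk : k ≠ 0) := norm_taylorCoeff_le hn hζ hd hf hfζ hk v v
  set l := √(∫ z, ‖f z‖ ^ 2 ∂ballMeasure n) / √((1 - ‖ζ‖ ^ 2) ^ (n + 1))
  set c := (n + 1) / (1 - ‖ζ‖ ^ 2)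
  have hc : 0 ≤ c := by positivity
  set u := c * ‖v‖ with hu
  have hu0 : 0 ≤ u := by positivity
  have hu1 : ‖u‖ < 1 := by rwa [Real.norm_of_nonneg hu0]
  have h1 := (hasSum_fderiv_apply hd hi (by omega) hζv v).sub
    (hasSum_taylorCoeff hd hi (by omega) hζv)
  rw [hfζ, sub_zero] at h1
  refine (h1.norm_le_of_bounded ((hasSum_coe_mul_geometric_of_norm_lt_one hu1).mul_left (l * u))
    fun k => ?_).trans_eq (by ring)
  have h2 (x : F) : ((k + 1 : ℕ) : ℂ) • x - x = (k : ℂ) • x := by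
    rw [Nat.cast_succ, add_smul, one_smul, add_sub_cancel_right]
  rw [h2, norm_smul, Complex.norm_natCast]
  rcases eq_or_ne k 0 with rfl | hk
  · simp
  refine (mul_le_mul_of_nonneg_left (hb hk) (by positivity)).trans_eq ?_
  rw [hu]
  ring_nf

end

section

variable {n : ℕ} {ω : En n} {R : ℝ}

theorem add_smul_mem_ball_iff (hR : 0 < R) {z : En n} :
    ω + R • z ∈ ball ω R ↔ z ∈ ball (0 : En n) 1 := by
  rw [mem_ball_iff_norm, mem_ball_zero_iff, add_sub_cancel_left, norm_smul,
    Real.norm_of_nonneg hR.le, mul_lt_iff_lt_one_right hR]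

theorem indicator_ball_comp_add_smul {G : Type*} [Zero G] (hR : 0 < R) (h : En n → G) :
    (ball 0 1).indicator (fun z => h (ω + R • z)) =
      fun z => (ball ω R).indicator h (ω + R • z) := by
  ext z
  have := add_smul_mem_ball_iff (ω := ω) hR (z := z)
  by_cases hz : z ∈ ball (0 : En n) 1
  · rw [Set.indicator_of_mem hz, Set.indicator_of_mem (this.2 hz)]
  · rw [Set.indicator_of_notMem hz, Set.indicator_of_notMem (mt this.1 hz)]

theorem integrableOn_ball_comp_add_smul {h : En n → ℝ} (hR : 0 < R)
    (hh : IntegrableOn h (ball ω R)) : IntegrableOn (fun z => h (ω + R • z)) (ball 0 1) := by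
  rw [← integrable_indicator_iff measurableSet_ball] at hh ⊢
  rw [indicator_ball_comp_add_smul hR]
  exact (hh.comp_add_left ω).comp_smul hR.ne'

theorem setIntegral_ball_comp_add_smul (hR : 0 < R) (h : En n → ℝ) :
    ∫ z in ball 0 1, h (ω + R • z) = (R ^ (2 * n))⁻¹ * ∫ z in ball ω R, h z := by
  rw [← integral_indicator measurableSet_ball, indicator_ball_comp_add_smul hR,
    Measure.integral_comp_smul_of_nonneg volume (fun z => (ball ω R).indicator h (ω + z)) R
      (hR := hR.le), integral_add_left_eq_self, integral_indicator measurableSet_ball,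
    finrank_real_En, smul_eq_mul]

theorem sqrt_integral_norm_sq_ballMeasure {F : Type*} [NormedAddCommGroup F] (hR : 0 < R)
    (f : En n → F) :
    √(∫ z, ‖f (ω + R • z)‖ ^ 2 ∂ballMeasure n) = A2Norm ω R f := by
  rw [A2Norm, integral_ballMeasure, setIntegral_ball_comp_add_smul hR (fun z => ‖f z‖ ^ 2),
    smul_eq_mul, ← mul_assoc, ← div_eq_mul_inv, div_div]

variable {F : Type*} [NormedAddCommGroup F] [NormedSpace ℂ F] {f : En n → F}

theorem MemA2.hasFDerivAt_comp_add_smul (hR : 0 < R) (hf : MemA2 ω R f) {z : En n}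
    (hz : z ∈ ball (0 : En n) 1) :
    HasFDerivAt (fun z => f (ω + R • z)) ((R : ℂ) • fderiv ℂ f (ω + R • z)) z := by
  have h1 := (hf.1 _ ((add_smul_mem_ball_iff hR).2 hz)).differentiableAt.hasFDerivAt
  have h2 : HasFDerivAt (fun z : En n => ω + R • z)
      ((R : ℂ) • ContinuousLinearMap.id ℂ (En n)) z :=
    (((R : ℂ) • ContinuousLinearMap.id ℂ (En n)).hasFDerivAt).const_add ω
  refine (h1.comp z h2).congr_fderiv ?_
  ext w
  simp

theorem MemA2.memLp_comp_add_smul (hR : 0 < R) (hf : MemA2 ω R f) :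
    MemLp (fun z => f (ω + R • z)) 2 (ballMeasure n) := by
  have h : ContinuousOn (fun z => f (ω + R • z)) (ball 0 1) := fun z hz =>
    (hf.hasFDerivAt_comp_add_smul hR hz).continuousAt.continuousWithinAt
  rw [memLp_two_iff_integrable_sq_norm h.aestronglyMeasurable_ballMeasure]
  exact (integrableOn_ball_comp_add_smul hR hf.2).integrable_ballMeasure

theorem MemA2.norm_fderiv_sub_fderiv_le [CompleteSpace F] (hn : 2 ≤ n) (hR : 0 < R)
    (hf : MemA2 ω R f) {ζ x : En n} (hζ : ζ ∈ ball ω R) (hfζ : f ζ = 0) {κ : ℝ}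
    (hκ : (n + 1) / (R * (1 - (‖ζ - ω‖ / R) ^ 2)) ≤ κ) (hx : κ * ‖x - ζ‖ < 1) :
    ‖fderiv ℂ f x - fderiv ℂ f ζ‖ ≤
        A2Norm ω R f / √((1 - (‖ζ - ω‖ / R) ^ 2) ^ (n + 1)) * κ *
          (1 / (1 - κ * ‖x - ζ‖) ^ 2 - 1) ∧
      ‖fderiv ℂ f x (x - ζ) - f x‖ ≤
        A2Norm ω R f / √((1 - (‖ζ - ω‖ / R) ^ 2) ^ (n + 1)) *
          ((κ * ‖x - ζ‖) ^ 2 / (1 - κ * ‖x - ζ‖) ^ 2) := by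
  set g : En n → F := fun z => f (ω + R • z) with hg
  set z : En n := R⁻¹ • (ζ - ω) with hz
  set v : En n := R⁻¹ • (x - ζ) with hv
  have hzω : ω + R • z = ζ := by rw [hz, smul_inv_smul₀ hR.ne']; abel
  have hvω : ω + R • (z + v) = x := by
    rw [smul_add, hz, hv, smul_inv_smul₀ hR.ne', smul_inv_smul₀ hR.ne']; abel
  have hzn : ‖z‖ = ‖ζ - ω‖ / R := by
    rw [hz, norm_smul, norm_inv, Real.norm_of_nonneg hR.le, inv_mul_eq_div]
  have hvn : ‖v‖ = ‖x - ζ‖ / R := by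
    rw [hv, norm_smul, norm_inv, Real.norm_of_nonneg hR.le, inv_mul_eq_div]
  have hz1 : ‖z‖ < 1 := by
    rw [← mem_ball_zero_iff, ← add_smul_mem_ball_iff hR, hzω]
    exact hζ
  have ha : 0 < 1 - ‖z‖ ^ 2 := by nlinarith [norm_nonneg z]
  rw [← hzn] at hκ ⊢
  set c : ℝ := (n + 1) / (1 - ‖z‖ ^ 2) with hc
  have hc0 : 0 ≤ c := by positivity
  have hcκ : c / R ≤ κ := by rwa [hc, div_div, mul_comm]
  have hκ0 : 0 ≤ κ := (by positivity : 0 ≤ c / R).trans hcκ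
  have hu : c * ‖v‖ ≤ κ * ‖x - ζ‖ := by
    rw [hvn, mul_div_assoc', ← div_mul_eq_mul_div]
    gcongr
  have hd : DifferentiableOn ℂ g (ball 0 1) := fun y hy =>
    (hf.hasFDerivAt_comp_add_smul hR hy).differentiableAt.differentiableWithinAt
  have hL := hf.memLp_comp_add_smul hR
  have hgz : g z = 0 := by rw [hg]; simpa only [hzω] using hfζ
  have hv1 : c * ‖v‖ < 1 := hu.trans_lt hx
  have hzv := norm_add_norm_lt_one (by omega) hz1 hv1
  have h1 := _root_.norm_fderiv_sub_fderiv_le hn hz1 hd hL hgz hv1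
  have h2 := norm_fderiv_apply_sub_le hn hz1 hd hL hgz hv1
  have h3 : fderiv ℂ g (z + v) = (R : ℂ) • fderiv ℂ f x := by
    rw [(hf.hasFDerivAt_comp_add_smul hR ?_).fderiv, hvω]
    rw [mem_ball_zero_iff]
    exact (norm_add_le _ _).trans_lt hzv
  have h4 : fderiv ℂ g z = (R : ℂ) • fderiv ℂ f ζ := by
    rw [(hf.hasFDerivAt_comp_add_smul hR (mem_ball_zero_iff.2 hz1)).fderiv, hzω]
  have h5 : (R : ℂ) • v = x - ζ := smul_inv_smul₀ hR.ne' (x - ζ)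
  have h6 : g (z + v) = f x := by rw [hg]; simp only [hvω]
  rw [h3, h4, sqrt_integral_norm_sq_ballMeasure hR, ← smul_sub, norm_smul, Complex.norm_real,
    Real.norm_of_nonneg hR.le, ← le_div_iff₀' hR] at h1
  rw [h3, h6, sqrt_integral_norm_sq_ballMeasure hR, smul_apply, ← map_smul, h5] at h2
  have hA : 0 ≤ A2Norm ω R f := Real.sqrt_nonneg _
  have hu0 : 0 ≤ c * ‖v‖ := by positivity
  have hsub : 0 < 1 - κ * ‖x - ζ‖ := by linarith
  refine ⟨h1.trans ?_, h2.trans ?_⟩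
  · calc _ = A2Norm ω R f / √((1 - ‖z‖ ^ 2) ^ (n + 1)) * (c / R) *
          (1 / (1 - c * ‖v‖) ^ 2 - 1) := by ring
      _ ≤ A2Norm ω R f / √((1 - ‖z‖ ^ 2) ^ (n + 1)) * κ * (1 / (1 - κ * ‖x - ζ‖) ^ 2 - 1) := by
        have : 0 ≤ 1 / (1 - c * ‖v‖) ^ 2 - 1 := by
          rw [sub_nonneg, le_div_iff₀ (by nlinarith)]
          nlinarith
        gcongr
  · gcongr

end

theorem exists_equiv_norm_sub_symm_le {E : Type*} [NormedAddCommGroup E] [NormedSpace ℂ E]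
    [CompleteSpace E] (A : E ≃L[ℂ] E) (D : E →L[ℂ] E) (y b : E) {γ u : ℝ}
    (hu : u < 1) (hγu : γ < (1 + γ) * (1 - u) ^ 2)
    (h1 : ‖(A.symm : E →L[ℂ] E)‖ * ‖D - A‖ ≤ γ * (1 / (1 - u) ^ 2 - 1))
    (h2 : ‖(A.symm : E →L[ℂ] E)‖ * ‖D y - b‖ ≤ γ * (u ^ 2 / (1 - u) ^ 2)) :
    ∃ B : E ≃L[ℂ] E, (B : E →L[ℂ] E) = D ∧
      ‖y - B.symm b‖ ≤ γ * u ^ 2 / ((1 + γ) * (1 - u) ^ 2 - γ) := by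
  have hs : 0 < (1 - u) ^ 2 := pow_pos (sub_pos.2 hu) 2
  set s := (1 - u) ^ 2
  set T : E →L[ℂ] E := (A.symm : E →L[ℂ] E).comp ((A : E →L[ℂ] E) - D) with hT
  have hTs : ‖T‖ ≤ γ * (1 / s - 1) := by
    refine (ContinuousLinearMap.opNorm_comp_le _ _).trans ?_
    rwa [norm_sub_rev]
  have hgap : 1 - γ * (1 / s - 1) = ((1 + γ) * s - γ) / s := by
    field_simp
    ring
  have hgap0 : 0 < ((1 + γ) * s - γ) / s := div_pos (by linarith) hs
  have hT1 : ‖T‖ < 1 := by linarith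
  let B : E ≃L[ℂ] E := (ContinuousLinearEquiv.unitsEquiv ℂ E (Units.oneSub T hT1)).trans A
  have hBA (w : E) : A.symm (B w) = w - T w := A.symm_apply_apply _
  have hB : (B : E →L[ℂ] E) = D := by
    ext w
    refine A.symm.injective ((hBA w).trans ?_)
    simp [hT]
  refine ⟨B, hB, ?_⟩
  set w := y - B.symm b with hw
  have hBw : B w = D y - b := by
    rw [hw, map_sub, B.apply_symm_apply, ← hB]
    rfl
  have h3 : ‖w‖ ≤ ‖T‖ * ‖w‖ + γ * (u ^ 2 / s) :=
    calc ‖w‖ = ‖T w + A.symm (B w)‖ := by rw [hBA, add_sub_cancel]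
      _ ≤ ‖T w‖ + ‖A.symm (B w)‖ := norm_add_le _ _
      _ ≤ ‖T‖ * ‖w‖ + ‖(A.symm : E →L[ℂ] E)‖ * ‖B w‖ :=
        add_le_add (T.le_opNorm w) ((A.symm : E →L[ℂ] E).le_opNorm _)
      _ ≤ _ := by rw [hBw]; gcongr
  have h4 := mul_le_mul_of_nonneg_right hTs (norm_nonneg w)
  have h5 : ((1 + γ) * s - γ) / s * ‖w‖ ≤ γ * u ^ 2 / s := by
    rw [← hgap]
    linarith [mul_div_assoc γ (u ^ 2) s]
  rw [le_div_iff₀ (by linarith)]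
  rw [div_mul_eq_mul_div, div_le_div_iff_of_pos_right hs] at h5
  linarith

theorem lt_mul_one_sub_sq_of_lt_one_sub_sqrt {γ u : ℝ} (hγ : 0 < γ)
    (hu : u < 1 - √(γ / (1 + γ))) : u < 1 ∧ γ < (1 + γ) * (1 - u) ^ 2 := by
  have h : √(γ / (1 + γ)) < 1 - u := by linarith
  have h0 := Real.sqrt_nonneg (γ / (1 + γ))
  refine ⟨by linarith, ?_⟩
  rw [Real.sqrt_lt' (h0.trans_lt h), div_lt_iff₀ (by linarith)] at h
  linarith

/-- Let `ζ ∈ B(ω,R)` be a zero of `f = (f₁,…,f_n) ∈ A²(ω,R)^n` with `Df(ζ)` invertible;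
write `γ = γ(f,ζ)`, `κ = κ_ζ`, and for `x ∈ B(ω,R)` set `u = κ‖x−ζ‖`.  If
`u < 1 − √(γ/(1+γ))`, then `Df(x)` is invertible and the Newton iterate
`N_f(x) = x − Df(x)⁻¹ f(x)` satisfies `‖N_f(x) − ζ‖ ≤ γu²/((1+γ)(1−u)² − γ)`. -/
theorem stmt15 (n : ℕ) (hn : 2 ≤ n) (ω : En n) (R : ℝ) (hR : 0 < R)
    (f : En n → En n) (hf : MemA2 ω R f)
    (ζ : En n) (hζ : ζ ∈ ball ω R) (hfζ : f ζ = 0)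
    (A : En n ≃L[ℂ] En n) (hA : (A : En n →L[ℂ] En n) = fderiv ℂ f ζ) :
    let ν : ℝ := ‖ζ - ω‖ / R
    let κ : ℝ := max 1 (((n : ℝ) + 1) / (R * (1 - ν ^ 2)))
    let lam : ℝ := A2Norm ω R f / (1 - ν ^ 2) ^ (((n : ℝ) + 1) / 2)
    let γ : ℝ := max 1 (lam * κ * ‖(A.symm : En n →L[ℂ] En n)‖)
    ∀ x ∈ ball ω R,
      κ * ‖x - ζ‖ < 1 - Real.sqrt (γ / (1 + γ)) →
      ∃ B : En n ≃L[ℂ] En n, (B : En n →L[ℂ] En n) = fderiv ℂ f x ∧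
        ‖x - B.symm (f x) - ζ‖ ≤
          γ * (κ * ‖x - ζ‖) ^ 2 / ((1 + γ) * (1 - κ * ‖x - ζ‖) ^ 2 - γ) := by
  intro ν κ lam γ x _ hux
  have hν : ν < 1 := by rwa [div_lt_one hR, ← mem_ball_iff_norm]
  have hν0 : 0 ≤ ν := by positivity
  have ha : 0 ≤ 1 - ν ^ 2 := by nlinarith
  have hlam : lam = A2Norm ω R f / √((1 - ν ^ 2) ^ (n + 1)) := by
    simp only [lam]
    rw [Real.sqrt_eq_rpow, ← Real.rpow_natCast _ (n + 1), ← Real.rpow_mul ha, Nat.cast_add_one,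
      mul_one_div]
  have hlam0 : 0 ≤ lam := hlam ▸ div_nonneg (Real.sqrt_nonneg _) (Real.sqrt_nonneg _)
  have hκ : 1 ≤ κ := le_max_left _ _
  have hγ : lam * κ * ‖(A.symm : En n →L[ℂ] En n)‖ ≤ γ := le_max_right _ _
  have hγ1 : 1 ≤ γ := le_max_left _ _
  obtain ⟨hu1, hγu⟩ := lt_mul_one_sub_sq_of_lt_one_sub_sqrt (by linarith) hux
  have hu0 : 0 ≤ κ * ‖x - ζ‖ := by positivity
  obtain ⟨h1, h2⟩ := hf.norm_fderiv_sub_fderiv_le hn hR hζ hfζ (κ := κ)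
    (le_max_right _ _) hu1
  change _ ≤ A2Norm ω R f / √((1 - ν ^ 2) ^ (n + 1)) * _ * _ at h1
  change _ ≤ A2Norm ω R f / √((1 - ν ^ 2) ^ (n + 1)) * _ at h2
  rw [← hlam] at h1 h2
  set u := κ * ‖x - ζ‖
  set α := ‖(A.symm : En n →L[ℂ] En n)‖
  have hα : 0 ≤ α := norm_nonneg _
  have hs : 0 < 1 - u := by linarith
  have hs1 : 0 ≤ 1 / (1 - u) ^ 2 - 1 := by
    rw [sub_nonneg, le_div_iff₀ (by positivity)]
    nlinarith
  have hγ' : lam * α ≤ γ :=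
    (mul_le_mul_of_nonneg_right (le_mul_of_one_le_right hlam0 hκ) hα).trans hγ
  obtain ⟨B, hB, hBx⟩ := exists_equiv_norm_sub_symm_le A (fderiv ℂ f x) (x - ζ) (f x) hu1 hγu
    (by
      rw [hA]
      calc α * ‖fderiv ℂ f x - fderiv ℂ f ζ‖ ≤ α * (lam * κ * (1 / (1 - u) ^ 2 - 1)) := by gcongr
        _ = lam * κ * α * (1 / (1 - u) ^ 2 - 1) := by ring
        _ ≤ _ := by gcongr)
    (by
      calc α * ‖fderiv ℂ f x (x - ζ) - f x‖ ≤ α * (lam * (u ^ 2 / (1 - u) ^ 2)) := by gcongr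
        _ = lam * α * (u ^ 2 / (1 - u) ^ 2) := by ring
        _ ≤ _ := by gcongr)
  refine ⟨B, hB, ?_⟩
  rwa [sub_right_comm]
end
end

section
/- Let F ∈ A²(ω,R)^s, ζ ∈ B(ω,R), and p ≥ 1, and suppose D^k F(ζ) = 0 for all 0 ≤ k < p (so F vanishes to order p at ζ). Set λ = ‖F‖/(1 − ν_ζ²)^{(n+1)/2} and κ = κ_ζ. Then for every x ∈ ℂⁿ with u := κ‖x − ζ‖ < 1, one has [F]_ζ(x) ≤ λ u^p / (1 − u). -/
open MeasureTheory Metric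

noncomputable section

section Taylor

variable {E G : Type*} [NormedAddCommGroup E] [NormedSpace ℂ E]
  [NormedAddCommGroup G] [NormedSpace ℂ G]

theorem AnalyticOnNhd.differentiableOn_slice {f : E → G} {r : ℝ}
    (hf : AnalyticOnNhd ℂ f (ball 0 r)) {z : E} {ρ : ℝ} (hρ : ρ * ‖z‖ ≤ r) (hz : z ≠ 0) :
    DifferentiableOn ℂ (fun t : ℂ => f (t • z)) (ball 0 ρ) := by
  intro t ht
  have h : t • z ∈ ball (0 : E) r := by
    rw [mem_ball_zero_iff, norm_smul]
    rw [mem_ball_zero_iff] at ht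
    exact (mul_lt_mul_of_pos_right ht (norm_pos_iff.2 hz)).trans_le hρ
  have h2 : DifferentiableAt ℂ (fun t : ℂ => f (t • z)) t :=
    (hf _ h).differentiableAt.comp t (by fun_prop)
  exact h2.differentiableWithinAt

variable [CompleteSpace G]

theorem AnalyticAt.fderiv_apply_const {f : E → G} {x : E} (hf : AnalyticAt ℂ f x) (u : E) :
    AnalyticAt ℂ (fun y => fderiv ℂ f y u) x :=
  ((ContinuousLinearMap.apply ℂ G u).analyticAt _).comp hf.fderiv

theorem AnalyticAt.iteratedFDeriv_fderiv_apply {f : E → G} {x : E} (hf : AnalyticAt ℂ f x)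
    (u : E) (k : ℕ) (m : Fin k → E) :
    iteratedFDeriv ℂ k (fun y => fderiv ℂ f y u) x m =
      iteratedFDeriv ℂ k (fun y => fderiv ℂ f y) x m u := by
  have h := ContinuousLinearMap.iteratedFDeriv_comp_left (ContinuousLinearMap.apply ℂ G u)
    (f := fun y => fderiv ℂ f y) (x := x) (n := ⊤) hf.fderiv.contDiffAt (i := k)
    (by exact_mod_cast le_top)
  have h2 := congrArg (fun T => T m) h
  simpa [Function.comp_def] using h2

theorem AnalyticAt.iteratedFDeriv_iteratedFDeriv_apply {j k : ℕ} {f : E → G} {x : E}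
    (hf : AnalyticAt ℂ f x) (u : Fin j → E) (v : Fin k → E) :
    iteratedFDeriv ℂ j (fun y => iteratedFDeriv ℂ k f y v) x u =
      iteratedFDeriv ℂ (j + k) f x (Fin.append u v) := by
  induction k generalizing f x with
  | zero =>
    have h : (fun y => iteratedFDeriv ℂ 0 f y v) = f := by
      ext y; simp
    rw [h]
    congr 1
    ext i
    rw [Fin.append_right_nil _ _ rfl]; rfl
  | succ k ih =>
    have h1 : (fun y => iteratedFDeriv ℂ (k + 1) f y v) =ᶠ[nhds x]
        fun y => iteratedFDeriv ℂ k (fun y => fderiv ℂ f y (v (Fin.last k))) y (Fin.init v) := by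
      filter_upwards [hf.eventually_analyticAt] with y hy
      rw [iteratedFDeriv_succ_apply_right, hy.iteratedFDeriv_fderiv_apply]
    rw [h1.iteratedFDeriv ℂ j |>.eq_of_nhds, ih (hf.fderiv_apply_const _),
      hf.iteratedFDeriv_fderiv_apply]
    change _ = iteratedFDeriv ℂ ((j + k) + 1) f x (Fin.append (m := j) (n := k + 1) u v)
    rw [iteratedFDeriv_succ_apply_right]
    have h2 : (Fin.append (m := j) (n := k + 1) u v : Fin (j + k + 1) → E) (Fin.last (j + k)) = v (Fin.last k) := by
      exact Fin.append_right u v (Fin.last k)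
    have h3 : Fin.init (n := j + k) (α := fun _ => E) (Fin.append (m := j) (n := k + 1) u v : Fin (j + k + 1) → E) =
        Fin.append u (Fin.init v) := by
      ext i
      refine Fin.addCases (fun i => ?_) (fun i => ?_) i
      · rw [Fin.append_left]
        exact Fin.append_left u v i
      · rw [Fin.append_right]
        exact Fin.append_right u v i.castSucc
    rw [h2, h3]

theorem AnalyticAt.iteratedDeriv_comp_smul {f : E → G} (z : E) (t : ℂ)
    (hf : AnalyticAt ℂ f (t • z)) (j : ℕ) :
    iteratedDeriv j (fun s : ℂ => f (s • z)) t = iteratedFDeriv ℂ j f (t • z) (fun _ => z) := by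
  induction j generalizing f with
  | zero => simp
  | succ j ih =>
    have hc : ContinuousAt (fun s : ℂ => s • z) t := by fun_prop
    have h1 : deriv (fun s : ℂ => f (s • z)) =ᶠ[nhds t] fun s => fderiv ℂ f (s • z) z := by
      filter_upwards [hc.eventually hf.eventually_analyticAt] with s hs
      have h := hs.differentiableAt.hasFDerivAt.comp_hasDerivAt s ((hasDerivAt_id s).smul_const z)
      simpa [Function.comp_def] using h.deriv
    rw [iteratedDeriv_succ', h1.iteratedDeriv_eq, ih (hf.fderiv_apply_const z),
      hf.iteratedFDeriv_fderiv_apply, iteratedFDeriv_succ_apply_right]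
    rfl

theorem AnalyticOnNhd.hasSum_iteratedFDeriv {f : E → G}
    (hf : AnalyticOnNhd ℂ f (ball 0 1)) {z : E} (hz : ‖z‖ < 1) :
    HasSum (fun j : ℕ => ((j.factorial : ℂ)⁻¹) • iteratedFDeriv ℂ j f 0 (fun _ => z)) (f z) := by
  have h0 : AnalyticAt ℂ f ((0 : ℂ) • z) := by
    rw [zero_smul]; exact hf 0 (by simp)
  have hd : ∃ ρ : ℝ, 1 < ρ ∧ DifferentiableOn ℂ (fun t : ℂ => f (t • z)) (ball 0 ρ) := by
    by_cases hz0 : z = 0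
    · refine ⟨2, by norm_num, ?_⟩
      subst hz0
      simp only [smul_zero]
      exact differentiableOn_const _
    · refine ⟨‖z‖⁻¹, (one_lt_inv₀ (norm_pos_iff.2 hz0)).2 hz, ?_⟩
      refine hf.differentiableOn_slice ?_ hz0
      rw [inv_mul_cancel₀ (norm_ne_zero_iff.2 hz0)]
  obtain ⟨ρ, hρ, hd⟩ := hd
  have h := Complex.hasSum_taylorSeries_on_ball hd (z := 1) (by simpa using hρ)
  simpa [h0.iteratedDeriv_comp_smul] using h

theorem AnalyticOnNhd.hasSum_iteratedFDeriv_apply {f : E → G}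
    (hf : AnalyticOnNhd ℂ f (ball 0 1)) {z : E} (hz : ‖z‖ < 1) {k : ℕ} (v : Fin k → E) :
    HasSum (fun j : ℕ => ((j.factorial : ℂ)⁻¹) •
      iteratedFDeriv ℂ (j + k) f 0 (Fin.append (fun _ => z) v)) (iteratedFDeriv ℂ k f z v) := by
  have h : AnalyticOnNhd ℂ (fun y => iteratedFDeriv ℂ k f y v) (ball 0 1) := fun y hy =>
    ((ContinuousMultilinearMap.apply ℂ (fun _ : Fin k => E) G v).analyticAt _).comp
      ((hf.iteratedFDeriv k) y hy)
  have h2 := h.hasSum_iteratedFDeriv hz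
  simpa only [(hf 0 (by simp)).iteratedFDeriv_iteratedFDeriv_apply] using h2

end Taylor

section Layer

open Module

variable {E : Type*} [NormedAddCommGroup E] [NormedSpace ℝ E] [FiniteDimensional ℝ E]
  [MeasurableSpace E] [BorelSpace E]

theorem setLIntegral_ball_of_homogeneous (μ : Measure E) [μ.IsAddHaarMeasure] {h : E → ENNReal}
    {a : ℕ} (hom : ∀ (t : ℝ) (x : E), 0 < t → h (t • x) = ENNReal.ofReal t ^ a * h x)
    {r : ℝ} (hr : 0 < r) :
    ∫⁻ x in ball 0 r, h x ∂μ =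
      ENNReal.ofReal (r ^ (finrank ℝ E + a)) * ∫⁻ x in ball 0 1, h x ∂μ := by
  have h1 := Measure.map_addHaar_smul μ (inv_ne_zero hr.ne')
  have hm : MeasurableEmbedding (fun x : E => r⁻¹ • x) :=
    (Homeomorph.smul (isUnit_iff_ne_zero.2 (inv_ne_zero hr.ne')).unit).measurableEmbedding
  have h3 : (fun x : E => r⁻¹ • x) ⁻¹' ball 0 1 = ball 0 r := by
    ext x
    simp only [Set.mem_preimage, mem_ball_zero_iff, norm_smul, norm_inv, Real.norm_eq_abs,
      abs_of_pos hr]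
    rw [inv_mul_lt_iff₀ hr, mul_one]
  have h2 : ∫⁻ x in ball 0 1, h x ∂(Measure.map (fun x : E => r⁻¹ • x) μ) =
      ∫⁻ x in ball 0 r, h (r⁻¹ • x) ∂μ := by
    rw [hm.restrict_map, hm.lintegral_map, h3]
  have h4 : ∀ x, h x = ENNReal.ofReal r ^ a * h (r⁻¹ • x) := by
    intro x
    rw [← hom r _ hr, smul_inv_smul₀ hr.ne']
  have h5 : ENNReal.ofReal r ^ a ≠ ⊤ := ENNReal.pow_ne_top ENNReal.ofReal_ne_top
  calc ∫⁻ x in ball 0 r, h x ∂μ = ∫⁻ x in ball 0 r, ENNReal.ofReal r ^ a * h (r⁻¹ • x) ∂μ := by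
        simp_rw [← h4]
    _ = ENNReal.ofReal r ^ a * ∫⁻ x in ball 0 r, h (r⁻¹ • x) ∂μ := lintegral_const_mul' _ _ h5
    _ = _ := by
        rw [← h2, h1, Measure.restrict_smul, lintegral_smul_measure, smul_eq_mul, ← mul_assoc]
        congr 1
        rw [← ENNReal.ofReal_pow hr.le, ← ENNReal.ofReal_mul (by positivity), inv_pow, inv_inv,
          abs_of_pos (by positivity), pow_add, mul_comm]

theorem ofReal_exp_neg_eq_lintegral (c : ℝ) :
    ENNReal.ofReal (Real.exp (-c)) = ∫⁻ t in Set.Ioi c, ENNReal.ofReal (Real.exp (-t)) := by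
  rw [← integral_exp_neg_Ioi, ofReal_integral_eq_lintegral_ofReal]
  · exact integrableOn_exp_neg_Ioi c
  · exact Filter.Eventually.of_forall fun t => (Real.exp_pos _).le

theorem lintegral_pow_mul_exp_neg (k : ℕ) :
    ∫⁻ t in Set.Ioi (0 : ℝ), ENNReal.ofReal (Real.exp (-t)) * ENNReal.ofReal (t ^ k) =
      ENNReal.ofReal k.factorial := by
  have h := Real.GammaIntegral_convergent (s := k + 1) (by positivity)
  rw [← Real.Gamma_nat_eq_factorial, Real.Gamma_eq_integral (by positivity),
    ofReal_integral_eq_lintegral_ofReal h]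
  · refine setLIntegral_congr_fun measurableSet_Ioi fun t ht => ?_
    rw [← ENNReal.ofReal_mul (Real.exp_pos _).le]
    simp
  · refine (ae_restrict_iff' measurableSet_Ioi).2 (Filter.Eventually.of_forall fun t ht => ?_)
    have : (0 : ℝ) < t := ht
    simp only [Pi.zero_apply]
    positivity

theorem lintegral_mul_exp_neg_of_homogeneous (μ : Measure E) [μ.IsAddHaarMeasure] {h : E → ENNReal}
    (hmeas : Measurable h) {a k : ℕ}
    (hom : ∀ (t : ℝ) (x : E), 0 < t → h (t • x) = ENNReal.ofReal t ^ a * h x)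
    (hk : finrank ℝ E + a = 2 * k) :
    ∫⁻ x, h x * ENNReal.ofReal (Real.exp (-‖x‖ ^ 2)) ∂μ =
      ENNReal.ofReal k.factorial * ∫⁻ x in ball 0 1, h x ∂μ := by
  have h1 : ∀ x : E, h x * ENNReal.ofReal (Real.exp (-‖x‖ ^ 2)) =
      ∫⁻ t in Set.Ioi (0 : ℝ), {p : E × ℝ | ‖p.1‖ ^ 2 < p.2}.indicator
        (fun p => h p.1 * ENNReal.ofReal (Real.exp (-p.2))) (x, t) := by
    intro x
    rw [ofReal_exp_neg_eq_lintegral, ← lintegral_const_mul _ (by fun_prop),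
      ← lintegral_indicator measurableSet_Ioi, ← lintegral_indicator measurableSet_Ioi]
    congr 1
    ext t
    have := sq_nonneg ‖x‖
    by_cases ht : ‖x‖ ^ 2 < t
    · simp [Set.indicator, ht, this.trans_lt ht]
    · simp [Set.indicator, ht]
  have hms : MeasurableSet {p : E × ℝ | ‖p.1‖ ^ 2 < p.2} :=
    measurableSet_lt (by fun_prop) (by fun_prop)
  simp_rw [h1]
  rw [lintegral_lintegral_swap]
  · rw [← lintegral_pow_mul_exp_neg, ← lintegral_mul_const _ (by fun_prop)]
    refine setLIntegral_congr_fun measurableSet_Ioi fun t ht => ?_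
    have ht : (0 : ℝ) < t := ht
    have h2 : ∀ x : E, {p : E × ℝ | ‖p.1‖ ^ 2 < p.2}.indicator
        (fun p => h p.1 * ENNReal.ofReal (Real.exp (-p.2))) (x, t) =
        (ball (0 : E) √t).indicator (fun x => ENNReal.ofReal (Real.exp (-t)) * h x) x := by
      intro x
      have : ‖x‖ ^ 2 < t ↔ ‖x‖ < √t := (Real.lt_sqrt (norm_nonneg x)).symm
      by_cases hx : ‖x‖ < √t
      · simp [Set.indicator, hx, this.2 hx, mul_comm]
      · simp [Set.indicator, hx, this]
    simp only [h2]
    rw [lintegral_indicator measurableSet_ball, lintegral_const_mul' _ _ ENNReal.ofReal_ne_top,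
      setLIntegral_ball_of_homogeneous μ hom (Real.sqrt_pos.2 ht), hk, pow_mul,
      Real.sq_sqrt ht.le, mul_assoc]
  · refine Measurable.aemeasurable ?_
    exact ((hmeas.comp measurable_fst).mul (by fun_prop)).indicator hms

end Layer

/-- The monomial `z ↦ ∏ l, z (i l)` attached to a tuple of coordinate indices. -/
def tupleMonomial {m n : ℕ} (i : Fin m → Fin n) (z : En n) : ℂ := ∏ l, z (i l)

theorem continuous_tupleMonomial {m n : ℕ} (i : Fin m → Fin n) :
    Continuous (tupleMonomial i) := by
  unfold tupleMonomial; fun_prop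

theorem tupleMonomial_smul {m n : ℕ} (i : Fin m → Fin n) (t : ℂ) (z : En n) :
    tupleMonomial i (t • z) = t ^ m * tupleMonomial i z := by
  simp [tupleMonomial, Finset.prod_mul_distrib]

theorem prod_comp_eq_prod_pow_card {m n : ℕ} (i : Fin m → Fin n) (g : Fin n → ℝ) :
    ∏ l, g (i l) = ∏ j, g j ^ Fintype.card {l // i l = j} := by
  rw [← Finset.prod_fiberwise' Finset.univ i g]
  refine Finset.prod_congr rfl fun j _ => ?_
  rw [Finset.prod_const, Fintype.card_subtype]

theorem integral_normSq_pow_mul_gaussian (a : ℕ) :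
    ∫ w : ℂ, (‖w‖ ^ 2) ^ a * Real.exp (-‖w‖ ^ 2) = Real.pi * a.factorial := by
  have h := Complex.integral_rpow_mul_exp_neg_rpow (p := 2) (q := 2 * a) (by norm_num)
    (by linarith [(Nat.cast_nonneg a : (0 : ℝ) ≤ a)])
  have h2 : ((2 : ℝ) * a + 2) / 2 = a + 1 := by ring
  rw [h2, Real.Gamma_nat_eq_factorial] at h
  have h3 : ∀ w : ℂ, (‖w‖ ^ 2) ^ a * Real.exp (-‖w‖ ^ 2) =
      ‖w‖ ^ ((2 : ℝ) * a) * Real.exp (-‖w‖ ^ (2 : ℝ)) := by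
    intro w
    rw [← pow_mul]
    norm_cast
  simp_rw [h3]
  rw [h]; ring

theorem integrable_normSq_pow_mul_gaussian (a : ℕ) :
    Integrable fun w : ℂ => (‖w‖ ^ 2) ^ a * Real.exp (-‖w‖ ^ 2) := by
  by_contra h
  have h1 := integral_normSq_pow_mul_gaussian a
  rw [integral_undef h] at h1
  have : 0 < Real.pi * a.factorial := by positivity
  linarith

theorem lintegral_pi_gaussian {n : ℕ} (a : Fin n → ℕ) :
    ∫⁻ z : Fin n → ℂ, ENNReal.ofReal (∏ j, ((‖z j‖ ^ 2) ^ a j * Real.exp (-‖z j‖ ^ 2))) =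
      ENNReal.ofReal (Real.pi ^ n * ∏ j, ((a j).factorial : ℝ)) := by
  rw [← ofReal_integral_eq_lintegral_ofReal]
  · rw [integral_fintype_prod_volume_eq_prod
      (fun (j : Fin n) (w : ℂ) => (‖w‖ ^ 2) ^ a j * Real.exp (-‖w‖ ^ 2))]
    simp_rw [integral_normSq_pow_mul_gaussian, Finset.prod_mul_distrib]
    simp
  · exact Integrable.fintype_prod
      (f := fun (j : Fin n) (w : ℂ) => (‖w‖ ^ 2) ^ a j * Real.exp (-‖w‖ ^ 2))
      fun j => integrable_normSq_pow_mul_gaussian (a j)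
  · refine Filter.Eventually.of_forall fun z => ?_
    exact Finset.prod_nonneg fun j _ => by positivity

theorem exists_volume_En_eq_smul_map (n : ℕ) : ∃ c : NNReal, (volume : Measure (En n)) =
    c • Measure.map (EuclideanSpace.equiv (Fin n) ℂ).symm volume := by
  have : (Measure.map (EuclideanSpace.equiv (Fin n) ℂ).symm volume :
      Measure (En n)).IsAddHaarMeasure :=
    (EuclideanSpace.equiv (Fin n) ℂ).symm.isAddHaarMeasure_map volume
  exact ⟨_, Measure.isAddLeftInvariant_eq_smul _ _⟩

theorem exists_lintegral_tupleMonomial_gaussian (n : ℕ) : ∃ c : NNReal,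
    ∀ (m : ℕ) (i : Fin m → Fin n),
    ∫⁻ z : En n, ENNReal.ofReal (‖tupleMonomial i z‖ ^ 2) * ENNReal.ofReal (Real.exp (-‖z‖ ^ 2)) =
      c * ENNReal.ofReal
        (Real.pi ^ n * ∏ j, ((Fintype.card {l // i l = j}).factorial : ℝ)) := by
  obtain ⟨c, hc⟩ := exists_volume_En_eq_smul_map n
  refine ⟨c, fun m i => ?_⟩
  have hm : MeasurableEmbedding (EuclideanSpace.equiv (Fin n) ℂ).symm :=
    (EuclideanSpace.equiv (Fin n) ℂ).symm.toHomeomorph.measurableEmbedding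
  rw [hc, lintegral_smul_measure, hm.lintegral_map, ← lintegral_pi_gaussian]
  congr 1
  refine lintegral_congr fun z => ?_
  rw [← ENNReal.ofReal_mul (by positivity)]
  congr 1
  have h1 : ‖tupleMonomial i ((EuclideanSpace.equiv (Fin n) ℂ).symm z)‖ ^ 2 =
      ∏ l, ‖z (i l)‖ ^ 2 := by
    simp [tupleMonomial, Finset.prod_pow]
  have h2 : ‖(EuclideanSpace.equiv (Fin n) ℂ).symm z‖ ^ 2 = ∑ j, ‖z j‖ ^ 2 := by
    rw [EuclideanSpace.norm_sq_eq]
    simp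
  rw [h1, h2, prod_comp_eq_prod_pow_card i (fun j => ‖z j‖ ^ 2), Finset.prod_mul_distrib,
    ← Real.exp_sum, Finset.sum_neg_distrib]

theorem exists_setLIntegral_tupleMonomial (n : ℕ) : ∃ c : NNReal,
    ∀ (m : ℕ) (i : Fin m → Fin n),
    ENNReal.ofReal (n + m).factorial * ∫⁻ z in ball (0 : En n) 1,
        ENNReal.ofReal (‖tupleMonomial i z‖ ^ 2) =
      c * ENNReal.ofReal
        (Real.pi ^ n * ∏ j, ((Fintype.card {l // i l = j}).factorial : ℝ)) := by
  obtain ⟨c, hc⟩ := exists_lintegral_tupleMonomial_gaussian n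
  refine ⟨c, fun m i => ?_⟩
  rw [← hc m i]
  refine (lintegral_mul_exp_neg_of_homogeneous (E := En n) volume
    (h := fun z => ENNReal.ofReal (‖tupleMonomial i z‖ ^ 2)) (a := 2 * m) (k := n + m)
    ?_ ?_ ?_).symm
  · exact ((continuous_tupleMonomial i).norm.pow 2).measurable.ennreal_ofReal
  · intro t z ht
    have : (t • z : En n) = (t : ℂ) • z := by
      rfl
    rw [this, tupleMonomial_smul, norm_mul, mul_pow, ENNReal.ofReal_mul (by positivity),
      ← ENNReal.ofReal_pow ht.le, norm_pow, Complex.norm_real, Real.norm_eq_abs, abs_of_pos ht,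
      ← pow_mul, mul_comm m 2]
  · rw [finrank_real_En]; ring

theorem volume_ball_En {n : ℕ} (hn : 0 < n) :
    volume (ball (0 : En n) 1) = ENNReal.ofReal (Real.pi ^ n / n.factorial) := by
  have : Nontrivial (En n) := by
    have : Nonempty (Fin n) := ⟨⟨0, hn⟩⟩
    infer_instance
  rw [InnerProductSpace.volume_ball_of_dim_even (k := n) (finrank_real_En n)]
  simp

theorem setLIntegral_tupleMonomial {n : ℕ} (hn : 0 < n) {m : ℕ} (i : Fin m → Fin n) :
    ∫⁻ z in ball (0 : En n) 1, ENNReal.ofReal (‖tupleMonomial i z‖ ^ 2) =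
      ENNReal.ofReal (Real.pi ^ n / (n + m).factorial *
        ∏ j, ((Fintype.card {l // i l = j}).factorial : ℝ)) := by
  obtain ⟨c, hc⟩ := exists_setLIntegral_tupleMonomial n
  have h0 := hc 0 Fin.elim0
  have hpi := Real.pi_pos
  simp only [tupleMonomial, Finset.univ_eq_empty, Finset.prod_empty] at h0
  simp only [norm_one, one_pow, ENNReal.ofReal_one, lintegral_const, MeasurableSet.univ,
    Measure.restrict_apply, Set.univ_inter, one_mul, volume_ball_En hn, add_zero,
    Fintype.card_eq_zero, Nat.factorial_zero, Nat.cast_one, Finset.prod_const_one, mul_one] at h0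
  rw [← ENNReal.ofReal_mul (by positivity), mul_div_cancel₀ _ (by positivity)] at h0
  have hc1 : (c : ENNReal) = 1 := by
    have h1 : ENNReal.ofReal (Real.pi ^ n) ≠ 0 := by
      simp only [ne_eq, ENNReal.ofReal_eq_zero, not_le]; positivity
    rw [← ENNReal.mul_left_inj h1 ENNReal.ofReal_ne_top, ← h0, one_mul]
  have h := hc m i
  have hf : ENNReal.ofReal ((n + m).factorial : ℝ) ≠ 0 := by
    simp only [ne_eq, ENNReal.ofReal_eq_zero, not_le]; positivity
  rw [← ENNReal.mul_right_inj hf ENNReal.ofReal_ne_top, h, hc1, one_mul,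
    ← ENNReal.ofReal_mul (by positivity)]
  congr 1
  field_simp

theorem integral_norm_tupleMonomial_sq {n : ℕ} (hn : 0 < n) {m : ℕ} (i : Fin m → Fin n) :
    ∫ z in ball (0 : En n) 1, ‖tupleMonomial i z‖ ^ 2 =
      Real.pi ^ n / (n + m).factorial *
        ∏ j, ((Fintype.card {l // i l = j}).factorial : ℝ) := by
  rw [integral_eq_lintegral_of_nonneg_ae, setLIntegral_tupleMonomial hn, ENNReal.toReal_ofReal]
  · have := Real.pi_pos
    positivity
  · exact Filter.Eventually.of_forall fun z => by positivity
  · exact ((continuous_tupleMonomial i).norm.pow 2).aestronglyMeasurable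

theorem LinearIsometryEquiv.setIntegral_unitBall {n : ℕ} {G : Type*} [NormedAddCommGroup G]
    [NormedSpace ℝ G] (e : En n ≃ₗᵢ[ℂ] En n) (g : En n → G) :
    ∫ z in ball (0 : En n) 1, g (e z) = ∫ z in ball (0 : En n) 1, g z := by
  have h : MeasurePreserving e (volume : Measure (En n)) volume :=
    LinearIsometryEquiv.measurePreserving
      ({ e.toLinearEquiv.restrictScalars ℝ with norm_map' := e.norm_map } : En n ≃ₗᵢ[ℝ] En n)
  have h2 := h.setIntegral_preimage_emb e.toHomeomorph.measurableEmbedding g (ball 0 1)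
  rwa [e.preimage_ball, map_zero] at h2

/-- Multiplication of the coordinates of `ℂⁿ` by unimodular constants. -/
def coordRotation {n : ℕ} (c : Fin n → Circle) : En n ≃ₗᵢ[ℂ] En n :=
  LinearIsometryEquiv.piLpCongrRight 2 fun j =>
    { (LinearEquiv.smulOfUnit (Circle.toUnits (c j)) : ℂ ≃ₗ[ℂ] ℂ) with
      norm_map' := fun z => by
        change ‖((Circle.toUnits (c j) : ℂˣ) : ℂ) * z‖ = ‖z‖
        rw [norm_mul, Circle.toUnits_apply, Units.val_mk0, Circle.norm_coe, one_mul] }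

@[simp]
theorem coordRotation_apply {n : ℕ} (c : Fin n → Circle) (z : En n) (j : Fin n) :
    coordRotation c z j = c j * z j := rfl

theorem tupleMonomial_coordRotation {m n : ℕ} (i : Fin m → Fin n) (c : Fin n → Circle)
    (z : En n) : tupleMonomial i (coordRotation c z) = (∏ l, (c (i l) : ℂ)) * tupleMonomial i z := by
  simp [tupleMonomial, Finset.prod_mul_distrib]

theorem prod_update_circle {m n : ℕ} (i : Fin m → Fin n) (j : Fin n) (u : Circle) :
    ∏ l, ((Function.update (fun _ => 1) j u : Fin n → Circle) (i l) : ℂ) =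
      (u : ℂ) ^ Fintype.card {l // i l = j} := by
  rw [Fintype.card_subtype, ← Finset.prod_const, Finset.prod_filter]
  refine Finset.prod_congr rfl fun l _ => ?_
  by_cases h : i l = j
  · subst h; simp
  · simp [h]

theorem exists_circle_pow_ne {a b : ℕ} (hab : a ≠ b) : ∃ u : Circle, u ^ a ≠ u ^ b := by
  by_contra! h
  wlog hlt : a < b generalizing a b
  · exact this hab.symm (fun u => (h u).symm) (by omega)
  obtain ⟨d, rfl⟩ := Nat.exists_eq_add_of_lt hlt
  have h1 : ∀ u : Circle, u ^ (d + 1) = 1 := fun u => by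
    have := h u
    rw [add_assoc, pow_add] at this
    simpa using this
  have h2 := h1 (Circle.exp (Real.pi / (d + 1 : ℕ)))
  rw [← Circle.exp_nsmul, nsmul_eq_mul, mul_div_cancel₀ _ (by positivity)] at h2
  have h3 := congrArg (fun z : Circle => (z : ℂ)) h2
  simp at h3
  norm_num at h3

open scoped ComplexConjugate in
theorem integral_tupleMonomial_mul_conj_of_card_ne {m n : ℕ} {i i' : Fin m → Fin n} {j : Fin n}
    (hj : Fintype.card {l // i l = j} ≠ Fintype.card {l // i' l = j}) :
    ∫ z in ball (0 : En n) 1, tupleMonomial i z * conj (tupleMonomial i' z) = 0 := by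
  obtain ⟨u, hu⟩ := exists_circle_pow_ne hj
  have h := (coordRotation (Function.update (fun _ => 1) j u)).setIntegral_unitBall
    fun z => tupleMonomial i z * conj (tupleMonomial i' z)
  simp only [tupleMonomial_coordRotation, prod_update_circle, map_mul, map_pow] at h
  set a := Fintype.card {l // i l = j}
  set b := Fintype.card {l // i' l = j}
  have h2 : ∀ z : En n, (u : ℂ) ^ a * tupleMonomial i z * (conj (u : ℂ) ^ b *
      conj (tupleMonomial i' z)) = ((u : ℂ) ^ a * conj (u : ℂ) ^ b) *
        (tupleMonomial i z * conj (tupleMonomial i' z)) := fun z => by ring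
  simp_rw [h2] at h
  rw [integral_const_mul] at h
  by_contra h0
  have h3 := mul_right_cancel₀ h0 (h.trans (one_mul _).symm)
  apply hu
  have h4 : (u : ℂ) * conj (u : ℂ) = 1 := by
    rw [Complex.mul_conj, Circle.normSq_coe]; simp
  apply Subtype.ext
  rw [Circle.coe_pow, Circle.coe_pow]
  calc (u : ℂ) ^ a = (u : ℂ) ^ a * (u * conj (u : ℂ)) ^ b := by rw [h4]; simp
    _ = ((u : ℂ) ^ a * conj (u : ℂ) ^ b) * (u : ℂ) ^ b := by ring
    _ = _ := by rw [h3, one_mul]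

theorem exists_perm_of_card_eq {m n : ℕ} {i i' : Fin m → Fin n}
    (h : ∀ j, Fintype.card {l // i l = j} = Fintype.card {l // i' l = j}) :
    ∃ σ : Equiv.Perm (Fin m), i' ∘ σ = i := by
  choose e _ using fun j => (⟨Fintype.equivOfCardEq (h j), trivial⟩ :
    ∃ _ : {l // i l = j} ≃ {l // i' l = j}, True)
  refine ⟨((Equiv.sigmaFiberEquiv i).symm.trans (Equiv.sigmaCongrRight e)).trans
    (Equiv.sigmaFiberEquiv i'), funext fun l => ?_⟩
  exact (e (i l) ⟨l, rfl⟩).2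

open scoped ComplexConjugate in
theorem integral_tupleMonomial_mul_conj {m n : ℕ} (hn : 0 < n) (i i' : Fin m → Fin n) :
    ∫ z in ball (0 : En n) 1, tupleMonomial i z * conj (tupleMonomial i' z) =
      (Real.pi ^ n / (n + m).factorial : ℝ) *
        ∑ σ : Equiv.Perm (Fin m), if i' ∘ σ = i then (1 : ℂ) else 0 := by
  by_cases h : ∀ j, Fintype.card {l // i l = j} = Fintype.card {l // i' l = j}
  · obtain ⟨σ₀, rfl⟩ := exists_perm_of_card_eq h
    have h1 : ∀ z : En n, tupleMonomial (i' ∘ σ₀) z = tupleMonomial i' z := fun z =>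
      Equiv.prod_comp σ₀ (fun l => z (i' l))
    have h2 : ∀ z : En n, tupleMonomial i' z * conj (tupleMonomial i' z) =
        ((‖tupleMonomial i' z‖ ^ 2 : ℝ) : ℂ) := fun z => by
      rw [Complex.mul_conj, Complex.normSq_eq_norm_sq]
    simp_rw [h1, h2]
    rw [integral_complex_ofReal, integral_norm_tupleMonomial_sq hn, Complex.ofReal_mul]
    congr 1
    have h3 : ∑ σ : Equiv.Perm (Fin m), (if i' ∘ σ = i' ∘ σ₀ then (1 : ℂ) else 0) =
        ∑ σ : Equiv.Perm (Fin m), (if i' ∘ σ = i' then (1 : ℂ) else 0) := by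
      rw [← Equiv.sum_comp (Equiv.mulRight σ₀)]
      refine Finset.sum_congr rfl fun σ _ => ?_
      have : i' ∘ (Equiv.mulRight σ₀ σ) = i' ∘ σ₀ ↔ i' ∘ σ = i' := by
        rw [Equiv.coe_mulRight, Equiv.Perm.coe_mul, ← Function.comp_assoc]
        exact σ₀.surjective.injective_comp_right.eq_iff
      simp only [this]
    rw [h3, Finset.sum_boole, ← Fintype.card_subtype]
    have h4 := DomMulAct.stabilizer_card i'
    rw [h4]
    push_cast
    rfl
  · push Not at h
    obtain ⟨j, hj⟩ := h
    rw [integral_tupleMonomial_mul_conj_of_card_ne hj, Finset.sum_eq_zero, mul_zero]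
    intro σ _
    rw [if_neg]
    rintro rfl
    exact hj (Fintype.card_congr (σ.subtypeEquiv fun l => Iff.rfl))

open scoped ComplexConjugate in
theorem integral_norm_sq_sum_tupleMonomial {m n : ℕ} (hn : 0 < n) {U : (Fin m → Fin n) → ℂ}
    (hU : ∀ (i : Fin m → Fin n) (σ : Equiv.Perm (Fin m)), U (i ∘ σ) = U i) :
    ∫ z in ball (0 : En n) 1, ‖∑ i, U i * tupleMonomial i z‖ ^ 2 =
      Real.pi ^ n * m.factorial / (n + m).factorial * ∑ i, ‖U i‖ ^ 2 := by
  have h1 : ∀ z : En n, ((‖∑ i, U i * tupleMonomial i z‖ ^ 2 : ℝ) : ℂ) =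
      ∑ i, ∑ i', U i * conj (U i') * (tupleMonomial i z * conj (tupleMonomial i' z)) := by
    intro z
    rw [← Complex.normSq_eq_norm_sq, ← Complex.mul_conj, map_sum, Finset.sum_mul_sum]
    refine Finset.sum_congr rfl fun i _ => Finset.sum_congr rfl fun i' _ => ?_
    rw [map_mul]; ring
  have hint : ∀ i i' : Fin m → Fin n, Integrable (fun z : En n =>
      U i * conj (U i') * (tupleMonomial i z * conj (tupleMonomial i' z)))
      (volume.restrict (ball 0 1)) := by
    intro i i'
    have hc : Continuous fun z : En n =>
        U i * conj (U i') * (tupleMonomial i z * conj (tupleMonomial i' z)) :=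
      continuous_const.mul ((continuous_tupleMonomial i).mul
        (Complex.continuous_conj.comp (continuous_tupleMonomial i')))
    exact (hc.continuousOn.integrableOn_compact (isCompact_closedBall (0 : En n) 1)).mono_set
      ball_subset_closedBall
  apply Complex.ofReal_injective
  rw [← integral_complex_ofReal]
  simp only [h1]
  rw [integral_finsetSum _ fun i _ => integrable_finsetSum _ fun i' _ => hint i i']
  have h2 : ∀ i, ∫ z in ball (0 : En n) 1, ∑ i', U i * conj (U i') *
      (tupleMonomial i z * conj (tupleMonomial i' z)) = ∑ i', U i * conj (U i') *
        ((Real.pi ^ n / (n + m).factorial : ℝ) *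
        ∑ σ : Equiv.Perm (Fin m), if i' ∘ σ = i then (1 : ℂ) else 0) := by
    intro i
    rw [integral_finsetSum _ fun i' _ => hint i i']
    refine Finset.sum_congr rfl fun i' _ => ?_
    rw [integral_const_mul, integral_tupleMonomial_mul_conj hn]
  simp only [h2]
  rw [Finset.sum_comm]
  have h3 : ∀ i', ∑ i, U i * conj (U i') * ((Real.pi ^ n / (n + m).factorial : ℝ) *
      ∑ σ : Equiv.Perm (Fin m), if i' ∘ σ = i then (1 : ℂ) else 0) =
      (Real.pi ^ n / (n + m).factorial : ℝ) * (m.factorial * ((‖U i'‖ ^ 2 : ℝ) : ℂ)) := by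
    intro i'
    have : ∀ i, U i * conj (U i') * ((Real.pi ^ n / (n + m).factorial : ℝ) *
      ∑ σ : Equiv.Perm (Fin m), if i' ∘ σ = i then (1 : ℂ) else 0) =
      ∑ σ : Equiv.Perm (Fin m), if i' ∘ σ = i then (Real.pi ^ n / (n + m).factorial : ℝ) *
        (U i * conj (U i')) else 0 := by
      intro i
      rw [Finset.mul_sum, Finset.mul_sum]
      refine Finset.sum_congr rfl fun σ _ => ?_
      split_ifs <;> ring
    simp only [this]
    rw [Finset.sum_comm]
    simp only [Finset.sum_ite_eq, Finset.mem_univ, if_true, hU, Finset.sum_const,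
      Finset.card_univ, Fintype.card_perm, Fintype.card_fin, Complex.mul_conj,
      Complex.normSq_eq_norm_sq, nsmul_eq_mul]
    ring
  simp only [h3]
  rw [← Finset.mul_sum, ← Finset.mul_sum]
  push_cast
  ring

theorem ContinuousMultilinearMap.apply_eq_sum_single {m n : ℕ}
    (T : ContinuousMultilinearMap ℂ (fun _ : Fin m => En n) ℂ) (v : Fin m → En n) :
    T v = ∑ i : Fin m → Fin n, (∏ l, v l (i l)) * T fun l => EuclideanSpace.single (i l) 1 := by
  have h : v = fun l => ∑ j, v l j • (EuclideanSpace.single j (1 : ℂ) : En n) := by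
    funext l
    ext k
    simp [Pi.single_apply]
  conv_lhs => rw [h]
  rw [T.map_sum]
  exact Finset.sum_congr rfl fun i _ => T.map_smul_univ _ _

/-- The Taylor coefficient of `f` at the origin attached to a tuple of coordinate indices:
the value of `D^m f(0) / m!` on the corresponding standard basis vectors. -/
def taylorEntry {n : ℕ} (f : En n → ℂ) {m : ℕ} (i : Fin m → Fin n) : ℂ :=
  (m.factorial : ℂ)⁻¹ * iteratedFDeriv ℂ m f 0 fun l => EuclideanSpace.single (i l) 1

theorem AnalyticAt.taylorEntry_comp_perm {n : ℕ} {f : En n → ℂ} (hf : AnalyticAt ℂ f 0) {m : ℕ}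
    (i : Fin m → Fin n) (σ : Equiv.Perm (Fin m)) : taylorEntry f (i ∘ σ) = taylorEntry f i := by
  unfold taylorEntry
  rw [← (hf.contDiffAt (n := ⊤)).iteratedFDeriv_comp_perm
    (fun l => EuclideanSpace.single (i l) (1 : ℂ)) σ]
  rfl

theorem inv_factorial_mul_iteratedFDeriv_eq_sum {n : ℕ} (f : En n → ℂ) {m : ℕ}
    (v : Fin m → En n) : (m.factorial : ℂ)⁻¹ * iteratedFDeriv ℂ m f 0 v =
      ∑ i : Fin m → Fin n, (∏ l, v l (i l)) * taylorEntry f i := by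
  rw [ContinuousMultilinearMap.apply_eq_sum_single, Finset.mul_sum]
  exact Finset.sum_congr rfl fun i _ => by unfold taylorEntry; ring

theorem sum_norm_sq_le_integral_addCircle {a : ℕ → ℂ} {h : AddCircle (1 : ℝ) → ℂ}
    (ha : Summable a) (hh : ∀ θ, HasSum (fun m => a m * fourier m θ) (h θ)) (M : ℕ) :
    ENNReal.ofReal (∑ m ∈ Finset.range M, ‖a m‖ ^ 2) ≤
      ∫⁻ θ, ENNReal.ofReal (‖h θ‖ ^ 2) ∂AddCircle.haarAddCircle := by
  have : Fact ((0 : ℝ) < 1) := ⟨one_pos⟩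
  have hs : Summable fun m : ℕ => a m • (fourier (T := (1 : ℝ)) m) := by
    refine Summable.of_norm ?_
    simp_rw [norm_smul, fourier_norm, mul_one]
    exact ha.norm
  set g : C(AddCircle (1 : ℝ), ℂ) := ∑' m : ℕ, a m • (fourier (T := (1 : ℝ)) m) with hg
  have hgh : ∀ θ, g θ = h θ := fun θ => by
    have h1 := (ContinuousMap.evalCLM ℂ θ).hasSum hs.hasSum
    exact h1.unique (hh θ)
  set x := ContinuousMap.toLp (E := ℂ) 2 AddCircle.haarAddCircle ℂ g with hx
  have hv : Orthonormal ℂ fun m : ℕ => fourierLp (T := 1) 2 (m : ℤ) :=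
    orthonormal_fourier.comp _ Nat.cast_injective
  have hxs : HasSum (fun m : ℕ => a m • fourierLp (T := 1) 2 (m : ℤ)) x := by
    have h1 := (ContinuousMap.toLp (E := ℂ) 2 (AddCircle.haarAddCircle (T := 1)) ℂ).hasSum hs.hasSum
    simp only [map_smul] at h1
    exact h1
  have hin : ∀ m : ℕ, inner ℂ (fourierLp (T := 1) 2 (m : ℤ)) x = a m := by
    intro m
    have h1 := (innerSL ℂ (fourierLp (T := 1) 2 (m : ℤ))).hasSum hxs
    refine h1.unique ?_
    have h2 : (fun k : ℕ => innerSL ℂ (fourierLp (T := 1) 2 (m : ℤ))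
        (a k • fourierLp (T := 1) 2 (k : ℤ))) = fun k => if k = m then a m else 0 := by
      funext k
      rw [innerSL_apply_apply, inner_smul_right, orthonormal_iff_ite.1 hv m k]
      by_cases hk : m = k
      · subst hk; simp
      · simp [hk, Ne.symm hk]
    rw [h2]
    exact hasSum_ite_eq m (a m)
  have hb := hv.sum_inner_products_le (s := Finset.range M) x
  simp_rw [hin] at hb
  have hnorm : ENNReal.ofReal (‖x‖ ^ 2) =
      ∫⁻ θ, ENNReal.ofReal (‖h θ‖ ^ 2) ∂AddCircle.haarAddCircle := by
    have h1 : ‖x‖ ^ 2 = ∫ θ, ‖g θ‖ ^ 2 ∂AddCircle.haarAddCircle := by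
      rw [← inner_self_eq_norm_sq (𝕜 := ℂ) x, L2.inner_def, ← integral_re (L2.integrable_inner x x)]
      refine integral_congr_ae ?_
      filter_upwards [ContinuousMap.coeFn_toLp (E := ℂ) (p := 2) AddCircle.haarAddCircle (𝕜 := ℂ) g] with θ hθ
      rw [inner_self_eq_norm_sq, hx, hθ]
    rw [h1, ofReal_integral_eq_lintegral_ofReal]
    · simp_rw [hgh]
    · exact Continuous.integrable_of_hasCompactSupport (by fun_prop) (HasCompactSupport.of_compactSpace _)
    · exact Filter.Eventually.of_forall fun θ => by positivity
  rw [← hnorm]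
  exact ENNReal.ofReal_le_ofReal hb

theorem LinearIsometryEquiv.lintegral_comp_En {n : ℕ} (e : En n ≃ₗᵢ[ℂ] En n) (g : En n → ENNReal) :
    ∫⁻ z, g (e z) = ∫⁻ z, g z := by
  have h : MeasurePreserving e (volume : Measure (En n)) volume :=
    LinearIsometryEquiv.measurePreserving
      ({ e.toLinearEquiv.restrictScalars ℝ with norm_map' := e.norm_map } : En n ≃ₗᵢ[ℝ] En n)
  exact h.lintegral_comp_emb e.toHomeomorph.measurableEmbedding g

theorem AnalyticOnNhd.hasSum_fourier_rotation {n : ℕ} {f : En n → ℂ}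
    (hf : AnalyticOnNhd ℂ f (ball 0 1)) {z : En n} (hz : ‖z‖ < 1) (θ : AddCircle (1 : ℝ)) :
    HasSum (fun m : ℕ => ((m.factorial : ℂ)⁻¹ * iteratedFDeriv ℂ m f 0 fun _ => z) * fourier m θ)
      (f (coordRotation (fun _ => θ.toCircle) z)) := by
  have h : coordRotation (fun _ => θ.toCircle) z = (θ.toCircle : ℂ) • z := by
    ext j; simp
  rw [h]
  have h2 : ‖(θ.toCircle : ℂ) • z‖ < 1 := by
    rwa [norm_smul, Circle.norm_coe, one_mul]
  have h5 := hf.hasSum_iteratedFDeriv h2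
  refine HasSum.congr_fun h5 fun m => ?_
  have h3 := (iteratedFDeriv ℂ m f 0).map_smul_univ (fun _ => (θ.toCircle : ℂ)) fun _ => z
  rw [h3]
  simp only [fourier_apply, Finset.prod_const, Finset.card_univ, Fintype.card_fin, smul_eq_mul]
  have h4 : (((m : ℤ) • θ).toCircle : ℂ) = (θ.toCircle : ℂ) ^ m := by
    rw [natCast_zsmul, AddCircle.toCircle_nsmul, Circle.coe_pow]
  rw [h4]; ring

theorem AnalyticOnNhd.sum_lintegral_taylor_le {n : ℕ} {f : En n → ℂ}
    (hf : AnalyticOnNhd ℂ f (ball 0 1)) (M : ℕ) :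
    ∫⁻ z in ball (0 : En n) 1, ENNReal.ofReal
        (∑ m ∈ Finset.range M, ‖(m.factorial : ℂ)⁻¹ * iteratedFDeriv ℂ m f 0 fun _ => z‖ ^ 2) ≤
      ∫⁻ z in ball (0 : En n) 1, ENNReal.ofReal (‖f z‖ ^ 2) := by
  have : Fact ((0 : ℝ) < 1) := ⟨one_pos⟩
  classical
  set G : En n → ENNReal := (ball 0 1).indicator fun z => ENNReal.ofReal (‖f z‖ ^ 2) with hG
  have hGm : Measurable G := by
    have hc : ContinuousOn (fun z => ENNReal.ofReal (‖f z‖ ^ 2)) (ball 0 1) :=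
      ENNReal.continuous_ofReal.comp_continuousOn (hf.continuousOn.norm.pow 2)
    rw [hG, ← Set.piecewise_eq_indicator]
    exact hc.measurable_piecewise continuousOn_const isOpen_ball.measurableSet
  have hrot : Measurable fun q : En n × AddCircle (1 : ℝ) =>
      coordRotation (fun _ => q.2.toCircle) q.1 := by
    apply Continuous.measurable
    have : (fun q : En n × AddCircle (1 : ℝ) => coordRotation (fun _ => q.2.toCircle) q.1) =
        fun q => (q.2.toCircle : ℂ) • q.1 := by
      funext q; ext j; simp
    rw [this]
    exact (continuous_subtype_val.comp (AddCircle.continuous_toCircle.comp continuous_snd)).smul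
      continuous_fst
  calc _ ≤ ∫⁻ z in ball (0 : En n) 1, ∫⁻ θ : AddCircle (1 : ℝ),
          G (coordRotation (fun _ => θ.toCircle) z) ∂AddCircle.haarAddCircle := by
        refine setLIntegral_mono' isOpen_ball.measurableSet fun z hz => ?_
        have hz1 : ‖z‖ < 1 := by simpa using hz
        have hs := hf.hasSum_iteratedFDeriv hz1
        refine (sum_norm_sq_le_integral_addCircle hs.summable
          (fun θ => hf.hasSum_fourier_rotation hz1 θ) M).trans_eq ?_
        refine lintegral_congr fun θ => ?_
        rw [hG, Set.indicator_of_mem]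
        simpa using hz1
    _ ≤ ∫⁻ z : En n, ∫⁻ θ : AddCircle (1 : ℝ),
          G (coordRotation (fun _ => θ.toCircle) z) ∂AddCircle.haarAddCircle :=
        setLIntegral_le_lintegral _ _
    _ = ∫⁻ θ : AddCircle (1 : ℝ), ∫⁻ z : En n,
          G (coordRotation (fun _ => θ.toCircle) z) ∂volume ∂AddCircle.haarAddCircle :=
        lintegral_lintegral_swap (f := fun (z : En n) (θ : AddCircle (1 : ℝ)) =>
          G (coordRotation (fun _ => θ.toCircle) z)) (hGm.comp hrot).aemeasurable
    _ = ∫⁻ θ : AddCircle (1 : ℝ), (∫⁻ z : En n, G z) ∂AddCircle.haarAddCircle := by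
        simp_rw [LinearIsometryEquiv.lintegral_comp_En]
    _ = _ := by
        rw [lintegral_const, measure_univ, mul_one, hG,
          lintegral_indicator isOpen_ball.measurableSet]

/-- Bessel's inequality for the orthogonal expansion of a square integrable analytic function on
the unit ball into homogeneous polynomials. -/
theorem AnalyticOnNhd.sum_taylorEntry_sq_le {n : ℕ} (hn : 0 < n) {f : En n → ℂ}
    (hf : AnalyticOnNhd ℂ f (ball 0 1)) (hint : IntegrableOn (fun z => ‖f z‖ ^ 2) (ball 0 1))
    (M : ℕ) :
    ∑ m ∈ Finset.range M, (∑ i : Fin m → Fin n, ‖taylorEntry f i‖ ^ 2) / (n + m).choose n ≤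
      A2Norm 0 1 f ^ 2 := by
  have hpi := Real.pi_pos
  have h0 : AnalyticAt ℂ f 0 := hf 0 (by simp)
  have hcont : ∀ m : ℕ, Continuous fun z : En n =>
      ‖(m.factorial : ℂ)⁻¹ * iteratedFDeriv ℂ m f 0 fun _ => z‖ ^ 2 := fun m =>
    ((continuous_const.mul ((iteratedFDeriv ℂ m f 0).cont.comp
      (continuous_pi fun _ => continuous_id))).norm.pow 2)
  have hpint : ∀ m : ℕ, IntegrableOn (fun z : En n =>
      ‖(m.factorial : ℂ)⁻¹ * iteratedFDeriv ℂ m f 0 fun _ => z‖ ^ 2) (ball 0 1) := fun m =>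
    ((hcont m).continuousOn.integrableOn_compact (isCompact_closedBall (0 : En n) 1)).mono_set
      ball_subset_closedBall
  have h1 := hf.sum_lintegral_taylor_le M
  rw [← ofReal_integral_eq_lintegral_ofReal hint (Filter.Eventually.of_forall fun z => by positivity),
    ← ofReal_integral_eq_lintegral_ofReal (integrable_finsetSum _ fun m _ => hpint m)
      (Filter.Eventually.of_forall fun z => Finset.sum_nonneg fun m _ => by positivity),
    ENNReal.ofReal_le_ofReal_iff (integral_nonneg fun z => by positivity),
    integral_finsetSum _ fun m _ => hpint m] at h1
  have h2 : ∀ m : ℕ, ∫ z in ball (0 : En n) 1,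
      ‖(m.factorial : ℂ)⁻¹ * iteratedFDeriv ℂ m f 0 fun _ => z‖ ^ 2 =
      Real.pi ^ n / n.factorial *
        ((∑ i : Fin m → Fin n, ‖taylorEntry f i‖ ^ 2) / (n + m).choose n) := by
    intro m
    have h3 : ∀ z : En n, (m.factorial : ℂ)⁻¹ * iteratedFDeriv ℂ m f 0 (fun _ => z) =
        ∑ i : Fin m → Fin n, taylorEntry f i * tupleMonomial i z := fun z => by
      rw [inv_factorial_mul_iteratedFDeriv_eq_sum]
      exact Finset.sum_congr rfl fun i _ => mul_comm _ _
    simp_rw [h3]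
    rw [integral_norm_sq_sum_tupleMonomial hn fun i σ => h0.taylorEntry_comp_perm i σ,
      Nat.cast_add_choose]
    field_simp
  simp_rw [h2] at h1
  rw [← Finset.mul_sum] at h1
  unfold A2Norm
  rw [Real.sq_sqrt (mul_nonneg (by positivity) (integral_nonneg fun z => by positivity))]
  calc _ = n.factorial / Real.pi ^ n * (Real.pi ^ n / n.factorial * ∑ m ∈ Finset.range M,
        (∑ i : Fin m → Fin n, ‖taylorEntry f i‖ ^ 2) / (n + m).choose n) := by
        field_simp
    _ ≤ _ := by
        rw [one_pow, mul_one]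
        exact mul_le_mul_of_nonneg_left h1 (by positivity)

theorem HasSum.norm_sq_le_mul {t : ℕ → ℂ} {S : ℂ} (ht : HasSum t S) {a b : ℕ → ℝ} {A B : ℝ}
    (ha : ∀ j, 0 ≤ a j) (hb : ∀ j, 0 ≤ b j) (h : ∀ j, ‖t j‖ ^ 2 ≤ a j * b j)
    (hA : ∀ M, ∑ j ∈ Finset.range M, a j ≤ A) (hB : HasSum b B) : ‖S‖ ^ 2 ≤ A * B := by
  have hA0 : 0 ≤ A := (Finset.sum_nonneg fun j _ => ha j).trans (hA 0)
  refine le_of_tendsto (ht.tendsto_sum_nat.norm.pow 2) (Filter.Eventually.of_forall fun M => ?_)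
  calc ‖∑ j ∈ Finset.range M, t j‖ ^ 2 ≤ (∑ j ∈ Finset.range M, ‖t j‖) ^ 2 := by
        gcongr; exact norm_sum_le _ _
    _ ≤ (∑ j ∈ Finset.range M, a j) * ∑ j ∈ Finset.range M, b j :=
        Finset.sum_sq_le_sum_mul_sum_of_sq_le_mul _ (fun j _ => ha j) (fun j _ => hb j)
          fun j _ => h j
    _ ≤ A * B := mul_le_mul (hA M) (sum_le_hasSum _ (fun j _ => hb j) hB)
        (Finset.sum_nonneg fun j _ => hb j) hA0

theorem norm_sq_sum_prod_mul_le {m n : ℕ} (v : Fin m → En n) (t : (Fin m → Fin n) → ℂ) :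
    ‖∑ i : Fin m → Fin n, (∏ l, v l (i l)) * t i‖ ^ 2 ≤
      (∑ i, ‖t i‖ ^ 2) * ∏ l, ‖v l‖ ^ 2 := by
  have h1 : ∏ l, ‖v l‖ ^ 2 = ∑ i : Fin m → Fin n, ‖∏ l, v l (i l)‖ ^ 2 := by
    simp_rw [EuclideanSpace.norm_sq_eq, norm_prod, ← Finset.prod_pow]
    rw [Finset.prod_univ_sum, Fintype.piFinset_univ]
  rw [h1, mul_comm]
  calc _ ≤ (∑ i : Fin m → Fin n, ‖(∏ l, v l (i l)) * t i‖) ^ 2 := by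
        gcongr; exact norm_sum_le _ _
    _ ≤ _ := by
        simp_rw [norm_mul]
        exact Finset.sum_mul_sq_le_sq_mul_sq _ _ _

/-- The normalised `m`-th derivative of `f` at `z`, as a form in `v`. -/
def taylorForm {n : ℕ} (f : En n → ℂ) (z : En n) {m : ℕ} (v : Fin m → En n) : ℂ :=
  (m.factorial : ℂ)⁻¹ * iteratedFDeriv ℂ m f z v

/-- The square norm of the family of order-`m` Taylor entries at the origin, weighted as in the
Bergman norm. -/
def taylorWeight {n : ℕ} (f : En n → ℂ) (m : ℕ) : ℝ :=
  (∑ i : Fin m → Fin n, ‖taylorEntry f i‖ ^ 2) / (n + m).choose n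

theorem taylorWeight_nonneg {n : ℕ} (f : En n → ℂ) (m : ℕ) : 0 ≤ taylorWeight f m := by
  unfold taylorWeight; positivity

theorem sum_taylorEntry_sq {n : ℕ} (f : En n → ℂ) (m : ℕ) :
    ∑ i : Fin m → Fin n, ‖taylorEntry f i‖ ^ 2 = taylorWeight f m * (n + m).choose n := by
  have : ((n + m).choose n : ℝ) ≠ 0 := by
    exact_mod_cast (Nat.choose_pos (Nat.le_add_right n m)).ne'
  unfold taylorWeight
  field_simp

theorem norm_taylorForm_zero_sq_le {n : ℕ} (f : En n → ℂ) {m : ℕ} (v : Fin m → En n) :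
    ‖taylorForm f 0 v‖ ^ 2 ≤ taylorWeight f m * (n + m).choose n * ∏ l, ‖v l‖ ^ 2 := by
  unfold taylorForm
  rw [inv_factorial_mul_iteratedFDeriv_eq_sum, ← sum_taylorEntry_sq]
  exact norm_sq_sum_prod_mul_le _ _

theorem norm_taylorForm_sq_le_sum {n : ℕ} (f : En n → ℂ) (z : En n) {m : ℕ} (v : Fin m → En n) :
    ‖taylorForm f z v‖ ^ 2 ≤
      (∑ i : Fin m → Fin n, ‖taylorForm f z fun l => EuclideanSpace.single (i l) 1‖ ^ 2) *
        ∏ l, ‖v l‖ ^ 2 := by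
  have h : taylorForm f z v = ∑ i : Fin m → Fin n, (∏ l, v l (i l)) *
      taylorForm f z fun l => EuclideanSpace.single (i l) 1 := by
    unfold taylorForm
    rw [ContinuousMultilinearMap.apply_eq_sum_single, Finset.mul_sum]
    exact Finset.sum_congr rfl fun i _ => by ring
  rw [h]
  exact norm_sq_sum_prod_mul_le _ _

theorem cast_add_choose_right (K : Type*) [DivisionRing K] [CharZero K] (a b : ℕ) :
    ((a + b).choose b : K) = (a + b).factorial / (a.factorial * b.factorial) := by
  rw [← Nat.choose_symm_add, Nat.cast_add_choose]

theorem AnalyticOnNhd.hasSum_taylorForm {n : ℕ} {f : En n → ℂ}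
    (hf : AnalyticOnNhd ℂ f (ball 0 1)) {z : En n} (hz : ‖z‖ < 1) {k : ℕ} (v : Fin k → En n) :
    HasSum (fun j : ℕ => ((j + k).choose k : ℂ) * taylorForm f 0 (Fin.append (fun _ : Fin j => z) v))
      (taylorForm f z v) := by
  refine ((hf.hasSum_iteratedFDeriv_apply hz v).mul_left (k.factorial : ℂ)⁻¹).congr_fun fun j => ?_
  have h1 : ((j + k).factorial : ℂ) ≠ 0 := by exact_mod_cast (j + k).factorial_ne_zero
  have h2 : (j.factorial : ℂ) ≠ 0 := by exact_mod_cast j.factorial_ne_zero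
  have h3 : (k.factorial : ℂ) ≠ 0 := by exact_mod_cast k.factorial_ne_zero
  unfold taylorForm
  rw [smul_eq_mul, cast_add_choose_right]
  field_simp

theorem AnalyticOnNhd.sum_range_taylorWeight_le {n : ℕ} (hn : 0 < n) {f : En n → ℂ}
    (hf : AnalyticOnNhd ℂ f (ball 0 1)) (hint : IntegrableOn (fun z => ‖f z‖ ^ 2) (ball 0 1))
    (k M : ℕ) : ∑ j ∈ Finset.range M, taylorWeight f (j + k) ≤ A2Norm 0 1 f ^ 2 := by
  refine le_trans ?_ (hf.sum_taylorEntry_sq_le hn hint (M + k))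
  rw [Finset.range_eq_Ico, Finset.sum_Ico_add' (fun j => taylorWeight f j) 0 M k,
    Finset.range_eq_Ico]
  exact Finset.sum_le_sum_of_subset_of_nonneg (Finset.Ico_subset_Ico (Nat.zero_le _) le_rfl)
    fun j _ _ => taylorWeight_nonneg f j

theorem choose_sq_mul_choose_le (n k j : ℕ) :
    ((j + k).choose k : ℝ) ^ 2 * (n + (j + k)).choose n ≤
      (n + 2 * k).factorial / (n.factorial * k.factorial ^ 2) *
        (j + (n + 2 * k)).choose (n + 2 * k) := by
  have h : ((j + k).factorial : ℝ) * (n + (j + k)).factorial ≤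
      j.factorial * (j + (n + 2 * k)).factorial := by
    norm_cast
    rw [← Nat.factorial_mul_ascFactorial j k, show j + (n + 2 * k) = (n + (j + k)) + k by ring,
      ← Nat.factorial_mul_ascFactorial (n + (j + k)) k]
    calc j.factorial * (j + 1).ascFactorial k * (n + (j + k)).factorial ≤
      j.factorial * (n + (j + k) + 1).ascFactorial k * (n + (j + k)).factorial := by
          gcongr
          omega
      _ = _ := by ring
  rw [cast_add_choose_right, cast_add_choose_right, Nat.cast_add_choose]
  calc _ = (((j + k).factorial : ℝ) * (n + (j + k)).factorial) /
        (j.factorial ^ 2 * k.factorial ^ 2 * n.factorial) := by field_simp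
    _ ≤ ((j.factorial : ℝ) * (j + (n + 2 * k)).factorial) /
        (j.factorial ^ 2 * k.factorial ^ 2 * n.factorial) := by gcongr
    _ = _ := by field_simp

theorem AnalyticOnNhd.norm_taylorForm_sq_le {n : ℕ} (hn : 0 < n) {f : En n → ℂ}
    (hf : AnalyticOnNhd ℂ f (ball 0 1)) (hint : IntegrableOn (fun z => ‖f z‖ ^ 2) (ball 0 1))
    {z : En n} (hz : ‖z‖ < 1) {k : ℕ} (v : Fin k → En n) :
    ‖taylorForm f z v‖ ^ 2 ≤ A2Norm 0 1 f ^ 2 *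
      ((n + 2 * k).factorial / (n.factorial * k.factorial ^ 2) /
        (1 - ‖z‖ ^ 2) ^ (n + 1 + 2 * k) * ∏ l, ‖v l‖ ^ 2) := by
  have hx : ‖(‖z‖ ^ 2 : ℝ)‖ < 1 := by
    rw [Real.norm_of_nonneg (by positivity)]
    exact pow_lt_one₀ (norm_nonneg z) hz two_ne_zero
  have hs := ((hasSum_choose_mul_geometric_of_norm_lt_one (n + 2 * k) hx).mul_left
    ((n + 2 * k).factorial / (n.factorial * k.factorial ^ 2) : ℝ)).mul_right (∏ l, ‖v l‖ ^ 2)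
  have h := (hf.hasSum_taylorForm hz v).norm_sq_le_mul
    (a := fun j => taylorWeight f (j + k)) (fun j => taylorWeight_nonneg f _)
    (fun j => by positivity) ?_ (hf.sum_range_taylorWeight_le hn hint k) hs
  · refine h.trans_eq ?_
    rw [mul_one_div, show n + 1 + 2 * k = n + 2 * k + 1 by ring]
  · intro j
    rw [norm_mul, mul_pow, Complex.norm_natCast]
    have h1 := norm_taylorForm_zero_sq_le f (Fin.append (fun _ : Fin j => z) v)
    rw [Fin.prod_univ_add] at h1
    simp only [Fin.append_left, Fin.append_right, Finset.prod_const, Finset.card_univ,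
      Fintype.card_fin] at h1
    calc _ ≤ ((j + k).choose k : ℝ) ^ 2 * (taylorWeight f (j + k) * (n + (j + k)).choose n *
          ((‖z‖ ^ 2) ^ j * ∏ l, ‖v l‖ ^ 2)) := by gcongr
      _ = taylorWeight f (j + k) * ((((j + k).choose k : ℝ) ^ 2 * (n + (j + k)).choose n) *
          ((‖z‖ ^ 2) ^ j * ∏ l, ‖v l‖ ^ 2)) := by ring
      _ ≤ taylorWeight f (j + k) * (((n + 2 * k).factorial / (n.factorial * k.factorial ^ 2) *
          (j + (n + 2 * k)).choose (n + 2 * k)) * ((‖z‖ ^ 2) ^ j * ∏ l, ‖v l‖ ^ 2)) := by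
        refine mul_le_mul_of_nonneg_left ?_ (taylorWeight_nonneg f _)
        exact mul_le_mul_of_nonneg_right (choose_sq_mul_choose_le n k j) (by positivity)
      _ = _ := by ring

theorem factorial_add_two_mul_le {n k : ℕ} (hn : 2 ≤ n) (hk : 2 ≤ k) (hnk : 3 ≤ n ∨ 3 ≤ k) :
    (n + 2 * k).factorial ≤ (n + 1) ^ (2 * k) * (n.factorial * k.factorial ^ 2) := by
  have step : ∀ k, 2 ≤ k →
      (n + 2 * k).factorial ≤ (n + 1) ^ (2 * k) * (n.factorial * k.factorial ^ 2) →
      (n + 2 * (k + 1)).factorial ≤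
        (n + 1) ^ (2 * (k + 1)) * (n.factorial * (k + 1).factorial ^ 2) := by
    intro k hk h
    have h1 : n + 2 * k + 2 ≤ (n + 1) * (k + 1) := by nlinarith
    rw [show n + 2 * (k + 1) = n + 2 * k + 1 + 1 by ring, Nat.factorial_succ, Nat.factorial_succ,
      Nat.factorial_succ k]
    calc _ ≤ ((n + 1) * (k + 1)) * (((n + 1) * (k + 1)) *
          ((n + 1) ^ (2 * k) * (n.factorial * k.factorial ^ 2))) := by
          gcongr
          omega
      _ = _ := by ring
  rcases Nat.lt_or_ge n 3 with h3 | h3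
  · obtain rfl : n = 2 := by omega
    induction k, (show 3 ≤ k by omega) using Nat.le_induction with
    | base => decide
    | succ k hk3 ih => exact step k (by omega) (ih (by omega) (Or.inr hk3))
  · induction k, hk using Nat.le_induction with
    | base =>
      rw [show n + 2 * 2 = n + 1 + 1 + 1 + 1 by ring, Nat.factorial_succ, Nat.factorial_succ,
        Nat.factorial_succ, Nat.factorial_succ]
      have h2 : Nat.factorial 2 = 2 := rfl
      rw [h2]
      have : (n + 1 + 1 + 1 + 1) * (n + 1 + 1 + 1) * (n + 1 + 1) ≤ 4 * (n + 1) ^ 3 := by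
        nlinarith [mul_le_mul h3 h3 (by norm_num) (by omega),
          mul_le_mul (mul_le_mul h3 h3 (by norm_num) (by omega)) h3 (by norm_num) (by positivity)]
      calc _ = (n + 1 + 1 + 1 + 1) * (n + 1 + 1 + 1) * (n + 1 + 1) * ((n + 1) * n.factorial) := by
            ring
        _ ≤ 4 * (n + 1) ^ 3 * ((n + 1) * n.factorial) := Nat.mul_le_mul_right _ this
        _ = _ := by ring
    | succ k hk2 ih => exact step k hk2 (ih (Or.inl h3))

theorem AnalyticOnNhd.norm_taylorForm_sq_le_of_three_le {n k : ℕ} (hn : 2 ≤ n) (hk : 2 ≤ k)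
    (hnk : 3 ≤ n ∨ 3 ≤ k) {f : En n → ℂ}
    (hf : AnalyticOnNhd ℂ f (ball 0 1)) (hint : IntegrableOn (fun z => ‖f z‖ ^ 2) (ball 0 1))
    {z : En n} (hz : ‖z‖ < 1) (v : Fin k → En n) :
    ‖taylorForm f z v‖ ^ 2 ≤ A2Norm 0 1 f ^ 2 *
      (((n : ℝ) + 1) ^ (2 * k) / (1 - ‖z‖ ^ 2) ^ (n + 1 + 2 * k) * ∏ l, ‖v l‖ ^ 2) := by
  have hx : 0 < 1 - ‖z‖ ^ 2 := sub_pos.2 (pow_lt_one₀ (norm_nonneg z) hz two_ne_zero)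
  refine (hf.norm_taylorForm_sq_le (by omega) hint hz v).trans ?_
  gcongr
  rw [div_le_iff₀ (by positivity)]
  exact_mod_cast factorial_add_two_mul_le hn hk hnk

theorem hasSum_descFactorial_mul_choose (n k : ℕ) {x : ℝ} (hx0 : 0 ≤ x) (hx : x < 1) :
    HasSum (fun m : ℕ => (m.descFactorial k : ℝ) * (n + m).choose n * x ^ (m - k))
      ((n + k).factorial / n.factorial / (1 - x) ^ (n + k + 1)) := by
  rw [← hasSum_nat_add_iff' k, Finset.sum_eq_zero, sub_zero]
  · have h := (hasSum_choose_mul_geometric_of_norm_lt_one (𝕜 := ℝ) (n + k) (r := x)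
      (by rwa [Real.norm_of_nonneg hx0])).mul_left ((n + k).factorial / n.factorial : ℝ)
    rw [mul_one_div] at h
    refine h.congr_fun fun j => ?_
    have h1 : (j.factorial : ℝ) * (j + k).descFactorial k = (j + k).factorial := by
      have := Nat.factorial_mul_descFactorial (Nat.le_add_left k j)
      rw [Nat.add_sub_cancel] at this
      exact_mod_cast this
    rw [Nat.add_sub_cancel, cast_add_choose_right, Nat.cast_add_choose, ← h1,
      show n + (j + k) = j + (n + k) by ring]
    have h2 : ((j + k).descFactorial k : ℝ) ≠ 0 := by
      have h3 : ((j + k).factorial : ℝ) ≠ 0 := by positivity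
      rw [← h1] at h3
      exact right_ne_zero_of_mul h3
    field_simp
  · intro m hm
    rw [Nat.descFactorial_of_lt (Finset.mem_range.1 hm)]
    simp

theorem AnalyticAt.succ_mul_norm_taylorEntry_sq_le {n : ℕ} {f : En n → ℂ} (hf : AnalyticAt ℂ f 0)
    {j k : ℕ} (o : Fin n) (b : Fin k → Fin n) {q : Fin k} (hq : b q ≠ o) :
    ((j : ℝ) + 1) * ‖taylorEntry f (Fin.append (fun _ : Fin j => o) b)‖ ^ 2 ≤
      taylorWeight f (j + k) * (n + (j + k)).choose n := by
  classical
  set i : Fin (j + k) → Fin n := Fin.append (fun _ : Fin j => o) b with hi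
  let g : Option (Fin j) → Fin (j + k) → Fin n := fun p =>
    p.elim i fun p => i ∘ Equiv.swap (Fin.castAdd k p) (Fin.natAdd j q)
  have hg0 : ∀ p' : Fin j, g none (Fin.castAdd k p') = o := fun p' => Fin.append_left _ _ _
  have hg1 : ∀ p : Fin j, g (some p) (Fin.castAdd k p) ≠ o := fun p => by
    simp only [g, Option.elim, Function.comp_apply, Equiv.swap_apply_left, hi, Fin.append_right]
    exact hq
  have hne : ∀ p' : Fin j, Fin.castAdd k p' ≠ Fin.natAdd j q := fun p' h => by
    have := congrArg Fin.val h
    simp at this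
    omega
  have hg2 : ∀ p p' : Fin j, p' ≠ p → g (some p) (Fin.castAdd k p') = o := fun p p' h => by
    simp only [g, Option.elim, Function.comp_apply]
    rw [Equiv.swap_apply_of_ne_of_ne (fun h' => h (Fin.castAdd_injective _ _ h')) (hne p'), hi,
      Fin.append_left]
  have hinj : Function.Injective g := by
    rintro (_ | p) (_ | p') h
    · rfl
    · exact absurd ((congrFun h _).symm.trans (hg0 p')) (hg1 p')
    · exact absurd ((congrFun h _).trans (hg0 p)) (hg1 p)
    · by_contra hpp
      have hpp' : p ≠ p' := fun h' => hpp (congrArg some h')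
      exact hg1 p ((congrFun h _).trans (hg2 p' p hpp'))
  have hval : ∀ p, ‖taylorEntry f (g p)‖ ^ 2 = ‖taylorEntry f i‖ ^ 2 := by
    rintro (_ | p)
    · rfl
    · simp only [g, Option.elim]
      rw [hf.taylorEntry_comp_perm]
  rw [← sum_taylorEntry_sq]
  calc _ = ∑ p : Option (Fin j), ‖taylorEntry f (g p)‖ ^ 2 := by
        simp [hval]
    _ = ∑ c ∈ Finset.univ.map ⟨g, hinj⟩, ‖taylorEntry f c‖ ^ 2 := by
        rw [Finset.sum_map]; rfl
    _ ≤ _ := Finset.sum_le_univ_sum_of_nonneg fun c => by positivity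

theorem HasSum.of_eq_of_eq {f g : ℕ → ℝ} {a b : ℝ} (hf : HasSum f a) (hab : a = b)
    (h : ∀ m, g m = f m) : HasSum g b :=
  hab ▸ hf.congr_fun h

theorem taylorForm_append_single {n j k : ℕ} (f : En n → ℂ) (o : Fin n) (ν : ℝ) (b : Fin k → Fin n) :
    taylorForm f 0 (Fin.append (fun _ : Fin j => (ν : ℂ) • (EuclideanSpace.single o 1 : En n))
      fun l => EuclideanSpace.single (b l) 1) =
      (ν : ℂ) ^ j * taylorEntry f (Fin.append (fun _ : Fin j => o) b) := by
  have h : (Fin.append (fun _ : Fin j => (ν : ℂ) • (EuclideanSpace.single o 1 : En n))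
      fun l => EuclideanSpace.single (b l) 1 : Fin (j + k) → En n) =
      fun l => (Fin.append (fun _ : Fin j => (ν : ℂ)) (fun _ : Fin k => 1) l) •
        (EuclideanSpace.single (Fin.append (fun _ : Fin j => o) b l) 1 : En n) := by
    funext l
    refine Fin.addCases (fun l => ?_) (fun l => ?_) l
    · simp only [Fin.append_left]
    · simp only [Fin.append_right, one_smul]
  unfold taylorForm taylorEntry
  rw [h, ContinuousMultilinearMap.map_smul_univ, Fin.prod_univ_add]
  simp only [Fin.append_left, Fin.append_right, Finset.prod_const, Finset.card_univ,
    Fintype.card_fin, one_pow, mul_one, smul_eq_mul]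
  ring

theorem norm_smul_single {n : ℕ} (o : Fin n) {ν : ℝ} (hν : 0 ≤ ν) :
    ‖(ν : ℂ) • (EuclideanSpace.single o 1 : En n)‖ = ν := by
  rw [norm_smul, PiLp.norm_single, norm_one, mul_one, Complex.norm_real,
    Real.norm_of_nonneg hν]

section Axis

variable {n : ℕ} {f : En n → ℂ} {o : Fin n} {ν : ℝ}

theorem AnalyticOnNhd.hasSum_taylorForm_single (hf : AnalyticOnNhd ℂ f (ball 0 1))
    (hν : 0 ≤ ν) (hν1 : ν < 1) {k : ℕ} (b : Fin k → Fin n) :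
    HasSum (fun j : ℕ => ((j + k).choose k : ℂ) *
      ((ν : ℂ) ^ j * taylorEntry f (Fin.append (fun _ : Fin j => o) b)))
      (taylorForm f ((ν : ℂ) • (EuclideanSpace.single o 1 : En n))
        fun l => EuclideanSpace.single (b l) 1) := by
  simp_rw [← taylorForm_append_single]
  exact hf.hasSum_taylorForm (by rwa [norm_smul_single o hν]) _

theorem AnalyticOnNhd.norm_taylorForm_single_sq_le_of_ne (hn : 0 < n)
    (hf : AnalyticOnNhd ℂ f (ball 0 1)) (hint : IntegrableOn (fun z => ‖f z‖ ^ 2) (ball 0 1))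
    (hν : 0 ≤ ν) (hν1 : ν < 1) {k : ℕ} {b : Fin k → Fin n} {q : Fin k} (hq : b q ≠ o) {G : ℝ}
    (hG : HasSum (fun j : ℕ => ((j + k).choose k : ℝ) ^ 2 * (n + (j + k)).choose n / (j + 1) *
      (ν ^ 2) ^ j) G) :
    ‖taylorForm f ((ν : ℂ) • (EuclideanSpace.single o 1 : En n))
        fun l => EuclideanSpace.single (b l) 1‖ ^ 2 ≤ A2Norm 0 1 f ^ 2 * G := by
  refine (hf.hasSum_taylorForm_single hν hν1 b).norm_sq_le_mul
    (fun j => taylorWeight_nonneg f (j + k)) (fun j => by positivity) (fun j => ?_)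
    (hf.sum_range_taylorWeight_le hn hint k) hG
  have h := (hf 0 (by simp)).succ_mul_norm_taylorEntry_sq_le (j := j) o b hq
  rw [norm_mul, norm_mul, Complex.norm_natCast, norm_pow, Complex.norm_real,
    Real.norm_of_nonneg hν]
  calc _ = ((j + k).choose k : ℝ) ^ 2 * (ν ^ 2) ^ j / (j + 1) *
        (((j : ℝ) + 1) * ‖taylorEntry f (Fin.append (fun _ : Fin j => o) b)‖ ^ 2) := by
        field_simp
        ring
    _ ≤ ((j + k).choose k : ℝ) ^ 2 * (ν ^ 2) ^ j / (j + 1) *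
        (taylorWeight f (j + k) * (n + (j + k)).choose n) := by gcongr
    _ = _ := by ring

theorem norm_taylorEntry_sq_le (f : En n → ℂ) {m : ℕ} (i : Fin m → Fin n) :
    ‖taylorEntry f i‖ ^ 2 ≤ taylorWeight f m * (n + m).choose n := by
  rw [← sum_taylorEntry_sq]
  exact Finset.single_le_sum (f := fun i : Fin m → Fin n => ‖taylorEntry f i‖ ^ 2)
    (fun i _ => by positivity) (Finset.mem_univ i)

theorem AnalyticOnNhd.norm_taylorForm_single_const_sq_le (hn : 0 < n)
    (hf : AnalyticOnNhd ℂ f (ball 0 1)) (hint : IntegrableOn (fun z => ‖f z‖ ^ 2) (ball 0 1))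
    (hν : 0 ≤ ν) (hν1 : ν < 1)
    (h0 : f ((ν : ℂ) • (EuclideanSpace.single o 1 : En n)) = 0) (k : ℕ) (c : ℝ) {G : ℝ}
    (hG : HasSum (fun m : ℕ => (n + m).choose n *
      (m.choose k * ν ^ (m - k) - c * ν ^ m) ^ 2) G) :
    ‖taylorForm f ((ν : ℂ) • (EuclideanSpace.single o 1 : En n))
        fun _ : Fin k => EuclideanSpace.single o 1‖ ^ 2 ≤ A2Norm 0 1 f ^ 2 * G := by
  have hconst : ∀ j k : ℕ, (Fin.append (fun _ : Fin j => o) (fun _ : Fin k => o)) =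
      fun _ => o := fun j k => by
    funext l
    refine Fin.addCases (fun l => ?_) (fun l => ?_) l
    · simp only [Fin.append_left]
    · simp only [Fin.append_right]
  have key : ∀ k : ℕ, HasSum (fun m : ℕ => (m.choose k * (ν : ℂ) ^ (m - k)) *
      taylorEntry f (fun _ : Fin m => o))
      (taylorForm f ((ν : ℂ) • (EuclideanSpace.single o 1 : En n))
        fun _ : Fin k => EuclideanSpace.single o 1) := by
    intro k
    rw [← hasSum_nat_add_iff' k, Finset.sum_eq_zero, sub_zero]
    · refine (hf.hasSum_taylorForm_single hν hν1 fun _ : Fin k => o).congr_fun fun j => ?_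
      rw [hconst, Nat.add_sub_cancel]
      ring
    · intro m hm
      rw [Nat.choose_eq_zero_of_lt (Finset.mem_range.1 hm)]
      simp
  have hk0 := key 0
  have hz : taylorForm f ((ν : ℂ) • (EuclideanSpace.single o 1 : En n))
      (fun _ : Fin 0 => EuclideanSpace.single o 1) = 0 := by
    rw [taylorForm, iteratedFDeriv_zero_apply, h0, mul_zero]
  rw [hz] at hk0
  have h1 := (key k).sub (hk0.mul_left (c : ℂ))
  rw [mul_zero, sub_zero] at h1
  refine h1.norm_sq_le_mul (fun m => taylorWeight_nonneg f m) (fun j => by positivity)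
    (fun m => ?_) (hf.sum_range_taylorWeight_le hn hint 0) hG
  have h2 : (m.choose k * (ν : ℂ) ^ (m - k)) * taylorEntry f (fun _ : Fin m => o) -
      c * ((m.choose 0 * (ν : ℂ) ^ (m - 0)) * taylorEntry f (fun _ : Fin m => o)) =
      ((m.choose k * ν ^ (m - k) - c * ν ^ m : ℝ) : ℂ) * taylorEntry f (fun _ : Fin m => o) := by
    push_cast
    simp
    ring
  rw [h2, norm_mul, mul_pow, Complex.norm_real, Real.norm_eq_abs, sq_abs]
  calc _ ≤ (m.choose k * ν ^ (m - k) - c * ν ^ m) ^ 2 *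
        (taylorWeight f m * (n + m).choose n) := by
        gcongr; exact norm_taylorEntry_sq_le f _
    _ = _ := by ring

theorem hasSum_axis_order_one (n : ℕ) (hν : 0 ≤ ν) (hν1 : ν < 1) :
    HasSum (fun m : ℕ => (n + m).choose n *
      (m.choose 1 * ν ^ (m - 1) - ((n + 1) * ν / (1 - ν ^ 2)) * ν ^ m) ^ 2)
      ((n + 1) / (1 - ν ^ 2) ^ (n + 3)) := by
  have hx0 : 0 ≤ ν ^ 2 := by positivity
  have hx1 : ν ^ 2 < 1 := pow_lt_one₀ hν hν1 two_ne_zero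
  have hx : 1 - ν ^ 2 ≠ 0 := by linarith
  have s := fun k => hasSum_descFactorial_mul_choose n k hx0 hx1
  generalize hc : (n + 1) * ν / (1 - ν ^ 2) = c
  have h := (((s 2).mul_left (ν ^ 2)).add ((s 1).mul_left (1 - 2 * c * ν))).add
    ((s 0).mul_left (c ^ 2))
  refine h.of_eq_of_eq ?_ ?_
  · have h1 : ((n + 1).factorial : ℝ) = (n + 1) * n.factorial := by
      rw [Nat.factorial_succ]; push_cast; ring
    have h2 : ((n + 2).factorial : ℝ) = (n + 2) * ((n + 1) * n.factorial) := by
      rw [Nat.factorial_succ, Nat.cast_mul, h1]; push_cast; ring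
    rw [h1, h2, ← hc]
    have : (n.factorial : ℝ) ≠ 0 := by positivity
    simp only [add_zero]
    field_simp
    ring
  · rintro (_ | _ | m)
    · simp
    · simp [Nat.descFactorial]
      ring
    · simp [Nat.descFactorial]
      ring

theorem hasSum_axis_order_two (hν : 0 ≤ ν) (hν1 : ν < 1) :
    HasSum (fun m : ℕ => (2 + m).choose 2 *
      (m.choose 2 * ν ^ (m - 2) - (6 * ν ^ 2 / (1 - ν ^ 2) ^ 2) * ν ^ m) ^ 2)
      ((48 * ν ^ 2 + 6) / (1 - ν ^ 2) ^ 7) := by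
  have hx0 : 0 ≤ ν ^ 2 := by positivity
  have hx1 : ν ^ 2 < 1 := pow_lt_one₀ hν hν1 two_ne_zero
  have hx : 1 - ν ^ 2 ≠ 0 := by linarith
  have s := fun k => hasSum_descFactorial_mul_choose 2 k hx0 hx1
  generalize hc : 6 * ν ^ 2 / (1 - ν ^ 2) ^ 2 = c
  have h := ((((s 4).mul_left ((ν ^ 2) ^ 2 / 4)).add ((s 3).mul_left (ν ^ 2))).add
    ((s 2).mul_left (1 / 2 - c * ν ^ 2))).add ((s 0).mul_left (c ^ 2))
  refine h.of_eq_of_eq ?_ ?_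
  · rw [← hc]
    norm_num [Nat.factorial]
    field_simp
    ring
  · rintro (_ | _ | _ | _ | m)
    · simp
    · simp [Nat.descFactorial]
      ring
    · simp [Nat.descFactorial]
      ring
    · simp [Nat.descFactorial]
      ring
    · simp [Nat.descFactorial, Nat.cast_choose_two]
      ring

theorem hasSum_transverse_order_one (n : ℕ) (hν : 0 ≤ ν) (hν1 : ν < 1) :
    HasSum (fun j : ℕ => ((j + 1).choose 1 : ℝ) ^ 2 * (n + (j + 1)).choose n / (j + 1) *
      (ν ^ 2) ^ j) ((n + 1) / (1 - ν ^ 2) ^ (n + 2)) := by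
  have hx0 : 0 ≤ ν ^ 2 := by positivity
  have hx1 : ν ^ 2 < 1 := pow_lt_one₀ hν hν1 two_ne_zero
  have s := hasSum_descFactorial_mul_choose n 1 hx0 hx1
  rw [← hasSum_nat_add_iff' 1] at s
  refine s.of_eq_of_eq ?_ ?_
  · rw [Nat.factorial_succ]
    have : (n.factorial : ℝ) ≠ 0 := by positivity
    push_cast
    simp [this]
  · intro j
    simp
    field_simp
    simp

theorem hasSum_transverse_order_two (hν : 0 ≤ ν) (hν1 : ν < 1) :
    HasSum (fun j : ℕ => ((j + 2).choose 2 : ℝ) ^ 2 * (2 + (j + 2)).choose 2 / (j + 1) *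
      (ν ^ 2) ^ j) ((6 + 9 * ν ^ 2) / (1 - ν ^ 2) ^ 6) := by
  have hx1 : ν ^ 2 < 1 := pow_lt_one₀ hν hν1 two_ne_zero
  have hx : 1 - ν ^ 2 ≠ 0 := by linarith
  have hx2 : ‖ν ^ 2‖ < 1 := by rwa [Real.norm_of_nonneg (by positivity)]
  have h := ((hasSum_choose_mul_geometric_of_norm_lt_one 5 hx2).mul_left 15).sub
    ((hasSum_choose_mul_geometric_of_norm_lt_one 4 hx2).mul_left 9)
  refine h.of_eq_of_eq ?_ ?_
  · field_simp
    ring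
  · intro j
    have h5 : ((j + 5).choose 5 : ℝ) = (j + 5) * (j + 4) * (j + 3) * (j + 2) * (j + 1) / 120 := by
      rw [cast_add_choose_right]
      simp only [Nat.factorial_succ]
      push_cast
      field_simp
      norm_num
      ring
    have h4 : ((j + 4).choose 4 : ℝ) = (j + 4) * (j + 3) * (j + 2) * (j + 1) / 24 := by
      rw [cast_add_choose_right]
      simp only [Nat.factorial_succ]
      push_cast
      field_simp
      norm_num
      ring
    rw [h4, h5, Nat.cast_choose_two, Nat.cast_choose_two]
    push_cast
    field_simp
    ring

end Axis

theorem AnalyticOnNhd.norm_taylorForm_axis_sq_le {n k : ℕ} (hn : 2 ≤ n) (hk : 1 ≤ k)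
    {f : En n → ℂ} {o : Fin n} {ν : ℝ}
    (hf : AnalyticOnNhd ℂ f (ball 0 1)) (hint : IntegrableOn (fun z => ‖f z‖ ^ 2) (ball 0 1))
    (hν : 0 ≤ ν) (hν1 : ν < 1)
    (h0 : f ((ν : ℂ) • (EuclideanSpace.single o 1 : En n)) = 0) (v : Fin k → En n) :
    ‖taylorForm f ((ν : ℂ) • (EuclideanSpace.single o 1 : En n)) v‖ ^ 2 ≤ A2Norm 0 1 f ^ 2 *
      (((n : ℝ) + 1) ^ (2 * k) / (1 - ν ^ 2) ^ (n + 1 + 2 * k) * ∏ l, ‖v l‖ ^ 2) := by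
  have hx0 : 0 ≤ ν ^ 2 := by positivity
  have hx1 : 0 < 1 - ν ^ 2 := sub_pos.2 (pow_lt_one₀ hν hν1 two_ne_zero)
  have hpos : 0 < n := by omega
  by_cases hbig : 2 ≤ k ∧ (3 ≤ n ∨ 3 ≤ k)
  · have h := hf.norm_taylorForm_sq_le_of_three_le hn hbig.1 hbig.2 hint
      (z := (ν : ℂ) • (EuclideanSpace.single o 1 : En n)) (by rwa [norm_smul_single o hν]) v
    rwa [norm_smul_single o hν] at h
  refine (norm_taylorForm_sq_le_sum f _ v).trans ?_
  rw [← mul_assoc]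
  refine mul_le_mul_of_nonneg_right ?_ (by positivity)
  have hcase : k = 1 ∨ (k = 2 ∧ n = 2) := by omega
  rcases hcase with rfl | ⟨rfl, rfl⟩
  · calc _ ≤ ∑ _b : Fin 1 → Fin n, A2Norm 0 1 f ^ 2 * ((n + 1) / (1 - ν ^ 2) ^ (n + 3)) := by
          refine Finset.sum_le_sum fun b _ => ?_
          by_cases hb : b 0 = o
          · obtain rfl : b = fun _ => o := funext fun l => by rw [Subsingleton.elim l 0, hb]
            exact hf.norm_taylorForm_single_const_sq_le hpos hint hν hν1 h0 1 _
              (hasSum_axis_order_one n hν hν1)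
          · refine (hf.norm_taylorForm_single_sq_le_of_ne hpos hint hν hν1 hb
              (hasSum_transverse_order_one n hν hν1)).trans ?_
            refine mul_le_mul_of_nonneg_left ?_ (by positivity)
            refine div_le_div_of_nonneg_left (by positivity) (by positivity) ?_
            exact pow_le_pow_of_le_one hx1.le (by linarith) (by omega)
      _ = A2Norm 0 1 f ^ 2 * ((n * (n + 1)) / (1 - ν ^ 2) ^ (n + 3)) := by
          simp
          ring
      _ ≤ A2Norm 0 1 f ^ 2 * (((n : ℝ) + 1) ^ (2 * 1) / (1 - ν ^ 2) ^ (n + 1 + 2 * 1)) := by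
          rw [show n + 1 + 2 * 1 = n + 3 by ring]
          have hn0 : (0 : ℝ) ≤ n := n.cast_nonneg
          gcongr
          rw [mul_one, sq]
          nlinarith
  · set D : ℝ := A2Norm 0 1 f ^ 2 / (1 - ν ^ 2) ^ 7 with hD
    have hD0 : 0 ≤ D := by positivity
    calc _ ≤ ∑ b : Fin 2 → Fin 2, (9 * D + if b = (fun _ => o) then 45 * D else 0) := by
          refine Finset.sum_le_sum fun b _ => ?_
          split_ifs with hb
          · subst hb
            refine (hf.norm_taylorForm_single_const_sq_le hpos hint hν hν1 h0 2 _
              (hasSum_axis_order_two hν hν1)).trans ?_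
            rw [hD, ← mul_div_assoc, ← mul_div_assoc, ← mul_div_assoc, ← add_div]
            gcongr
            nlinarith [sq_nonneg (A2Norm 0 1 f)]
          · obtain ⟨q, hq⟩ := Function.ne_iff.1 hb
            refine (hf.norm_taylorForm_single_sq_le_of_ne hpos hint hν hν1 hq
              (hasSum_transverse_order_two hν hν1)).trans ?_
            have : (6 + 9 * ν ^ 2) / (1 - ν ^ 2) ^ 6 ≤ 9 / (1 - ν ^ 2) ^ 7 := by
              rw [div_le_div_iff₀ (by positivity) (by positivity), pow_succ _ 6]
              have h9 : (6 + 9 * ν ^ 2) * (1 - ν ^ 2) ≤ 9 := by nlinarith [sq_nonneg (ν ^ 2)]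
              nlinarith [mul_le_mul_of_nonneg_right h9 (pow_nonneg hx1.le 6)]
            calc _ ≤ A2Norm 0 1 f ^ 2 * (9 / (1 - ν ^ 2) ^ 7) := by gcongr
              _ = _ := by rw [hD]; ring
      _ = 81 * D := by
          rw [Finset.sum_add_distrib, Finset.sum_ite_eq' Finset.univ (fun _ : Fin 2 => o)]
          simp
          ring
      _ = _ := by
          rw [hD]
          norm_num
          ring

theorem exists_linearIsometryEquiv_single_eq {n : ℕ} (o : Fin n) {u : En n} (hu : ‖u‖ = 1) :
    ∃ e : En n ≃ₗᵢ[ℂ] En n, e (EuclideanSpace.single o 1) = u := by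
  have hon : Orthonormal ℂ (({o} : Set (Fin n)).domRestrict fun _ => u) := by
    refine ⟨fun _ => hu, fun i j hij => absurd (Subsingleton.elim i j) hij⟩
  obtain ⟨b, hb⟩ := hon.exists_orthonormalBasis_extension_of_card_eq (by simp)
  exact ⟨b.repr.symm, by rw [b.repr_symm_single]; exact hb o rfl⟩

theorem exists_linearIsometryEquiv_norm_smul_single_eq {n : ℕ} (o : Fin n) (w : En n) :
    ∃ e : En n ≃ₗᵢ[ℂ] En n, e ((‖w‖ : ℂ) • EuclideanSpace.single o 1) = w := by
  rcases eq_or_ne w 0 with rfl | hw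
  · exact ⟨LinearIsometryEquiv.refl ℂ _, by simp⟩
  · have hw' : (‖w‖ : ℂ) ≠ 0 := by exact_mod_cast norm_ne_zero_iff.2 hw
    obtain ⟨e, he⟩ := exists_linearIsometryEquiv_single_eq o (u := (‖w‖ : ℂ)⁻¹ • w) (by
      rw [norm_smul, norm_inv, Complex.norm_real, norm_norm, inv_mul_cancel₀ (norm_ne_zero_iff.2 hw)])
    exact ⟨e, by rw [map_smul, he, smul_inv_smul₀ hw']⟩

section Affine

variable {n : ℕ} (ω : En n) {R : ℝ} (e : En n ≃ₗᵢ[ℂ] En n)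

theorem indicator_ball_comp_affine (hR : 0 < R) {G : Type*} [Zero G] (g : En n → G) :
    ((ball (0 : En n) 1).indicator fun y => g (ω + R • e y)) =
      fun y => (ball ω R).indicator g (ω + R • e y) := by
  funext y
  have h : y ∈ ball (0 : En n) 1 ↔ ω + R • e y ∈ ball ω R := by
    rw [mem_ball_zero_iff, mem_ball_iff_norm, add_sub_cancel_left, norm_smul, e.norm_map,
      Real.norm_of_nonneg hR.le, mul_lt_iff_lt_one_right hR]
  by_cases hy : y ∈ ball (0 : En n) 1
  · rw [Set.indicator_of_mem hy, Set.indicator_of_mem (h.1 hy)]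
  · rw [Set.indicator_of_notMem hy, Set.indicator_of_notMem (mt h.2 hy)]

theorem integrableOn_ball_comp_affine (hR : 0 < R) {g : En n → ℝ} (hg : IntegrableOn g (ball ω R)) :
    IntegrableOn (fun y => g (ω + R • e y)) (ball 0 1) := by
  rw [← integrable_indicator_iff measurableSet_ball] at hg ⊢
  rw [indicator_ball_comp_affine ω e hR]
  have h : MeasurePreserving e (volume : Measure (En n)) volume :=
    LinearIsometryEquiv.measurePreserving
      ({ e.toLinearEquiv.restrictScalars ℝ with norm_map' := e.norm_map } : En n ≃ₗᵢ[ℝ] En n)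
  exact (h.integrable_comp_emb e.toHomeomorph.measurableEmbedding).2
    ((integrable_comp_smul_iff volume _ hR.ne').2 (hg.comp_add_left ω))

theorem setIntegral_ball_comp_affine (hR : 0 < R) (g : En n → ℝ) :
    ∫ y in ball (0 : En n) 1, g (ω + R • e y) = (R ^ (2 * n))⁻¹ * ∫ z in ball ω R, g z := by
  rw [← integral_indicator measurableSet_ball, ← integral_indicator measurableSet_ball,
    indicator_ball_comp_affine ω e hR]
  have h : MeasurePreserving e (volume : Measure (En n)) volume :=
    LinearIsometryEquiv.measurePreserving
      ({ e.toLinearEquiv.restrictScalars ℝ with norm_map' := e.norm_map } : En n ≃ₗᵢ[ℝ] En n)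
  rw [h.integral_comp e.toHomeomorph.measurableEmbedding
      (fun y => (ball ω R).indicator g (ω + R • y)),
    Measure.integral_comp_smul volume (fun y => (ball ω R).indicator g (ω + y)) R,
    integral_add_left_eq_self, finrank_real_En, smul_eq_mul, abs_of_pos (by positivity)]

theorem A2Norm_comp_affine (hR : 0 < R) {G : Type*} [NormedAddCommGroup G] (g : En n → G) :
    A2Norm 0 1 (fun y => g (ω + R • e y)) = A2Norm ω R g := by
  unfold A2Norm
  rw [setIntegral_ball_comp_affine ω e hR fun z => ‖g z‖ ^ 2]
  congr 1
  rw [one_pow]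
  field_simp

theorem iteratedFDeriv_comp_affine {G : Type*} [NormedAddCommGroup G] [NormedSpace ℂ G]
    (hR : R ≠ 0) (g : En n → G) (k : ℕ) (y : En n) (v : Fin k → En n) :
    iteratedFDeriv ℂ k (fun y => g (ω + R • e y)) y v =
      iteratedFDeriv ℂ k g (ω + R • e y) fun l => R • e (v l) := by
  have hRc : (R : ℂ) ≠ 0 := by exact_mod_cast hR
  set A : En n ≃L[ℂ] En n :=
    e.toContinuousLinearEquiv.trans (ContinuousLinearEquiv.smulLeft (Units.mk0 (R : ℂ) hRc))
  have hA : ∀ y, A y = R • e y := fun y => by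
    change (R : ℂ) • e y = R • e y
    exact Complex.coe_smul R _
  have h := A.iteratedFDerivWithin_comp_right (fun y => g (ω + y)) (x := y) uniqueDiffOn_univ
    (Set.mem_univ _) k
  rw [Set.preimage_univ, iteratedFDerivWithin_univ, iteratedFDerivWithin_univ,
    iteratedFDeriv_comp_add_left] at h
  have h2 := congrArg (fun T => T v) h
  simpa only [Function.comp_def, hA, ContinuousMultilinearMap.compContinuousLinearMap_apply,
    ContinuousLinearEquiv.coe_coe] using h2

end Affine

section Bound

variable {n : ℕ} {ω ζ : En n} {R : ℝ}

theorem MemA2.norm_taylorForm_sq_le {k : ℕ} (hn : 2 ≤ n) (hk : 1 ≤ k) (hR : 0 < R)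
    {f : En n → ℂ} (hf : MemA2 ω R f) (hζ : ζ ∈ ball ω R) (h0 : f ζ = 0) (v : Fin k → En n) :
    ‖taylorForm f ζ v‖ ^ 2 ≤ A2Norm ω R f ^ 2 *
      (((n : ℝ) + 1) ^ (2 * k) / (1 - (‖ζ - ω‖ / R) ^ 2) ^ (n + 1 + 2 * k) *
        ∏ l, (‖v l‖ / R) ^ 2) := by
  set ν : ℝ := ‖ζ - ω‖ / R with hνdef
  have hν : 0 ≤ ν := by positivity
  have hν1 : ν < 1 := by rwa [hνdef, div_lt_one hR, ← mem_ball_iff_norm]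
  set o : Fin n := ⟨0, by omega⟩
  obtain ⟨e, he⟩ := exists_linearIsometryEquiv_norm_smul_single_eq o (R⁻¹ • (ζ - ω))
  have hnorm : ‖R⁻¹ • (ζ - ω)‖ = ν := by
    rw [norm_smul, norm_inv, Real.norm_of_nonneg hR.le, hνdef]; ring
  rw [hnorm] at he
  have hpt : ω + R • e ((ν : ℂ) • (EuclideanSpace.single o 1 : En n)) = ζ := by
    rw [he, smul_inv_smul₀ hR.ne', add_sub_cancel]
  have hg : AnalyticOnNhd ℂ (fun y => f (ω + R • e y)) (ball 0 1) := by
    intro y hy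
    have hy' : ω + R • e y ∈ ball ω R := by
      rw [mem_ball_iff_norm, add_sub_cancel_left, norm_smul, e.norm_map,
        Real.norm_of_nonneg hR.le]
      rw [mem_ball_zero_iff] at hy
      nlinarith
    have hA : AnalyticAt ℂ (fun y => ω + (R : ℂ) • e y) y :=
      analyticAt_const.add
        (((R : ℂ) • (e.toContinuousLinearEquiv : En n →L[ℂ] En n)).analyticAt y)
    simp_rw [Complex.coe_smul] at hA
    exact AnalyticAt.fun_comp (f := fun y => ω + R • e y) (hf.1 _ hy') hA
  have h := hg.norm_taylorForm_axis_sq_le hn hk (o := o)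
    (integrableOn_ball_comp_affine ω e hR hf.2) hν hν1 (by rw [hpt, h0])
    (fun l => R⁻¹ • e.symm (v l))
  rw [A2Norm_comp_affine ω e hR f] at h
  have hT : taylorForm (fun y => f (ω + R • e y)) ((ν : ℂ) • (EuclideanSpace.single o 1 : En n))
      (fun l => R⁻¹ • e.symm (v l)) = taylorForm f ζ v := by
    unfold taylorForm
    rw [iteratedFDeriv_comp_affine ω e hR.ne', hpt]
    congr 2
    funext l
    have : e (R⁻¹ • e.symm (v l)) = R⁻¹ • v l := by
      rw [← Complex.coe_smul, map_smul, e.apply_symm_apply, Complex.coe_smul]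
    rw [this, smul_inv_smul₀ hR.ne']
  rw [hT] at h
  refine h.trans_eq ?_
  congr 3
  funext l
  rw [norm_smul, norm_inv, Real.norm_of_nonneg hR.le, e.symm.norm_map, div_eq_inv_mul]

theorem A2Norm_sq {G : Type*} [NormedAddCommGroup G] (hR : 0 < R) (f : En n → G) :
    A2Norm ω R f ^ 2 = (n.factorial : ℝ) / (Real.pi ^ n * R ^ (2 * n)) *
      ∫ z in ball ω R, ‖f z‖ ^ 2 :=
  Real.sq_sqrt (by positivity)

theorem MemA2.norm_iteratedFDeriv_le {s k : ℕ} (hn : 2 ≤ n) (hk : 1 ≤ k) (hR : 0 < R)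
    {F : En n → En s} (hF : MemA2 ω R F) (hζ : ζ ∈ ball ω R) (h0 : F ζ = 0) :
    1 / (k.factorial : ℝ) * ‖iteratedFDeriv ℂ k F ζ‖ ≤
      A2Norm ω R F / (1 - (‖ζ - ω‖ / R) ^ 2) ^ (((n : ℝ) + 1) / 2) *
        (((n : ℝ) + 1) / (R * (1 - (‖ζ - ω‖ / R) ^ 2))) ^ k := by
  have hν1 : ‖ζ - ω‖ / R < 1 := by rwa [div_lt_one hR, ← mem_ball_iff_norm]
  have hx : 0 < 1 - (‖ζ - ω‖ / R) ^ 2 :=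
    sub_pos.2 (pow_lt_one₀ (by positivity) hν1 two_ne_zero)
  set x := 1 - (‖ζ - ω‖ / R) ^ 2
  set B : ℝ := A2Norm ω R F / x ^ (((n : ℝ) + 1) / 2) * (((n : ℝ) + 1) / (R * x)) ^ k with hB
  have hA0 : 0 ≤ A2Norm ω R F := Real.sqrt_nonneg _
  have hB0 : 0 ≤ B := by positivity
  have hkf : (0 : ℝ) < k.factorial := by positivity
  have hBsq : B ^ 2 = A2Norm ω R F ^ 2 * (((n : ℝ) + 1) ^ (2 * k) / x ^ (n + 1 + 2 * k) *
      (R⁻¹ ^ 2) ^ k) := by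
    have hr : (x ^ (((n : ℝ) + 1) / 2)) ^ 2 = x ^ (n + 1) := by
      rw [← Real.rpow_natCast, ← Real.rpow_mul hx.le, ← Real.rpow_natCast]
      congr 1
      push_cast
      ring
    rw [hB, mul_pow, div_pow, hr, ← pow_mul, mul_comm k 2, div_pow, mul_pow, ← pow_mul, inv_pow]
    field_simp
    ring
  rw [one_div, inv_mul_le_iff₀ hkf]
  refine ContinuousMultilinearMap.opNorm_le_bound (by positivity) fun v => ?_
  set w := iteratedFDeriv ℂ k F ζ v with hw
  rcases eq_or_ne w 0 with hw0 | hw0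
  · rw [hw0, norm_zero]; positivity
  have hw0' : 0 < ‖w‖ := norm_pos_iff.2 hw0
  set f : En n → ℂ := fun z => inner ℂ w (F z) with hf_def
  have hfF : ∀ z, ‖f z‖ ^ 2 ≤ ‖w‖ ^ 2 * ‖F z‖ ^ 2 := fun z => by
    rw [← mul_pow]
    gcongr
    exact norm_inner_le_norm w (F z)
  have hfan : AnalyticOnNhd ℂ f (ball ω R) := fun z hz =>
    ((innerSL ℂ w).analyticAt _).comp (hF.1 z hz)
  have hfint : IntegrableOn (fun z => ‖f z‖ ^ 2) (ball ω R) := by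
    refine (hF.2.const_mul (‖w‖ ^ 2)).mono'
      ((hfan.continuousOn.norm.pow 2).aestronglyMeasurable measurableSet_ball)
      (Filter.Eventually.of_forall fun z => ?_)
    rw [Real.norm_of_nonneg (by positivity)]
    exact hfF z
  have hN : A2Norm ω R f ^ 2 ≤ ‖w‖ ^ 2 * A2Norm ω R F ^ 2 := by
    rw [A2Norm_sq hR, A2Norm_sq hR, mul_left_comm,
      ← integral_const_mul (‖w‖ ^ 2)]
    exact mul_le_mul_of_nonneg_left (setIntegral_mono hfint (hF.2.const_mul _) hfF) (by positivity)
  have hTf : taylorForm f ζ v = (k.factorial : ℂ)⁻¹ * inner ℂ w w := by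
    have h := (innerSL ℂ w).iteratedFDeriv_comp_left (f := F) (x := ζ) (n := ⊤)
      (hF.1 ζ hζ).contDiffAt (i := k) (by exact_mod_cast le_top)
    have h2 := congrArg (fun T => T v) h
    unfold taylorForm
    congr 1
  have h := MemA2.norm_taylorForm_sq_le hn hk hR ⟨hfan, hfint⟩ hζ
    (by rw [hf_def]; simp [h0]) v
  have hT : ‖taylorForm f ζ v‖ = (k.factorial : ℝ)⁻¹ * ‖w‖ ^ 2 := by
    rw [hTf, inner_self_eq_norm_sq_to_K]
    simp
  have hprod : ∏ l, (‖v l‖ / R) ^ 2 = (R⁻¹ ^ 2) ^ k * (∏ l, ‖v l‖) ^ 2 := by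
    simp_rw [div_eq_inv_mul, mul_pow, Finset.prod_mul_distrib, Finset.prod_pow]
    rw [Finset.prod_const, Finset.card_univ, Fintype.card_fin, ← pow_mul, ← pow_mul, mul_comm 2 k]
  rw [hT, hprod] at h
  have hfin : ((k.factorial : ℝ)⁻¹ * ‖w‖ ^ 2) ^ 2 ≤ (‖w‖ * (B * ∏ l, ‖v l‖)) ^ 2 := by
    refine h.trans ?_
    rw [mul_pow, mul_pow, hBsq]
    calc _ ≤ ‖w‖ ^ 2 * A2Norm ω R F ^ 2 * (((n : ℝ) + 1) ^ (2 * k) / x ^ (n + 1 + 2 * k) *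
          ((R⁻¹ ^ 2) ^ k * (∏ l, ‖v l‖) ^ 2)) := by gcongr
      _ = _ := by ring
  have h3 := le_of_sq_le_sq hfin (by positivity)
  rw [inv_mul_le_iff₀ hkf] at h3
  refine le_of_mul_le_mul_left ?_ hw0'
  nlinarith

end Bound

/-- Let `F ∈ A²(ω,R)^s`, `ζ ∈ B(ω,R)` and `p ≥ 1`, and suppose `D^k F(ζ) = 0` for all
`0 ≤ k < p`.  With `λ = ‖F‖/(1−ν_ζ²)^{(n+1)/2}` and `κ = κ_ζ`, for every `x ∈ ℂⁿ` with
`u := κ‖x−ζ‖ < 1` one has `[F]_ζ(x) = Σ_{k≥0} (1/k!)‖D^k F(ζ)‖‖x−ζ‖^k ≤ λu^p/(1−u)`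
(in particular the series converges). -/
theorem stmt16 (n s : ℕ) (hn : 2 ≤ n) (ω : En n) (R : ℝ) (hR : 0 < R)
    (F : En n → En s) (hF : MemA2 ω R F)
    (ζ : En n) (hζ : ζ ∈ ball ω R) (p : ℕ) (hp : 1 ≤ p)
    (hvan : ∀ k : ℕ, k < p → iteratedFDeriv ℂ k F ζ = 0) :
    let ν : ℝ := ‖ζ - ω‖ / R
    let κ : ℝ := max 1 (((n : ℝ) + 1) / (R * (1 - ν ^ 2)))
    let lam : ℝ := A2Norm ω R F / (1 - ν ^ 2) ^ (((n : ℝ) + 1) / 2)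
    ∀ x : En n, κ * ‖x - ζ‖ < 1 →
      Summable (fun k : ℕ =>
        (1 / (k.factorial : ℝ)) * ‖iteratedFDeriv ℂ k F ζ‖ * ‖x - ζ‖ ^ k) ∧
      (∑' k : ℕ, (1 / (k.factorial : ℝ)) * ‖iteratedFDeriv ℂ k F ζ‖ * ‖x - ζ‖ ^ k) ≤
        lam * (κ * ‖x - ζ‖) ^ p / (1 - κ * ‖x - ζ‖) := by
  intro ν κ lam x hu
  have hν1 : ν < 1 := by rwa [div_lt_one hR, ← mem_ball_iff_norm]
  have hν : 0 ≤ ν := by positivity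
  have hx : 0 < 1 - ν ^ 2 := sub_pos.2 (pow_lt_one₀ hν hν1 two_ne_zero)
  have hlam : 0 ≤ lam := div_nonneg (Real.sqrt_nonneg _) (by positivity)
  have h0 : F ζ = 0 := by
    have h := congrArg (fun T => T (fun _ => 0)) (hvan 0 hp)
    simpa only [iteratedFDeriv_zero_apply, zero_apply] using h
  have hu0 : 0 ≤ κ * ‖x - ζ‖ := by positivity
  set a : ℕ → ℝ := fun k => (1 / (k.factorial : ℝ)) * ‖iteratedFDeriv ℂ k F ζ‖ * ‖x - ζ‖ ^ k
    with ha
  have ha0 : ∀ k, 0 ≤ a k := fun k => by positivity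
  have hsmall : ∑ k ∈ Finset.range p, a k = 0 := Finset.sum_eq_zero fun k hk => by
    simp [ha, hvan k (Finset.mem_range.1 hk)]
  have hle : ∀ k, a (k + p) ≤ lam * (κ * ‖x - ζ‖) ^ p * (κ * ‖x - ζ‖) ^ k := fun k => by
    have h := hF.norm_iteratedFDeriv_le (k := k + p) hn (by omega) hR hζ h0
    calc a (k + p) ≤ lam * κ ^ (k + p) * ‖x - ζ‖ ^ (k + p) := by
          refine mul_le_mul_of_nonneg_right (h.trans ?_) (by positivity)
          refine mul_le_mul_of_nonneg_left ?_ hlam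
          exact pow_le_pow_left₀ (by positivity) (le_max_right _ _) _
      _ = _ := by ring
  have hgeo := (hasSum_geometric_of_lt_one hu0 hu).mul_left (lam * (κ * ‖x - ζ‖) ^ p)
  have hs : Summable fun k => a (k + p) := .of_nonneg_of_le (fun k => ha0 _) hle hgeo.summable
  have hs' : Summable a := (summable_nat_add_iff p).1 hs
  refine ⟨hs', ?_⟩
  rw [← hs'.sum_add_tsum_nat_add p, hsmall, zero_add, div_eq_mul_inv, ← hgeo.tsum_eq]
  exact hs.tsum_le_tsum hle hgeo.summable
end
end
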